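/- arXiv:1409.2229 — 6 statements merged into one kernel-verified Lean document; each statement's English description precedes it below -/
import Mathlib

section
/- Let X and Y be smooth vector fields defined on an open neighborhood of the origin in ℝ³ such that X(p) and Y(p) are linearly independent for every p in that neighborhood. Then there exist an open neighborhood W of the origin, a smooth diffeomorphism Φ from W onto an open subset of ℝ³ (target coordinates denoted (x,a,b)), smooth nowhere-vanishing real functions μ, λ on Φ(W), and a smooth function ψ on Φ(W), such that the pushforwards satisfy Φ_*X = μ·∂_x and Φ_*Y = λ·(∂_b + ψ·∂_a). -/
open Set Filter Topology
open scoped unitInterval ContDiff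

/-- Pointwise application as a continuous bilinear map on spaces of continuous curves. -/
noncomputable def curveApply (E F : Type) [NormedAddCommGroup E] [NormedSpace ℝ E]
    [NormedAddCommGroup F] [NormedSpace ℝ F] :
    C(I, E →L[ℝ] F) →L[ℝ] C(I, E) →L[ℝ] C(I, F) :=
  LinearMap.mkContinuous₂
    (LinearMap.mk₂ ℝ (fun (A : C(I, E →L[ℝ] F)) (h : C(I, E)) =>
        (⟨fun t => A t (h t), A.continuous.clm_apply h.continuous⟩ : C(I, F)))
      (by intros; ext; simp) (by intros; ext; simp) (by intros; ext; simp) (by intros; ext; simp))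
    1 (by
      intro A h
      rw [ContinuousMap.norm_le _ (by positivity)]
      intro t
      simp only [LinearMap.mk₂_apply, ContinuousMap.coe_mk, one_mul]
      exact (A t).le_of_opNorm_le_of_le (A.norm_coe_le_norm t) (h.norm_coe_le_norm t))

@[simp] lemma curveApply_apply {E F : Type} [NormedAddCommGroup E] [NormedSpace ℝ E]
    [NormedAddCommGroup F] [NormedSpace ℝ F] (A : C(I, E →L[ℝ] F)) (h : C(I, E)) (t : I) :
    curveApply E F A h t = A t (h t) := rfl

lemma curveComp_hasFDerivAt {E F : Type} [NormedAddCommGroup E] [NormedSpace ℝ E]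
    [NormedAddCommGroup F] [NormedSpace ℝ F] (f : C(E, F)) (f' : C(E, E →L[ℝ] F))
    (hf : ∀ x, HasFDerivAt f (f' x) x) (γ : C(I, E)) :
    HasFDerivAt (fun g : C(I, E) => f.comp g) (curveApply E F (f'.comp γ)) γ := by
  rw [hasFDerivAt_iff_isLittleO_nhds_zero, Asymptotics.isLittleO_iff]
  intro c hc
  have hcont : ContinuousAt (fun g : C(I, E) => f'.comp g) γ :=
    (ContinuousMap.continuous_postcomp f').continuousAt
  obtain ⟨δ, hδ, H⟩ := (Metric.continuousAt_iff (α := C(I, E)) (β := C(I, E →L[ℝ] F))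
    (f := fun g : C(I, E) => f'.comp g) (a := γ)).1 hcont c hc
  have key : ∀ (t : I), ∀ z ∈ Metric.ball (γ t) δ, ‖f' z - f' (γ t)‖ ≤ c := by
    intro t z hz
    have h1 : dist (γ + ContinuousMap.const I (z - γ t)) γ < δ := by
      rw [dist_eq_norm, add_sub_cancel_left]
      refine lt_of_le_of_lt ((ContinuousMap.norm_le _ (norm_nonneg (z - γ t))).2 ?_)
        (mem_ball_iff_norm.1 hz)
      intro x; simp
    have h2 := (ContinuousMap.dist_apply_le_dist t).trans (H h1).le
    simpa [dist_eq_norm] using h2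
  filter_upwards [Metric.ball_mem_nhds (0 : C(I, E)) hδ] with h hh
  rw [ContinuousMap.norm_le _ (by positivity)]
  intro t
  have hht : ‖h t‖ < δ := lt_of_le_of_lt (h.norm_coe_le_norm t) (by simpa using hh)
  have := (convex_ball (γ t) δ).norm_image_sub_le_of_norm_hasFDerivWithin_le' (𝕜 := ℝ)
    (f := f) (f' := f') (φ := f' (γ t)) (C := c) (x := γ t) (y := γ t + h t)
    (fun x _ => (hf x).hasFDerivWithinAt) (key t) (Metric.mem_ball_self hδ)
    (by simpa [mem_ball_iff_norm] using hht)
  simp only [add_sub_cancel_left] at this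
  refine (le_trans (le_of_eq ?_) this).trans ?_
  · simp
  · gcongr; exact h.norm_coe_le_norm t

lemma curveComp_contDiff_nat {E : Type} [NormedAddCommGroup E] [NormedSpace ℝ E] (n : ℕ) :
    ∀ {F : Type} [NormedAddCommGroup F] [NormedSpace ℝ F] (f : C(E, F)), ContDiff ℝ ∞ f →
    ContDiff ℝ n (fun g : C(I, E) => f.comp g) := by
  induction n with
  | zero =>
    intro F _ _ f hf
    exact contDiff_zero.2 (ContinuousMap.continuous_postcomp f)
  | succ n ih =>
    intro F _ _ f hf
    have hf' : ContDiff ℝ ∞ (fderiv ℝ f) := hf.fderiv_right (m := ∞) (by simp)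
    let f' : C(E, E →L[ℝ] F) := ⟨fderiv ℝ f, hf'.continuous⟩
    have := ih f' hf'
    push_cast
    rw [contDiff_succ_iff_hasFDerivAt]
    have hB : ContDiff ℝ n (fun A : C(I, E →L[ℝ] F) => curveApply E F A) :=
      (IsLinearMap.with_bound (𝕜 := ℝ) (E := C(I, E →L[ℝ] F)) (F := C(I, E) →L[ℝ] C(I, F))
        (f := fun A => curveApply E F A)
        ⟨fun A B => by ext; simp, fun c A => by ext; simp⟩ 1 (fun A => by
          refine ContinuousLinearMap.opNorm_le_bound _ (by positivity) fun h => ?_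
          rw [ContinuousMap.norm_le _ (by positivity)]
          intro t
          rw [curveApply_apply, one_mul]
          exact (A t).le_of_opNorm_le_of_le (A.norm_coe_le_norm t) (h.norm_coe_le_norm t))).contDiff
    refine ⟨fun γ => curveApply E F (f'.comp γ), hB.comp this, fun γ => ?_⟩
    exact curveComp_hasFDerivAt f f' (fun x => (hf.differentiable (by simp) x).hasFDerivAt) γ

lemma curveComp_contDiff {E F : Type} [NormedAddCommGroup E] [NormedSpace ℝ E]
    [NormedAddCommGroup F] [NormedSpace ℝ F] (f : C(E, F)) (hf : ContDiff ℝ ∞ f) :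
    ContDiff ℝ ∞ (fun g : C(I, E) => f.comp g) :=
  contDiff_infty.2 fun n => curveComp_contDiff_nat n f hf

/-- Constant curves. -/
noncomputable def curveConst (E : Type) [NormedAddCommGroup E] [NormedSpace ℝ E] :
    E →L[ℝ] C(I, E) :=
  LinearMap.mkContinuous
    { toFun := fun y => ContinuousMap.const I y
      map_add' := by intros; ext; simp
      map_smul' := by intros; ext; simp } 1 (by
      intro y
      rw [ContinuousMap.norm_le _ (by positivity)]
      intro t; simp)

@[simp] lemma curveConst_apply {E : Type} [NormedAddCommGroup E] [NormedSpace ℝ E] (y : E) (t : I) :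
    curveConst E y t = y := rfl

lemma curveExt_continuous {E : Type} [NormedAddCommGroup E] (g : C(I, E)) :
    Continuous (fun u : ℝ => g (projIcc 0 1 zero_le_one u)) :=
  g.continuous.comp continuous_projIcc

/-- Integration of curves. -/
noncomputable def curveInt (E : Type) [NormedAddCommGroup E] [NormedSpace ℝ E] :
    C(I, E) →L[ℝ] C(I, E) :=
  LinearMap.mkContinuous
    { toFun := fun g => ⟨fun s : I => ∫ u in (0 : ℝ)..s, g (projIcc 0 1 zero_le_one u),
        (intervalIntegral.continuous_primitive
          (fun a b => (curveExt_continuous g).intervalIntegrable a b) 0).comp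
          continuous_subtype_val⟩
      map_add' := by
        intro g h; ext s
        simpa using intervalIntegral.integral_add ((curveExt_continuous g).intervalIntegrable 0 s)
          ((curveExt_continuous h).intervalIntegrable 0 s)
      map_smul' := by
        intro c g; ext s
        simp } 1 (by
      intro g
      rw [ContinuousMap.norm_le _ (by positivity)]
      intro s
      refine (intervalIntegral.norm_integral_le_of_norm_le_const (C := ‖g‖)
        (fun x _ => g.norm_coe_le_norm _)).trans ?_
      rw [sub_zero, abs_of_nonneg s.2.1, one_mul]
      exact mul_le_of_le_one_right (norm_nonneg _) s.2.2)

lemma curveInt_apply {E : Type} [NormedAddCommGroup E] [NormedSpace ℝ E] (g : C(I, E)) (s : I) :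
    curveInt E g s = ∫ u in (0 : ℝ)..s, g (projIcc 0 1 zero_le_one u) := rfl

lemma curveInt_norm_le {E : Type} [NormedAddCommGroup E] [NormedSpace ℝ E] (g : C(I, E)) :
    ‖curveInt E g‖ ≤ ‖g‖ := by
  simpa using (curveInt E).le_of_opNorm_le
    (LinearMap.mkContinuous_norm_le _ zero_le_one _) g

/-- The Picard operator, as a map of parameters (time scale, initial point) and curve. -/
noncomputable def picOp {E : Type} [NormedAddCommGroup E] [NormedSpace ℝ E] (X : C(E, E))
    (p : (ℝ × E) × C(I, E)) : C(I, E) :=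
  curveConst E p.1.2 + p.1.1 • curveInt E (X.comp p.2)

lemma picOp_contDiff {E : Type} [NormedAddCommGroup E] [NormedSpace ℝ E] (X : C(E, E))
    (hX : ContDiff ℝ ∞ X) : ContDiff ℝ ∞ (picOp X) := by
  unfold picOp
  have h1 : ContDiff ℝ ∞ (fun p : (ℝ × E) × C(I, E) => curveInt E (X.comp p.2)) :=
    (curveInt E).contDiff.comp ((curveComp_contDiff X hX).comp contDiff_snd)
  have h2 : ContDiff ℝ ∞ (fun p : (ℝ × E) × C(I, E) => curveConst E p.1.2) :=
    (curveConst E).contDiff.comp (contDiff_snd.comp contDiff_fst)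
  exact h2.add ((contDiff_fst.comp contDiff_fst).smul h1)

lemma picOp_lipschitz {E : Type} [NormedAddCommGroup E] [NormedSpace ℝ E] (X : C(E, E))
    {K : NNReal} (hK : LipschitzWith K X) (p : ℝ × E) :
    LipschitzWith (‖p.1‖₊ * K) (fun γ => picOp X (p, γ)) := by
  refine LipschitzWith.of_dist_le_mul fun g h => ?_
  have : dist (picOp X (p, g)) (picOp X (p, h)) =
      ‖p.1‖ * ‖curveInt E (X.comp g - X.comp h)‖ := by
    rw [dist_eq_norm, ← norm_smul, map_sub, smul_sub]
    simp [picOp]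
  rw [this]
  push_cast
  rw [mul_assoc]
  gcongr
  refine (curveInt_norm_le _).trans ((ContinuousMap.norm_le _ (by positivity)).2 fun t => ?_)
  rw [ContinuousMap.sub_apply, ← dist_eq_norm]
  exact (hK.dist_le_mul _ _).trans (by gcongr; exact ContinuousMap.dist_apply_le_dist t)

lemma exists_smooth_flow {E : Type} [NormedAddCommGroup E] [NormedSpace ℝ E] [CompleteSpace E]
    (X : C(E, E)) (hX : ContDiff ℝ ∞ X) {K : NNReal} (hK : LipschitzWith K X) :
    ∃ φ : ℝ × E → E, ContDiffOn ℝ ∞ φ {p | ‖p.1‖₊ * K < 1} ∧ (∀ y, φ (0, y) = y) ∧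
      ∀ p : ℝ × E, ‖p.1‖₊ * K < 1 → HasDerivAt (fun t => φ (t, p.2)) (X (φ p)) p.1 := by
  classical
  have hcontr : ∀ p : ℝ × E, ‖p.1‖₊ * K < 1 →
      ContractingWith (‖p.1‖₊ * K) (fun γ => picOp X (p, γ)) :=
    fun p hp => ⟨hp, picOp_lipschitz X hK p⟩
  have hex : ∀ p : ℝ × E, ∃ γ : C(I, E), ‖p.1‖₊ * K < 1 →
      (picOp X (p, γ) = γ ∧ ∀ δ, picOp X (p, δ) = δ → δ = γ) := by
    intro p
    by_cases hp : ‖p.1‖₊ * K < 1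
    · exact ⟨ContractingWith.fixedPoint _ (hcontr p hp), fun _ =>
        ⟨(hcontr p hp).fixedPoint_isFixedPt, fun δ hδ => (hcontr p hp).fixedPoint_unique hδ⟩⟩
    · exact ⟨0, fun h => absurd h hp⟩
  choose γ hγ using hex
  have hSo : IsOpen {p : ℝ × E | ‖p.1‖₊ * K < 1} :=
    isOpen_lt (by fun_prop) continuous_const
  -- smoothness of the curve-valued map
  have hsm : ∀ p : ℝ × E, ‖p.1‖₊ * K < 1 → ContDiffAt ℝ ∞ γ p := by
    intro p hp
    let G : (ℝ × E) × C(I, E) → C(I, E) := fun q => q.2 - picOp X q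
    have hT := picOp_contDiff X hX
    have hG : ContDiff ℝ ∞ G := contDiff_snd.sub hT
    have hGat : ContDiffAt ℝ ∞ G (p, γ p) := hG.contDiffAt
    have hd : HasFDerivAt (fun g : C(I, E) => picOp X (p, g))
        ((fderiv ℝ (picOp X) (p, γ p)) ∘L (.inr ℝ (ℝ × E) C(I, E))) (γ p) := by
      have h1 : HasFDerivAt (picOp X) (fderiv ℝ (picOp X) (p, γ p)) (p, γ p) :=
        (hT.differentiable (by simp) _).hasFDerivAt
      exact h1.comp (γ p) (hasFDerivAt_prodMk_right p (γ p))
    have hnorm := hd.le_of_lipschitz (picOp_lipschitz X hK p)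
    set L := (fderiv ℝ (picOp X) (p, γ p)) ∘L (.inr ℝ (ℝ × E) C(I, E)) with hL
    have hL1 : ‖L‖ < 1 := lt_of_le_of_lt hnorm (by exact_mod_cast hp)
    have hGd : fderiv ℝ G (p, γ p) ∘L (.inr ℝ (ℝ × E) C(I, E)) = 1 - L := by
      have h1 : HasFDerivAt G (ContinuousLinearMap.snd ℝ (ℝ × E) C(I, E) -
          fderiv ℝ (picOp X) (p, γ p)) (p, γ p) :=
        hasFDerivAt_snd.sub (hT.differentiable (by simp) _).hasFDerivAt
      rw [h1.fderiv, hL]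
      ext; simp
    have hinv : (fderiv ℝ G (p, γ p) ∘L (.inr ℝ (ℝ × E) C(I, E))).IsInvertible := by
      rw [hGd]
      let u := Units.oneSub L hL1
      refine ContinuousLinearMap.IsInvertible.of_inverse (g := (↑u⁻¹ : C(I, E) →L[ℝ] C(I, E))) ?_ ?_
      · exact u.mul_inv
      · exact u.inv_mul
    have hi := hGat.contDiffAt_implicitFunction (by simp) hinv
    refine hi.congr_of_eventuallyEq ?_
    filter_upwards [hGat.eventually_apply_implicitFunction (by simp) hinv, hSo.mem_nhds hp]
      with q hq hqS
    refine ((hγ q hqS).2 _ ?_).symm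
    have h0 : G (p, γ p) = 0 := by simp only [G, (hγ p hp).1, sub_self]
    rw [h0] at hq
    exact (sub_eq_zero.1 hq).symm
  let φ : ℝ × E → E := fun p => γ p 1
  have hev : ContDiff ℝ ∞ (fun g : C(I, E) => g 1) :=
    (IsLinearMap.with_bound (𝕜 := ℝ) (E := C(I, E)) (F := E) (f := fun g => g 1)
      ⟨fun _ _ => rfl, fun _ _ => rfl⟩ 1
      (fun g => by rw [one_mul]; exact g.norm_coe_le_norm 1)).contDiff
  have hφs : ∀ p : ℝ × E, ‖p.1‖₊ * K < 1 → ContDiffAt ℝ ∞ φ p := fun p hp =>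
    hev.contDiffAt.comp p (hsm p hp)
  -- scaling
  have hscale : ∀ (τ : ℝ) (y : E), ‖τ‖₊ * K < 1 → ∀ c : I, φ (c * τ, y) = γ (τ, y) c := by
    intro τ y hτ c
    have hc : ‖(c : ℝ) * τ‖₊ * K < 1 := by
      refine lt_of_le_of_lt ?_ hτ
      gcongr
      rw [← NNReal.coe_le_coe]
      simp only [coe_nnnorm, norm_mul]
      refine mul_le_of_le_one_left (norm_nonneg _) ?_
      rw [Real.norm_eq_abs, abs_of_nonneg c.2.1]; exact c.2.2
    let δ : C(I, E) := (γ (τ, y)).comp ⟨fun s : I => c * s, by fun_prop⟩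
    have hδ : picOp X (((c : ℝ) * τ, y), δ) = δ := by
      ext s
      have h1 := congrArg (fun g : C(I, E) => g (c * s)) (hγ (τ, y) hτ).1
      have h2 : δ s = γ (τ, y) (c * s) := rfl
      rw [h2, ← h1]
      simp only [picOp, ContinuousMap.add_apply, ContinuousMap.smul_apply, curveConst_apply,
        curveInt_apply]
      congr 1
      rw [mul_comm, mul_smul]
      congr 1
      have h3 := intervalIntegral.smul_integral_comp_mul_left (a := 0) (b := (s : ℝ))
        (fun u : ℝ => (X.comp (γ (τ, y))) (projIcc 0 1 zero_le_one u)) (c : ℝ)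
      rw [mul_zero] at h3
      rw [show ((c * s : I) : ℝ) = c * s from rfl, ← h3]
      congr 1
      refine intervalIntegral.integral_congr fun u hu => ?_
      rw [uIcc_of_le s.2.1] at hu
      have hu' : u ∈ Icc (0 : ℝ) 1 := ⟨hu.1, hu.2.trans s.2.2⟩
      have hcu : (c : ℝ) * u ∈ Icc (0 : ℝ) 1 := unitInterval.mul_mem c.2 hu'
      simp only [ContinuousMap.comp_apply]
      rw [projIcc_of_mem _ hu', projIcc_of_mem _ hcu]
      rfl
    have := (hγ ((c : ℝ) * τ, y) hc).2 δ hδ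
    have h4 : δ 1 = γ (τ, y) c := by simp [δ]
    rw [← h4, this]
  have hint : ∀ (τ : ℝ) (y : E), ‖τ‖₊ * K < 1 → φ (τ, y) = y + ∫ u in (0 : ℝ)..τ, X (φ (u, y)) := by
    intro τ y hτ
    have h1 := congrArg (fun g : C(I, E) => g 1) (hγ (τ, y) hτ).1
    have h2 : φ (τ, y) = γ (τ, y) 1 := rfl
    rw [h2, ← h1]
    simp only [picOp, ContinuousMap.add_apply, ContinuousMap.smul_apply, curveConst_apply,
        curveInt_apply]
    congr 1
    have h3 := intervalIntegral.smul_integral_comp_mul_left (a := 0) (b := (1 : ℝ))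
        (fun u : ℝ => X (φ (u, y))) τ
    rw [mul_zero, mul_one] at h3
    rw [← h3]
    congr 1
    refine intervalIntegral.integral_congr fun u hu => ?_
    rw [uIcc_of_le (by simp)] at hu
    have hu' : u ∈ Icc (0 : ℝ) 1 := by simpa using hu
    simp only [ContinuousMap.comp_apply]
    rw [projIcc_of_mem _ hu', ← hscale τ y hτ ⟨u, hu'⟩, mul_comm]
  refine ⟨φ, fun p hp => (hφs p hp).contDiffWithinAt, fun y => ?_, ?_⟩
  · simpa using hint 0 y (by simp)
  · rintro ⟨τ, y⟩ hτ
    have hτ' : ‖τ‖₊ * K < 1 := hτ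
    have hcont : ContinuousOn (fun u : ℝ => X (φ (u, y))) {u | ‖u‖₊ * K < 1} := by
      intro u hu
      have h1 : ContinuousAt φ (u, y) := (hφs (u, y) hu).continuousAt
      have h2 : ContinuousAt (fun u : ℝ => φ (u, y)) u :=
        h1.comp (f := fun u : ℝ => (u, y)) (by fun_prop)
      exact (X.continuous.continuousAt.comp h2).continuousWithinAt
    have ho : IsOpen {u : ℝ | ‖u‖₊ * K < 1} := isOpen_lt (by fun_prop) continuous_const
    have hsub : uIcc 0 τ ⊆ {u : ℝ | ‖u‖₊ * K < 1} := by
      intro u hu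
      refine lt_of_le_of_lt ?_ hτ'
      gcongr
      rw [← NNReal.coe_le_coe]
      simpa using abs_sub_left_of_mem_uIcc hu
    have hD : HasDerivAt (fun t => ∫ u in (0 : ℝ)..t, X (φ (u, y))) (X (φ (τ, y))) τ :=
      intervalIntegral.integral_hasDerivAt_right ((hcont.mono hsub).intervalIntegrable)
        (hcont.stronglyMeasurableAtFilter ho τ hτ') (hcont.continuousAt (ho.mem_nhds hτ'))
    refine (hD.const_add y).congr_of_eventuallyEq ?_
    filter_upwards [ho.mem_nhds hτ'] with t ht using hint t y ht

lemma local_inverse {E : Type} [NormedAddCommGroup E] [NormedSpace ℝ E] [FiniteDimensional ℝ E]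
    {f : E → E} {V : Set E} (hV : IsOpen V) (hf : ContDiffOn ℝ ∞ f V) {a : E} (ha : a ∈ V)
    (hinj : ∀ v, fderiv ℝ f a v = 0 → v = 0) :
    ∃ e : OpenPartialHomeomorph E E, (e : E → E) = f ∧ a ∈ e.source ∧ e.source ⊆ V ∧
      ContDiffOn ℝ ∞ e.symm e.target := by
  have : CompleteSpace E := FiniteDimensional.complete ℝ E
  have hinj' : Function.Injective (fderiv ℝ f a : E →ₗ[ℝ] E) := by
    rw [← LinearMap.ker_eq_bot, LinearMap.ker_eq_bot']; exact hinj
  let f' : E ≃L[ℝ] E := (LinearEquiv.ofInjectiveEndo _ hinj').toContinuousLinearEquiv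
  have hf' : (f' : E →L[ℝ] E) = fderiv ℝ f a := by ext v; rfl
  have hat : ContDiffAt ℝ ∞ f a := hf.contDiffAt (hV.mem_nhds ha)
  have hda : HasFDerivAt f (f' : E →L[ℝ] E) a := by
    rw [hf']; exact (hat.differentiableAt (by simp)).hasFDerivAt
  let e0 := hat.toOpenPartialHomeomorph f hda (by simp)
  let O : Set E := V ∩ fderiv ℝ f ⁻¹' (range ((↑) : (E ≃L[ℝ] E) → (E →L[ℝ] E)))
  have hO : IsOpen O :=
    (hf.continuousOn_fderiv_of_isOpen hV (by simp)).isOpen_inter_preimage hV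
      ContinuousLinearEquiv.isOpen
  refine ⟨e0.restrOpen O hO, rfl, ?_, ?_, ?_⟩
  · exact ⟨hat.mem_toOpenPartialHomeomorph_source hda (by simp), ha, f', hf'⟩
  · intro x hx; exact hx.2.1
  · intro q hq
    have hx := (e0.restrOpen O hO).map_target hq
    obtain ⟨g, hg⟩ := hx.2.2
    have hc : ContDiffAt ℝ ∞ f ((e0.restrOpen O hO).symm q) := hf.contDiffAt (hV.mem_nhds hx.2.1)
    refine ((e0.restrOpen O hO).contDiffAt_symm (f₀' := g) hq ?_ hc).contDiffWithinAt
    rw [hg]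
    exact (hc.differentiableAt (by simp)).hasFDerivAt

lemma exists_transversal (w : ℝ × ℝ × ℝ) (hw : w ≠ 0) :
    ∃ ι : (ℝ × ℝ) →L[ℝ] (ℝ × ℝ × ℝ), ∀ (t : ℝ) (z : ℝ × ℝ), t • w + ι z = 0 → t = 0 ∧ z = 0 := by
  obtain ⟨w1, w2, w3⟩ := w
  by_cases h1 : w1 = 0
  · by_cases h2 : w2 = 0
    · have h3 : w3 ≠ 0 := by
        rintro rfl; exact hw (by simp [h1, h2])
      refine ⟨(ContinuousLinearMap.fst ℝ ℝ ℝ).prod ((ContinuousLinearMap.snd ℝ ℝ ℝ).prod 0), ?_⟩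
      rintro t ⟨a, b⟩ h
      simp [Prod.ext_iff] at h ⊢
      obtain ⟨e1, e2, e3⟩ := h
      have ht : t = 0 := by simpa [h3] using e3
      subst ht; simp at e1 e2; simp [e1, e2]
    · refine ⟨(ContinuousLinearMap.fst ℝ ℝ ℝ).prod
        ((0 : (ℝ × ℝ) →L[ℝ] ℝ).prod (ContinuousLinearMap.snd ℝ ℝ ℝ)), ?_⟩
      rintro t ⟨a, b⟩ h
      simp [Prod.ext_iff] at h ⊢
      obtain ⟨e1, e2, e3⟩ := h
      have ht : t = 0 := by simpa [h2] using e2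
      subst ht; simp at e1 e3; simp [e1, e3]
  · refine ⟨(0 : (ℝ × ℝ) →L[ℝ] ℝ).prod (ContinuousLinearMap.id ℝ (ℝ × ℝ)), ?_⟩
    rintro t ⟨a, b⟩ h
    simp [Prod.ext_iff] at h ⊢
    obtain ⟨e1, e2, e3⟩ := h
    have ht : t = 0 := by simpa [h1] using e1
    subst ht; simp at e2 e3; simp [e2, e3]

lemma exists_cutoff {U : Set (ℝ × ℝ × ℝ)} (hU : IsOpen U) (hU0 : (0 : ℝ × ℝ × ℝ) ∈ U)
    {X : (ℝ × ℝ × ℝ) → (ℝ × ℝ × ℝ)} (hX : ContDiffOn ℝ ∞ X U) :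
    ∃ Z : (ℝ × ℝ × ℝ) → (ℝ × ℝ × ℝ), ContDiff ℝ ∞ Z ∧ HasCompactSupport Z ∧ Z =ᶠ[𝓝 0] X := by
  obtain ⟨r, hr, hrU⟩ := Metric.isOpen_iff.1 hU 0 hU0
  let f : ContDiffBump (0 : ℝ × ℝ × ℝ) := ⟨r / 4, r / 2, by positivity, by linarith⟩
  have hts : tsupport f ⊆ U := by
    rw [f.tsupport_eq]
    exact (Metric.closedBall_subset_ball (by simp [f]; linarith)).trans hrU
  refine ⟨fun x => f x • X x, ?_, f.hasCompactSupport.smul_right, ?_⟩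
  · rw [contDiff_iff_contDiffAt]
    intro x
    by_cases hx : x ∈ U
    · exact f.contDiff.contDiffAt.smul (hX.contDiffAt (hU.mem_nhds hx))
    · have : (fun x => f x • X x) =ᶠ[𝓝 x] fun _ => 0 := by
        have hx' : x ∉ tsupport f := fun h => hx (hts h)
        filter_upwards [notMem_tsupport_iff_eventuallyEq.1 hx'] with y hy
        simp [hy]
      exact contDiffAt_const.congr_of_eventuallyEq this
  · filter_upwards [f.eventuallyEq_one] with y hy
    simp [hy]

lemma exists_first_integrals {U : Set (ℝ × ℝ × ℝ)} (hU : IsOpen U) (hU0 : (0 : ℝ × ℝ × ℝ) ∈ U)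
    {X : (ℝ × ℝ × ℝ) → (ℝ × ℝ × ℝ)} (hX : ContDiffOn ℝ ∞ X U) (hX0 : X 0 ≠ 0) :
    ∃ (V : Set (ℝ × ℝ × ℝ)) (F : (ℝ × ℝ × ℝ) → ℝ × ℝ), IsOpen V ∧ 0 ∈ V ∧ ContDiffOn ℝ ∞ F V ∧
      (∀ p ∈ V, fderiv ℝ F p (X p) = 0) ∧
      ∀ v, fderiv ℝ F 0 v = 0 → ∃ c : ℝ, v = c • X 0 := by
  obtain ⟨Z, hZ, hZc, hZX⟩ := exists_cutoff hU hU0 hX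
  obtain ⟨K, hK⟩ := ContDiff.lipschitzWith_of_hasCompactSupport hZc hZ (by simp)
  obtain ⟨φ, hφ, hφ0, hφd⟩ := exists_smooth_flow ⟨Z, hZ.continuous⟩ hZ hK
  obtain ⟨ι, hι⟩ := exists_transversal (X 0) hX0
  let Ψ : (ℝ × ℝ × ℝ) → (ℝ × ℝ × ℝ) := fun p => φ (p.1, ι p.2)
  let S : Set (ℝ × ℝ × ℝ) := {p | ‖p.1‖₊ * K < 1}
  have hS : IsOpen S := isOpen_lt (by fun_prop) continuous_const
  have hS0 : (0 : ℝ × ℝ × ℝ) ∈ S := by simp [S]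
  have hΨ : ContDiffOn ℝ ∞ Ψ S := by
    refine hφ.comp (t := {p : ℝ × (ℝ × ℝ × ℝ) | ‖p.1‖₊ * K < 1})
      (f := fun p : ℝ × ℝ × ℝ => (p.1, ι p.2)) ?_ (fun p hp => hp)
    exact (contDiff_fst.prodMk (ι.contDiff.comp contDiff_snd)).contDiffOn
  have hΨd : ∀ p ∈ S, HasFDerivAt Ψ (fderiv ℝ Ψ p) p := fun p hp =>
    ((hΨ.contDiffAt (hS.mem_nhds hp)).differentiableAt (by simp)).hasFDerivAt
  have hΨ0 : Ψ 0 = 0 := by simp [Ψ, hφ0]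
  have hΨX : ∀ p ∈ S, fderiv ℝ Ψ p (1, 0) = Z (Ψ p) := by
    rintro ⟨t, z⟩ hp
    have h1 : HasDerivAt (fun s : ℝ => (s, z)) ((1 : ℝ), (0 : ℝ × ℝ)) t :=
      (hasDerivAt_id t).prodMk (hasDerivAt_const t z)
    have h2 := (hΨd (t, z) hp).comp_hasDerivAt t h1
    exact h2.unique (hφd (t, ι z) hp)
  have hΨι : ∀ z, fderiv ℝ Ψ 0 (0, z) = ι z := by
    intro z
    have h1 : HasFDerivAt (fun z : ℝ × ℝ => ((0 : ℝ), z)) (ContinuousLinearMap.inr ℝ ℝ (ℝ × ℝ)) 0 :=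
      hasFDerivAt_prodMk_right 0 0
    have h2 := (hΨd 0 hS0).comp (0 : ℝ × ℝ) h1
    have h3 : (Ψ ∘ fun z : ℝ × ℝ => ((0 : ℝ), z)) = ι := by
      funext z; simp [Ψ, hφ0]
    rw [h3] at h2
    have h4 := h2.unique ι.hasFDerivAt
    rw [← h4]; simp
  have hZ0 : Z 0 = X 0 := hZX.self_of_nhds
  have hΨ' : ∀ (t : ℝ) (z : ℝ × ℝ), fderiv ℝ Ψ 0 (t, z) = t • X 0 + ι z := by
    intro t z
    have h : ((t, z) : ℝ × ℝ × ℝ) = t • ((1 : ℝ), (0 : ℝ × ℝ)) + (0, z) := by simp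
    rw [h, map_add, map_smul, hΨX 0 hS0, hΨι, hΨ0, hZ0]
  have hinj : ∀ v, fderiv ℝ Ψ 0 v = 0 → v = 0 := by
    rintro ⟨t, z⟩ h
    rw [hΨ'] at h
    obtain ⟨rfl, rfl⟩ := hι t z h
    rfl
  obtain ⟨e, he, he0, heS, hes⟩ := local_inverse hS hΨ hS0 hinj
  have he00 : e 0 = 0 := by rw [he, hΨ0]
  have het0 : (0 : ℝ × ℝ × ℝ) ∈ e.target := by rw [← he00]; exact e.map_source he0
  have hes0 : e.symm 0 = 0 := by
    conv_lhs => rw [← he00]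
    exact e.left_inv he0
  let F : (ℝ × ℝ × ℝ) → ℝ × ℝ := fun p => (e.symm p).2
  have hF : ContDiffOn ℝ ∞ F e.target := contDiff_snd.comp_contDiffOn hes
  have hFΨ : ∀ p ∈ e.target, ∀ v, fderiv ℝ F p (fderiv ℝ Ψ (e.symm p) v) = v.2 := by
    intro p hp v
    have hq := e.map_target hp
    have hpe : Ψ (e.symm p) = p := by rw [← he]; exact e.right_inv hp
    have h1 : HasFDerivAt F (fderiv ℝ F p) (Ψ (e.symm p)) := by
      rw [hpe]
      exact ((hF.contDiffAt (e.open_target.mem_nhds hp)).differentiableAt (by simp)).hasFDerivAt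
    have h2 := h1.comp (e.symm p) (hΨd _ (heS hq))
    have h3 : (F ∘ Ψ) =ᶠ[𝓝 (e.symm p)] Prod.snd := by
      filter_upwards [e.open_source.mem_nhds hq] with x hx
      have := e.left_inv hx
      rw [he] at this
      simp only [F, Function.comp_apply, this]
    have h4 := h2.unique (hasFDerivAt_snd.congr_of_eventuallyEq h3)
    exact congrArg (fun L : (ℝ × ℝ × ℝ) →L[ℝ] ℝ × ℝ => L v) h4
  obtain ⟨O, hO, hOo, hO0⟩ := eventually_nhds_iff.1 hZX
  refine ⟨e.target ∩ O, F, e.open_target.inter hOo, ⟨het0, hO0⟩, hF.mono inter_subset_left, ?_, ?_⟩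
  · rintro p ⟨hp, hpO⟩
    have hpe : Ψ (e.symm p) = p := by rw [← he]; exact e.right_inv hp
    have h := hFΨ p hp (1, 0)
    rw [hΨX _ (heS (e.map_target hp)), hpe, hO p hpO] at h
    exact h
  · intro v hv
    have hsurj : Function.Surjective (fderiv ℝ Ψ 0 : (ℝ × ℝ × ℝ) →ₗ[ℝ] (ℝ × ℝ × ℝ)) := by
      rw [← LinearMap.injective_iff_surjective, ← LinearMap.ker_eq_bot, LinearMap.ker_eq_bot']
      exact hinj
    obtain ⟨⟨t, z⟩, rfl⟩ := hsurj v
    have h := hFΨ 0 het0 (t, z)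
    rw [hes0] at h
    have hz : z = 0 := h.symm.trans hv
    refine ⟨t, ?_⟩
    have := hΨ' t z
    rw [hz, map_zero, add_zero] at this
    rw [hz]; exact this

/-- A pair of linear functionals on the plane separating a nonzero vector: the second is nonzero
on the given vector, and jointly they are injective. -/
lemma exists_plane_coords (w : ℝ × ℝ) (hw : w ≠ 0) :
    ∃ M : (ℝ × ℝ) →L[ℝ] (ℝ × ℝ), (M w).2 ≠ 0 ∧ ∀ v, M v = 0 → v = 0 := by
  obtain ⟨a, b⟩ := w
  by_cases hb : b = 0
  · have ha : a ≠ 0 := by rintro rfl; exact hw (by simp [hb])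
    refine ⟨(ContinuousLinearMap.snd ℝ ℝ ℝ).prod (ContinuousLinearMap.fst ℝ ℝ ℝ), by simpa using ha,
      ?_⟩
    rintro ⟨x, y⟩ h
    simp [Prod.ext_iff] at h ⊢
    exact ⟨h.2, h.1⟩
  · exact ⟨ContinuousLinearMap.id ℝ _, by simpa using hb, fun v h => by simpa using h⟩

/-- Straightening of a pair of pointwise linearly independent smooth
vector fields `X`, `Y` near the origin of `ℝ³` (coordinates `(x, a, b)`,
`∂_x = (1,0,0)`, `∂_a = (0,1,0)`, `∂_b = (0,0,1)`): there are local coordinates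
in which `Φ_* X = μ ∂_x` and `Φ_* Y = λ (∂_b + ψ ∂_a)`. -/
theorem stmt_0
    (U : Set (ℝ × ℝ × ℝ)) (hU : IsOpen U) (hU0 : (0 : ℝ × ℝ × ℝ) ∈ U)
    (X Y : (ℝ × ℝ × ℝ) → (ℝ × ℝ × ℝ))
    (hX : ContDiffOn ℝ (⊤ : ℕ∞) X U) (hY : ContDiffOn ℝ (⊤ : ℕ∞) Y U)
    (hind : ∀ p ∈ U, LinearIndependent ℝ ![X p, Y p]) :
    ∃ (W : Set (ℝ × ℝ × ℝ)) (Φ Φinv : (ℝ × ℝ × ℝ) → (ℝ × ℝ × ℝ))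
      (μ lam ψ : (ℝ × ℝ × ℝ) → ℝ),
      IsOpen W ∧ (0 : ℝ × ℝ × ℝ) ∈ W ∧ W ⊆ U ∧
      IsOpen (Φ '' W) ∧
      ContDiffOn ℝ (⊤ : ℕ∞) Φ W ∧ ContDiffOn ℝ (⊤ : ℕ∞) Φinv (Φ '' W) ∧
      (∀ p ∈ W, Φinv (Φ p) = p) ∧ (∀ q ∈ Φ '' W, Φ (Φinv q) = q) ∧
      ContDiffOn ℝ (⊤ : ℕ∞) μ (Φ '' W) ∧ ContDiffOn ℝ (⊤ : ℕ∞) lam (Φ '' W) ∧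
      ContDiffOn ℝ (⊤ : ℕ∞) ψ (Φ '' W) ∧
      (∀ q ∈ Φ '' W, μ q ≠ 0) ∧ (∀ q ∈ Φ '' W, lam q ≠ 0) ∧
      (∀ q ∈ Φ '' W, fderiv ℝ Φ (Φinv q) (X (Φinv q)) = (μ q, 0, 0)) ∧
      (∀ q ∈ Φ '' W, fderiv ℝ Φ (Φinv q) (Y (Φinv q)) = (0, lam q * ψ q, lam q)) := by
  have hli := hind 0 hU0
  rw [LinearIndependent.pair_iff] at hli
  have hX0 : X 0 ≠ 0 := fun h => by simpa using (hli 1 0 (by simp [h])).1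
  have hY0 : Y 0 ≠ 0 := fun h => by simpa using (hli 0 1 (by simp [h])).2
  obtain ⟨V1, F, hV1, hV10, hF, hFX, hFk⟩ := exists_first_integrals hU hU0 hX hX0
  obtain ⟨V2, H, hV2, hV20, hH, hHY, hHk⟩ := exists_first_integrals hU hU0 hY hY0
  have hFY : fderiv ℝ F 0 (Y 0) ≠ 0 := by
    intro h
    obtain ⟨c, hc⟩ := hFk _ h
    simpa using (hli c (-1) (by simp [hc])).2
  have hHX : fderiv ℝ H 0 (X 0) ≠ 0 := by
    intro h
    obtain ⟨c, hc⟩ := hHk _ h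
    simpa using (hli (-1) c (by simp [hc])).1
  obtain ⟨M, hM, hMi⟩ := exists_plane_coords _ hFY
  obtain ⟨N, hN, -⟩ := exists_plane_coords _ hHX
  let Φ : (ℝ × ℝ × ℝ) → (ℝ × ℝ × ℝ) := fun p => ((N (H p)).2, M (F p))
  let V : Set (ℝ × ℝ × ℝ) := U ∩ (V1 ∩ V2)
  have hV : IsOpen V := hU.inter (hV1.inter hV2)
  have hVU : V ⊆ U := inter_subset_left
  have hΦ : ContDiffOn ℝ ∞ Φ V := by
    refine ContDiffOn.prodMk ?_ ?_
    · exact contDiff_snd.comp_contDiffOn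
        (N.contDiff.comp_contDiffOn (hH.mono fun p hp => hp.2.2))
    · exact M.contDiff.comp_contDiffOn (hF.mono fun p hp => hp.2.1)
  have hΦd : ∀ p ∈ V, ∀ v, fderiv ℝ Φ p v = ((N (fderiv ℝ H p v)).2, M (fderiv ℝ F p v)) := by
    intro p hp v
    have h1 : HasFDerivAt F (fderiv ℝ F p) p :=
      ((hF.contDiffAt (hV1.mem_nhds hp.2.1)).differentiableAt (by simp)).hasFDerivAt
    have h2 : HasFDerivAt H (fderiv ℝ H p) p :=
      ((hH.contDiffAt (hV2.mem_nhds hp.2.2)).differentiableAt (by simp)).hasFDerivAt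
    have h3 : HasFDerivAt Φ _ p :=
      (N.hasFDerivAt.comp p h2).snd.prodMk (M.hasFDerivAt.comp p h1)
    rw [h3.fderiv]; simp
  have hΦ' : ContDiffOn ℝ ∞ (fderiv ℝ Φ) V := hΦ.fderiv_of_isOpen hV (by simp)
  have hAX : ContDiffOn ℝ ∞ (fun p => fderiv ℝ Φ p (X p)) V := hΦ'.clm_apply (hX.mono hVU)
  have hAY : ContDiffOn ℝ ∞ (fun p => fderiv ℝ Φ p (Y p)) V := hΦ'.clm_apply (hY.mono hVU)
  have hm : ContDiffOn ℝ ∞ (fun p => (fderiv ℝ Φ p (X p)).1) V := contDiff_fst.comp_contDiffOn hAX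
  have hl : ContDiffOn ℝ ∞ (fun p => (fderiv ℝ Φ p (Y p)).2.2) V :=
    (contDiff_snd.comp contDiff_snd).comp_contDiffOn hAY
  have hk : ContDiffOn ℝ ∞ (fun p => (fderiv ℝ Φ p (Y p)).2.1) V :=
    (contDiff_fst.comp contDiff_snd).comp_contDiffOn hAY
  have h0V : (0 : ℝ × ℝ × ℝ) ∈ V := ⟨hU0, hV10, hV20⟩
  let V' : Set (ℝ × ℝ × ℝ) := (V ∩ (fun p => (fderiv ℝ Φ p (X p)).1) ⁻¹' {0}ᶜ) ∩
    (V ∩ (fun p => (fderiv ℝ Φ p (Y p)).2.2) ⁻¹' {0}ᶜ)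
  have hV' : IsOpen V' :=
    (hm.continuousOn.isOpen_inter_preimage hV isOpen_compl_singleton).inter
      (hl.continuousOn.isOpen_inter_preimage hV isOpen_compl_singleton)
  have hV'V : V' ⊆ V := fun p hp => hp.1.1
  have h0V' : (0 : ℝ × ℝ × ℝ) ∈ V' := by
    refine ⟨⟨h0V, ?_⟩, ⟨h0V, ?_⟩⟩
    · simpa [hΦd 0 h0V] using hN
    · simpa [hΦd 0 h0V] using hM
  have hinj : ∀ v, fderiv ℝ Φ 0 v = 0 → v = 0 := by
    intro v hv
    rw [hΦd 0 h0V, Prod.mk_eq_zero] at hv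
    obtain ⟨c, rfl⟩ := hFk v (hMi _ hv.2)
    have h1 := hv.1
    rw [map_smul, map_smul, Prod.smul_snd, smul_eq_mul] at h1
    rcases mul_eq_zero.1 h1 with h | h
    · simp [h]
    · exact absurd h hN
  obtain ⟨e, he, he0, heV, hes⟩ := local_inverse hV' (hΦ.mono hV'V) h0V' hinj
  have him : Φ '' e.source = e.target := by rw [← he]; exact e.image_source_eq_target
  have hmaps : MapsTo e.symm e.target V := fun q hq => hV'V (heV (e.map_target hq))
  have hl0 : ∀ q ∈ e.target, (fderiv ℝ Φ (e.symm q) (Y (e.symm q))).2.2 ≠ 0 :=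
    fun q hq => (heV (e.map_target hq)).2.2
  refine ⟨e.source, Φ, e.symm, fun q => (fderiv ℝ Φ (e.symm q) (X (e.symm q))).1,
    fun q => (fderiv ℝ Φ (e.symm q) (Y (e.symm q))).2.2,
    fun q => (fderiv ℝ Φ (e.symm q) (Y (e.symm q))).2.1 /
      (fderiv ℝ Φ (e.symm q) (Y (e.symm q))).2.2,
    e.open_source, he0, (heV.trans hV'V).trans hVU, ?_⟩
  rw [him]
  refine ⟨e.open_target, hΦ.mono (heV.trans hV'V), hes, ?_, ?_, hm.comp hes hmaps,
    hl.comp hes hmaps, (hk.comp hes hmaps).div (hl.comp hes hmaps) hl0, ?_, hl0, ?_, ?_⟩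
  · intro p hp
    rw [← he]; exact e.left_inv hp
  · intro q hq
    rw [← he]; exact e.right_inv hq
  · exact fun q hq => (heV (e.map_target hq)).1.2
  · intro q hq
    have hp := hmaps hq
    refine Prod.ext rfl ?_
    rw [hΦd _ hp, hFX _ hp.2.1, map_zero]
    rfl
  · intro q hq
    have hp := hmaps hq
    have h1 := hl0 q hq
    refine Prod.ext ?_ (Prod.ext ?_ rfl)
    · rw [hΦd _ hp, hHY _ hp.2.2, map_zero]; rfl
    · simp only; field_simp
end

section
/- Let ψ be a smooth function defined on an open neighborhood of the origin in ℝ³ with coordinates (x,a,b). Then there exist an open neighborhood U of the origin and a smooth function φ̃ on U such that: (i) ∂_b φ̃ + ψ·∂_a φ̃ = 0 on U; (ii) φ̃(x,a,0) = a whenever (x,a,0) ∈ U; and consequently, for the embedding ι(x,a,b) = (x, φ̃(x,a,b), a, b) of U into ℝ⁴ = ℝ²_{xy} × ℝ²_{ab}, the differential of ι sends ∂_x to a vector with vanishing a- and b-components (namely ∂_x + (∂_xφ̃)∂_y) and sends ∂_b + ψ∂_a to a vector with vanishing x- and y-components (namely ψ∂_a + ∂_b). In particular the para-CR structure (∂_x,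 ∂_b + ψ∂_a) on U is realized as the structure induced on the hypersurface ι(U) by the two families of 2-planes T ℝ²_{xy} and T ℝ²_{ab}. -/
open Set Filter Topology
open scoped ContDiff

/-- The bounded linear map turning a continuous family of operators into an operator. -/
noncomputable def famOp (I E F : Type) [TopologicalSpace I] [CompactSpace I]
    [NormedAddCommGroup E] [NormedSpace ℝ E] [NormedAddCommGroup F] [NormedSpace ℝ F] :
    C(I, E →L[ℝ] F) →L[ℝ] C(I, E) →L[ℝ] C(I, F) :=
  LinearMap.mkContinuous₂
    (LinearMap.mk₂ ℝ (fun (A : C(I, E →L[ℝ] F)) (h : C(I, E)) =>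
        (⟨fun s => A s (h s), by fun_prop⟩ : C(I, F)))
      (by intros; ext; simp) (by intros; ext; simp) (by intros; ext; simp) (by intros; ext; simp))
    1 (by
      intro A h
      rw [ContinuousMap.norm_le _ (by positivity)]
      intro s
      simp only [LinearMap.mk₂_apply, ContinuousMap.coe_mk, one_mul]
      exact (A s).le_of_opNorm_le_of_le (A.norm_coe_le_norm s) (h.norm_coe_le_norm s))

theorem famOp_apply (I E F : Type) [TopologicalSpace I] [CompactSpace I]
    [NormedAddCommGroup E] [NormedSpace ℝ E] [NormedAddCommGroup F] [NormedSpace ℝ F]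
    (A : C(I, E →L[ℝ] F)) (h : C(I, E)) (s : I) : famOp I E F A h s = A s (h s) := rfl

theorem hasFDerivAt_postcomp (I E F : Type) [TopologicalSpace I] [CompactSpace I]
    [NormedAddCommGroup E] [NormedSpace ℝ E] [NormedAddCommGroup F] [NormedSpace ℝ F]
    (f : C(E, F)) (f' : C(E, E →L[ℝ] F)) (hf : ∀ x, HasFDerivAt f (f' x) x) (γ : C(I, E)) :
    HasFDerivAt (fun γ : C(I, E) => f.comp γ) (famOp I E F (f'.comp γ)) γ := by
  rw [hasFDerivAt_iff_isLittleO_nhds_zero, Asymptotics.isLittleO_iff]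
  intro c hc
  have hcont : ContinuousAt (fun γ : C(I, E) => f'.comp γ) γ :=
    (ContinuousMap.continuous_postcomp f').continuousAt
  obtain ⟨δ, hδ, H⟩ := (Metric.continuousAt_iff (f := fun γ : C(I, E) => f'.comp γ)).1 hcont c hc
  filter_upwards [Metric.ball_mem_nhds (0 : C(I, E)) hδ] with h hh
  rw [mem_ball_zero_iff] at hh
  rw [ContinuousMap.norm_le _ (by positivity)]
  intro s
  have key : ∀ y ∈ Metric.ball (γ s) δ, ‖f' y - f' (γ s)‖ ≤ c := by
    intro y hy
    have h1 : dist (γ + ContinuousMap.const I (y - γ s)) γ < δ := by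
      rw [dist_eq_norm, add_sub_cancel_left]
      refine lt_of_le_of_lt ((ContinuousMap.norm_le _ (norm_nonneg (y - γ s))).2 ?_) ?_
      · intro t; simp
      · rwa [← dist_eq_norm]
    have h2 : ‖f'.comp (γ + ContinuousMap.const I (y - γ s)) - f'.comp γ‖ ≤ c :=
      (dist_eq_norm (f'.comp (γ + ContinuousMap.const I (y - γ s))) (f'.comp γ)).symm.le.trans
        (H h1).le
    have h3 := (ContinuousMap.norm_coe_le_norm _ s).trans h2
    simpa using h3
  have hs : ‖h s‖ < δ := (h.norm_coe_le_norm s).trans_lt hh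
  have := (convex_ball (γ s) δ).norm_image_sub_le_of_norm_hasFDerivWithin_le'
    (f := f) (f' := f') (φ := f' (γ s)) (C := c) (x := γ s) (y := γ s + h s)
    (fun x _ => (hf x).hasFDerivWithinAt) key (Metric.mem_ball_self hδ) (by simpa using hs)
  simp only [add_sub_cancel_left] at this
  simp only [ContinuousMap.sub_apply, ContinuousMap.comp_apply, ContinuousMap.add_apply,
    famOp_apply]
  refine this.trans ?_
  gcongr
  exact h.norm_coe_le_norm s

theorem contDiff_postcomp_nat (I E : Type) [TopologicalSpace I] [CompactSpace I]
    [NormedAddCommGroup E] [NormedSpace ℝ E] (n : ℕ) :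
    ∀ (F : Type) [NormedAddCommGroup F] [NormedSpace ℝ F] (f : C(E, F)),
    ContDiff ℝ n f → ContDiff ℝ n (fun γ : C(I, E) => f.comp γ) := by
  induction n with
  | zero =>
    intro F _ _ f hf
    exact contDiff_zero.2 (ContinuousMap.continuous_postcomp f)
  | succ n ih =>
    intro F _ _ f hf
    have hf2 := hf
    push_cast at hf2 ⊢
    rw [contDiff_succ_iff_hasFDerivAt] at hf2 ⊢
    obtain ⟨f', h1, h2⟩ := hf2
    refine ⟨fun γ => famOp I E F ((⟨f', h1.continuous⟩ : C(E, E →L[ℝ] F)).comp γ), ?_, ?_⟩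
    · exact (famOp I E F).contDiff.comp (ih (E →L[ℝ] F) ⟨f', h1.continuous⟩ h1)
    · intro γ
      exact hasFDerivAt_postcomp I E F f ⟨f', h1.continuous⟩ h2 γ

theorem contDiff_postcomp (I E F : Type) [TopologicalSpace I] [CompactSpace I]
    [NormedAddCommGroup E] [NormedSpace ℝ E] [NormedAddCommGroup F] [NormedSpace ℝ F]
    (f : C(E, F)) (hf : ContDiff ℝ ∞ f) :
    ContDiff ℝ ∞ (fun γ : C(I, E) => f.comp γ) := by
  rw [contDiff_infty] at hf ⊢
  exact fun n => contDiff_postcomp_nat I E n F f (hf n)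

/-- Smooth implicit function theorem for a special type of equation. -/
theorem implicit_special (E B : Type) [NormedAddCommGroup E] [NormedSpace ℝ E] [CompleteSpace E]
    [NormedAddCommGroup B] [NormedSpace ℝ B] [CompleteSpace B]
    (A : E →L[ℝ] B) (l : E →L[ℝ] ℝ) (H : E × B → B) (hH : ContDiff ℝ ∞ H) :
    ∃ (W : Set E) (V : Set (E × B)) (g : E → B), IsOpen W ∧ 0 ∈ W ∧ ContDiffOn ℝ ∞ g W ∧
      g 0 = 0 ∧ V ∈ 𝓝 (0 : E × B) ∧ (∀ p ∈ W, g p - A p + l p • H (p, g p) = 0) ∧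
      (∀ v ∈ V, v.2 - A v.1 + l v.1 • H v = 0 → g v.1 = v.2) := by
  set G : E × B → E × B := fun v => (v.1, v.2 - A v.1 + l v.1 • H v) with hG
  have hGs : ContDiff ℝ ∞ G := by fun_prop
  let S : E →L[ℝ] B := - A + l.smulRight (H 0)
  let e' : (E × B) ≃L[ℝ] (E × B) := ContinuousLinearEquiv.equivOfInverse
    ((ContinuousLinearMap.fst ℝ E B).prod
      (ContinuousLinearMap.snd ℝ E B + S ∘L ContinuousLinearMap.fst ℝ E B))
    ((ContinuousLinearMap.fst ℝ E B).prod
      (ContinuousLinearMap.snd ℝ E B - S ∘L ContinuousLinearMap.fst ℝ E B))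
    (by intro v; ext <;> simp) (by intro v; ext <;> simp)
  have hd : HasFDerivAt G (e' : (E × B) →L[ℝ] (E × B)) 0 := by
    have hHd : HasFDerivAt H (fderiv ℝ H 0) 0 :=
      (hH.differentiable (by simp)).differentiableAt.hasFDerivAt
    have h1 : HasFDerivAt (fun v : E × B => l v.1) (l ∘L ContinuousLinearMap.fst ℝ E B) 0 :=
      (l ∘L ContinuousLinearMap.fst ℝ E B).hasFDerivAt
    have h2 : HasFDerivAt (fun v : E × B => v.2 - A v.1)
      (ContinuousLinearMap.snd ℝ E B - A ∘L ContinuousLinearMap.fst ℝ E B) 0 :=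
      (ContinuousLinearMap.snd ℝ E B - A ∘L ContinuousLinearMap.fst ℝ E B).hasFDerivAt
    have h3 : HasFDerivAt (fun v : E × B => v.1) (ContinuousLinearMap.fst ℝ E B) 0 :=
      (ContinuousLinearMap.fst ℝ E B).hasFDerivAt
    have h4 := h3.prodMk (h2.add (h1.smul hHd))
    refine h4.congr_fderiv ?_
    apply ContinuousLinearMap.ext
    intro v
    simp [e', S]
    abel
  have hG0 : G 0 = 0 := by simp [hG]
  let e := hGs.contDiffAt.toOpenPartialHomeomorph G hd (n := ∞) (by simp)
  have he : ∀ v, e v = G v := fun v => rfl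
  have h0s : (0 : E × B) ∈ e.source :=
    hGs.contDiffAt.mem_toOpenPartialHomeomorph_source hd (by simp)
  have h0t : (0 : E × B) ∈ e.target := by
    have := e.map_source h0s
    rwa [he, hG0] at this
  have hsymm0 : e.symm 0 = 0 := by
    have := e.left_inv h0s
    rwa [he, hG0] at this
  have hopen : IsOpen {v : E × B | ∃ e'' : (E × B) ≃L[ℝ] (E × B), (e'' : (E × B) →L[ℝ] (E × B)) = fderiv ℝ G v} := by
    have h1 : IsOpen (range ((↑) : ((E × B) ≃L[ℝ] (E × B)) → (E × B) →L[ℝ] (E × B))) :=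
      ContinuousLinearEquiv.isOpen
    exact h1.preimage (hGs.continuous_fderiv (by simp))
  set N := {v : E × B | ∃ e'' : (E × B) ≃L[ℝ] (E × B), (e'' : (E × B) →L[ℝ] (E × B)) = fderiv ℝ G v}
  have hT : IsOpen (e.target ∩ e.symm ⁻¹' N) := e.isOpen_inter_preimage_symm hopen
  refine ⟨(fun p : E => (p, (0 : B))) ⁻¹' (e.target ∩ e.symm ⁻¹' N), e.source,
    fun p => (e.symm (p, 0)).2, hT.preimage (by fun_prop), ?_, ?_, ?_, e.open_source.mem_nhds h0s, ?_, ?_⟩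
  · refine ⟨h0t, ?_⟩
    change e.symm 0 ∈ N
    rw [hsymm0]
    exact ⟨e', hd.fderiv.symm⟩
  · intro p hp
    obtain ⟨hp1, e'', he''⟩ := hp
    have h1 : ContDiffAt ℝ ∞ e.symm (p, 0) := by
      refine e.contDiffAt_symm hp1 (f₀' := e'') ?_ hGs.contDiffAt
      rw [he'']
      exact (hGs.differentiable (by simp)).differentiableAt.hasFDerivAt
    have h2 : ContDiffAt ℝ ∞ (fun p : E => (p, (0 : B))) p := by fun_prop
    exact (ContDiffAt.snd (ContDiffAt.comp p h1 h2)).contDiffWithinAt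
  · change (e.symm 0).2 = 0
    rw [hsymm0]; rfl
  · intro p hp
    have h1 := e.right_inv hp.1
    rw [he] at h1
    have h2 : (e.symm (p, 0)).1 = p := congrArg Prod.fst h1
    have h3 := congrArg Prod.snd h1
    simp only [hG] at h3
    have h4 : e.symm (p, 0) = (p, (e.symm (p, 0)).2) := Prod.ext h2 rfl
    rw [h2] at h3
    rw [← h4]
    exact h3
  · intro v hv hz
    have h1 := e.left_inv hv
    rw [he] at h1
    simp only [hG] at h1
    rw [hz] at h1
    exact congrArg Prod.snd h1

abbrev II := Icc (0 : ℝ) 1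

noncomputable def ext01 (β : C(II, ℝ)) : ℝ → ℝ := fun s => β (projIcc 0 1 zero_le_one s)

theorem continuous_ext01 (β : C(II, ℝ)) : Continuous (ext01 β) :=
  β.continuous.comp continuous_projIcc

noncomputable def intOp : C(II, ℝ) →L[ℝ] C(II, ℝ) :=
  LinearMap.mkContinuous
    { toFun := fun f => ⟨fun t => ∫ s in (0:ℝ)..t, ext01 f s, by
        have := intervalIntegral.continuous_primitive
          (fun a b => (continuous_ext01 f).intervalIntegrable (μ := MeasureTheory.volume) a b) 0
        exact this.comp continuous_subtype_val⟩
      map_add' := by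
        intro f g; ext t
        exact intervalIntegral.integral_add ((continuous_ext01 f).intervalIntegrable _ _)
          ((continuous_ext01 g).intervalIntegrable _ _)
      map_smul' := by
        intro c f; ext t
        exact intervalIntegral.integral_const_mul c _ }
    1 (by
      intro f
      rw [ContinuousMap.norm_le _ (by positivity)]
      intro t
      have := intervalIntegral.norm_integral_le_of_norm_le_const (a := 0) (b := (t : ℝ))
        (f := ext01 f) (C := ‖f‖) (fun s _ => f.norm_coe_le_norm _)
      refine this.trans ?_
      rw [sub_zero, abs_of_nonneg t.2.1, one_mul]
      exact mul_le_of_le_one_right (norm_nonneg _) t.2.2)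

theorem intOp_apply (f : C(II, ℝ)) (t : II) : intOp f t = ∫ s in (0:ℝ)..t, ext01 f s := rfl

noncomputable def curveOp : ((ℝ × ℝ × ℝ) × C(II, ℝ)) →L[ℝ] C(II, ℝ × ℝ × ℝ) :=
  LinearMap.mkContinuous
    { toFun := fun v => ⟨fun t => (v.1.1, v.2 t, v.1.2.2 * (1 - (t : ℝ))), by fun_prop⟩
      map_add' := by intro v w; ext t <;> simp; ring
      map_smul' := by intro c v; ext t <;> simp; ring }
    1 (by
      intro v
      rw [ContinuousMap.norm_le _ (by positivity)]
      intro t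
      have ht : ‖1 - (t:ℝ)‖ ≤ 1 := by
        rw [Real.norm_eq_abs, abs_le]; constructor <;> linarith [t.2.1, t.2.2]
      have h1 : ‖v.1.1‖ ≤ ‖v‖ := (norm_fst_le _).trans (norm_fst_le _)
      have h2 : ‖v.2 t‖ ≤ ‖v‖ := (v.2.norm_coe_le_norm t).trans (norm_snd_le _)
      have h3 : ‖v.1.2.2‖ ≤ ‖v‖ := (norm_snd_le _).trans ((norm_snd_le _).trans (norm_fst_le _))
      have h4 : ‖v.1.2.2 * (1 - (t:ℝ))‖ ≤ ‖v‖ := by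
        rw [norm_mul]
        exact (mul_le_of_le_one_right (norm_nonneg _) ht).trans h3
      rw [one_mul]
      exact norm_prod_le_iff.2 ⟨h1, norm_prod_le_iff.2 ⟨h2, h4⟩⟩)

theorem curveOp_apply (v : (ℝ × ℝ × ℝ) × C(II, ℝ)) (t : II) :
    curveOp v t = (v.1.1, v.2 t, v.1.2.2 * (1 - (t : ℝ))) := rfl

/-- The integrand along a curve. -/
noncomputable def rhs (ψ : C(ℝ × ℝ × ℝ, ℝ)) (p : ℝ × ℝ × ℝ) (β : C(II, ℝ)) : ℝ → ℝ :=
  ext01 (ψ.comp (curveOp (p, β)))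

theorem rhs_eq (ψ : C(ℝ × ℝ × ℝ, ℝ)) (p : ℝ × ℝ × ℝ) (β : C(II, ℝ)) (s : ℝ) (hs : s ∈ II) :
    rhs ψ p β s = ψ (p.1, β ⟨s, hs⟩, p.2.2 * (1 - s)) := by
  simp [rhs, ext01, curveOp_apply, projIcc_of_mem _ hs]

/-- Solution of the (rescaled) characteristic equation in integral form. -/
def IsSol (ψ : C(ℝ × ℝ × ℝ, ℝ)) (p : ℝ × ℝ × ℝ) (β : C(II, ℝ)) : Prop :=
  ∀ t : II, β t - p.2.1 + p.2.2 * ∫ s in (0:ℝ)..t, rhs ψ p β s = 0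

noncomputable def shiftCurve (β : C(II, ℝ)) (τ : II) : C(II, ℝ) :=
  ⟨fun t => β ⟨τ + (1 - τ) * t, by
    have h1 := τ.2.1; have h2 := τ.2.2; have h3 := t.2.1; have h4 := t.2.2
    constructor <;> nlinarith⟩, by fun_prop⟩

theorem IsSol.shift {ψ : C(ℝ × ℝ × ℝ, ℝ)} {p : ℝ × ℝ × ℝ} {β : C(II, ℝ)} (h : IsSol ψ p β)
    (τ : II) : IsSol ψ (p.1, β τ, p.2.2 * (1 - τ)) (shiftCurve β τ) := by
  intro t
  have hmem : ∀ s ∈ II, (τ : ℝ) + (1 - τ) * s ∈ II := by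
    intro s hs
    have h1 := τ.2.1; have h2 := τ.2.2; have h3 := hs.1; have h4 := hs.2
    constructor <;> nlinarith
  have e1 : ∫ s in (0:ℝ)..t, rhs ψ (p.1, β τ, p.2.2 * (1 - τ)) (shiftCurve β τ) s
      = ∫ s in (0:ℝ)..t, rhs ψ p β (τ + (1 - τ) * s) := by
    apply intervalIntegral.integral_congr
    intro s hs
    rw [uIcc_of_le t.2.1] at hs
    have hs' : s ∈ II := ⟨hs.1, hs.2.trans t.2.2⟩
    simp only
    rw [rhs_eq _ _ _ _ hs', rhs_eq _ _ _ _ (hmem s hs')]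
    congr 3
    simp only
    ring
  have e2 := intervalIntegral.smul_integral_comp_add_mul (a := 0) (b := (t : ℝ))
    (rhs ψ p β) (1 - (τ : ℝ)) τ
  have hc : Continuous (rhs ψ p β) := continuous_ext01 _
  have e3 := intervalIntegral.integral_add_adjacent_intervals (μ := MeasureTheory.volume)
    (hc.intervalIntegrable 0 τ) (hc.intervalIntegrable τ (τ + (1 - τ) * t))
  have a1 := h τ
  have a2 := h ⟨_, hmem t t.2⟩
  simp only [smul_eq_mul, mul_zero, add_zero] at e2
  rw [e1]
  change β ⟨_, hmem t t.2⟩ - β τ + p.2.2 * (1 - τ) * _ = 0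
  rw [mul_assoc, e2]
  simp only at a2
  rw [← e3] at a2
  linear_combination a2 - a1

theorem norm_shiftCurve_le (β : C(II, ℝ)) (τ : II) : ‖shiftCurve β τ‖ ≤ ‖β‖ :=
  (ContinuousMap.norm_le _ (norm_nonneg _)).2 fun _ => β.norm_coe_le_norm _

theorem IsSol.hasDeriv {ψ : C(ℝ × ℝ × ℝ, ℝ)} {p : ℝ × ℝ × ℝ} {β : C(II, ℝ)}
    (h : IsSol ψ p β) :
    HasDerivWithinAt (fun τ : ℝ => ((p.1, ext01 β τ, p.2.2 * (1 - τ)) : ℝ × ℝ × ℝ))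
      (0, -(p.2.2 * ψ p), -p.2.2) (Icc 0 1) 0 := by
  have hz : (0 : ℝ) ∈ II := ⟨le_rfl, zero_le_one⟩
  have hb0 : β ⟨0, hz⟩ = p.2.1 := by
    have := h ⟨0, hz⟩
    simp only [intervalIntegral.integral_same, mul_zero, add_zero] at this
    linarith
  have hc : Continuous (rhs ψ p β) := continuous_ext01 _
  have h1 : HasDerivAt (fun τ : ℝ => p.2.1 - p.2.2 * ∫ s in (0:ℝ)..τ, rhs ψ p β s)
      (-(p.2.2 * rhs ψ p β 0)) 0 := by
    have := (intervalIntegral.integral_hasDerivAt_right (hc.intervalIntegrable 0 0)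
      (hc.stronglyMeasurableAtFilter _ _) hc.continuousAt)
    exact (this.const_mul p.2.2).const_sub p.2.1
  have hr : rhs ψ p β 0 = ψ p := by
    rw [rhs_eq _ _ _ _ hz, hb0]; simp
  rw [hr] at h1
  have h2 : HasDerivWithinAt (ext01 β) (-(p.2.2 * ψ p)) (Icc 0 1) 0 := by
    refine h1.hasDerivWithinAt.congr_of_mem ?_ hz
    intro τ hτ
    have := h ⟨τ, hτ⟩
    simp only at this
    rw [ext01, projIcc_of_mem _ hτ]
    linarith
  have h3 : HasDerivWithinAt (fun τ : ℝ => p.2.2 * (1 - τ)) (-p.2.2) (Icc 0 1) 0 := by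
    have := ((hasDerivAt_id (0:ℝ)).const_sub 1).const_mul p.2.2
    simpa using this.hasDerivWithinAt (s := Icc 0 1)
  exact (hasDerivWithinAt_const _ _ _).prodMk (h2.prodMk h3)

theorem core (ψ : C(ℝ × ℝ × ℝ, ℝ)) (hψ : ContDiff ℝ ∞ ψ) :
    ∃ (U : Set (ℝ × ℝ × ℝ)) (φ : (ℝ × ℝ × ℝ) → ℝ),
      IsOpen U ∧ (0 : ℝ × ℝ × ℝ) ∈ U ∧ ContDiffOn ℝ ∞ φ U ∧
      (∀ p ∈ U, fderiv ℝ φ p (0, 0, 1) + ψ p * fderiv ℝ φ p (0, 1, 0) = 0) ∧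
      (∀ p ∈ U, p.2.2 = 0 → φ p = p.2.1) := by
  let l : (ℝ × ℝ × ℝ) →L[ℝ] ℝ := ContinuousLinearMap.snd ℝ ℝ ℝ ∘L ContinuousLinearMap.snd ℝ ℝ (ℝ × ℝ)
  let A : (ℝ × ℝ × ℝ) →L[ℝ] C(II, ℝ) :=
    (ContinuousLinearMap.fst ℝ ℝ ℝ ∘L ContinuousLinearMap.snd ℝ ℝ (ℝ × ℝ)).smulRight 1
  let H : (ℝ × ℝ × ℝ) × C(II, ℝ) → C(II, ℝ) := fun v => intOp (ψ.comp (curveOp v))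
  have hH : ContDiff ℝ ∞ H :=
    intOp.contDiff.comp ((contDiff_postcomp II _ _ ψ hψ).comp curveOp.contDiff)
  obtain ⟨W, V, g, hW, h0W, hg, hg0, hV, hsol, huniq⟩ := implicit_special _ _ A l H hH
  have hiff : ∀ p β, IsSol ψ p β ↔ β - A p + l p • H (p, β) = 0 := by
    intro p β
    rw [ContinuousMap.ext_iff]
    refine forall_congr' fun t => ?_
    simp [A, l, H, intOp_apply, rhs]
  obtain ⟨r, hr, hrV⟩ := Metric.mem_nhds_iff.1 hV
  have hgc : ContinuousAt g 0 := (hg.contDiffAt (hW.mem_nhds h0W)).continuousAt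
  have hgn : ContinuousOn g W := hg.continuousOn
  let U : Set (ℝ × ℝ × ℝ) := (W ∩ g ⁻¹' Metric.ball 0 r) ∩ Metric.ball 0 r
  have hU : IsOpen U := (hgn.isOpen_inter_preimage hW Metric.isOpen_ball).inter Metric.isOpen_ball
  have h0U : (0 : ℝ × ℝ × ℝ) ∈ U :=
    ⟨⟨h0W, by simp [hg0, hr]⟩, Metric.mem_ball_self hr⟩
  let ev : C(II, ℝ) →L[ℝ] ℝ := ContinuousMap.evalCLM ℝ (⟨1, zero_le_one, le_rfl⟩ : II)
  let φ : (ℝ × ℝ × ℝ) → ℝ := fun p => g p ⟨1, zero_le_one, le_rfl⟩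
  have hφ : ContDiffOn ℝ ∞ φ U := by
    have : ContDiffOn ℝ ∞ (fun p => ev (g p)) U :=
      ev.contDiff.comp_contDiffOn (hg.mono fun p hp => hp.1.1)
    exact this
  have hS : ∀ p ∈ U, IsSol ψ p (g p) := fun p hp => (hiff p (g p)).2 (hsol p hp.1.1)
  have hdiff : ∀ p ∈ U, DifferentiableAt ℝ φ p := fun p hp =>
    (hφ.contDiffAt (hU.mem_nhds hp)).differentiableAt (by simp)
  have hpde0 : ∀ p ∈ U, p.2.2 ≠ 0 →
      fderiv ℝ φ p (0, 0, 1) + ψ p * fderiv ℝ φ p (0, 1, 0) = 0 := by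
    intro p hp hb
    have hd := (hS p hp).hasDeriv
    set β := g p with hβ
    have hz : (0 : ℝ) ∈ II := ⟨le_rfl, zero_le_one⟩
    have hc0 : ((p.1, ext01 β 0, p.2.2 * (1 - 0)) : ℝ × ℝ × ℝ) = p := by
      have := hS p hp ⟨0, hz⟩
      simp only [intervalIntegral.integral_same, mul_zero, add_zero] at this
      have h' : ext01 β 0 = p.2.1 := by
        rw [ext01, projIcc_of_mem _ hz]; linarith
      rw [h']; simp
    have hconst : ∀ τ ∈ Icc (0:ℝ) 1, φ (p.1, ext01 β τ, p.2.2 * (1 - τ)) = φ p := by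
      intro τ hτ
      have hs := (hS p hp).shift ⟨τ, hτ⟩
      rw [ext01, projIcc_of_mem _ hτ]
      have hβr : ‖β‖ < r := by simpa using hp.1.2
      have hpr : ‖p‖ < r := by simpa using hp.2
      have hv : ((p.1, β ⟨τ, hτ⟩, p.2.2 * (1 - τ)), shiftCurve β ⟨τ, hτ⟩) ∈ V := by
        apply hrV
        rw [mem_ball_zero_iff]
        have ht : ‖1 - τ‖ ≤ 1 := by
          rw [Real.norm_eq_abs, abs_le]; constructor <;> linarith [hτ.1, hτ.2]
        have h1 : ‖p.1‖ < r := (norm_fst_le _).trans_lt hpr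
        have h2 : ‖β ⟨τ, hτ⟩‖ < r := (β.norm_coe_le_norm _).trans_lt hβr
        have h3 : ‖p.2.2‖ < r := ((norm_snd_le _).trans (norm_snd_le _)).trans_lt hpr
        have h4 : ‖p.2.2 * (1 - τ)‖ < r := by
          rw [norm_mul]
          exact (mul_le_of_le_one_right (norm_nonneg _) ht).trans_lt h3
        have h5 := (norm_shiftCurve_le β ⟨τ, hτ⟩).trans_lt hβr
        exact max_lt (max_lt h1 (max_lt h2 h4)) h5
      have := huniq _ hv ((hiff _ _).1 hs)
      simp only [φ]
      simp only at this
      rw [this]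
      simp [shiftCurve, hβ]
      rfl
    have hf : HasFDerivAt φ (fderiv ℝ φ p) ((p.1, ext01 β 0, p.2.2 * (1 - 0)) : ℝ × ℝ × ℝ) := by
      rw [hc0]; exact (hdiff p hp).hasFDerivAt
    have h1 := hf.comp_hasDerivWithinAt (0:ℝ) hd
    have h2 : HasDerivWithinAt (φ ∘ fun τ : ℝ => ((p.1, ext01 β τ, p.2.2 * (1 - τ)) : ℝ × ℝ × ℝ))
        0 (Icc 0 1) 0 :=
      (hasDerivWithinAt_const (0:ℝ) (Icc 0 1) (φ p)).congr_of_mem (fun τ hτ => hconst τ hτ) hz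
    have h3 := (uniqueDiffOn_Icc_zero_one 0 hz).eq_deriv _ h1 h2
    have h4 : ((0, -(p.2.2 * ψ p), -p.2.2) : ℝ × ℝ × ℝ)
        = (-p.2.2) • ((0, 0, 1) + ψ p • (0, 1, 0)) := by
      ext <;> simp
    rw [h4, map_smul, map_add, map_smul, smul_eq_mul, smul_eq_mul] at h3
    exact (mul_eq_zero.1 h3).resolve_left (neg_ne_zero.2 hb)
  refine ⟨U, φ, hU, h0U, hφ, ?_, ?_⟩
  · intro p hp
    by_cases hb : p.2.2 = 0
    · have hfc : ContinuousAt (fderiv ℝ φ) p :=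
        ((hφ.contDiffAt (hU.mem_nhds hp)).fderiv_right (m := 0) (by simp)).continuousAt
      have hQ : ContinuousAt
          (fun q => fderiv ℝ φ q (0, 0, 1) + ψ q * fderiv ℝ φ q (0, 1, 0)) p :=
        (hfc.clm_apply continuousAt_const).add
          (ψ.continuous.continuousAt.mul (hfc.clm_apply continuousAt_const))
      let c : ℝ → ℝ × ℝ × ℝ := fun s => (p.1, p.2.1, s)
      have hc : Continuous c := by fun_prop
      have hcp : c 0 = p := by ext <;> simp [c, hb]
      have hct : Tendsto c (𝓝[≠] 0) (𝓝 p) := by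
        have := hc.tendsto 0
        rw [hcp] at this
        exact this.mono_left nhdsWithin_le_nhds
      have ht := hQ.tendsto.comp hct
      refine tendsto_nhds_unique ht ?_
      refine tendsto_const_nhds.congr' ?_
      filter_upwards [hct.eventually (hU.mem_nhds hp), self_mem_nhdsWithin] with s hs hs0
      exact (hpde0 _ hs hs0).symm
    · exact hpde0 p hp hb
  · intro p hp hb
    have := hS p hp ⟨1, zero_le_one, le_rfl⟩
    rw [hb] at this
    simp only [φ]
    linarith

/-- Given a smooth function `ψ` near the origin of `ℝ³` (coordinates
`(x,a,b)`), there is a neighbourhood `U` of `0` and a smooth solution `φ` of the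
Cauchy problem `∂_b φ + ψ ∂_a φ = 0`, `φ(x,a,0) = a`; for the resulting embedding
`ι(x,a,b) = (x, φ(x,a,b), a, b)` into `ℝ⁴ = ℝ²_{xy} × ℝ²_{ab}` (coordinates
`(x,y,a,b)`), `dι` sends `∂_x` to `∂_x + (∂_x φ) ∂_y` (vanishing `a`- and
`b`-components) and sends `∂_b + ψ ∂_a` to `ψ ∂_a + ∂_b` (vanishing `x`- and
`y`-components), realising the para-CR structure `(∂_x, ∂_b + ψ ∂_a)` as the one
induced on the hypersurface `ι(U)` by `Tℝ²_{xy}` and `Tℝ²_{ab}`. -/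
theorem stmt_1
    (U₀ : Set (ℝ × ℝ × ℝ)) (hU₀ : IsOpen U₀) (h0 : (0 : ℝ × ℝ × ℝ) ∈ U₀)
    (ψ : (ℝ × ℝ × ℝ) → ℝ) (hψ : ContDiffOn ℝ (⊤ : ℕ∞) ψ U₀) :
    ∃ (U : Set (ℝ × ℝ × ℝ)) (φ : (ℝ × ℝ × ℝ) → ℝ),
      IsOpen U ∧ (0 : ℝ × ℝ × ℝ) ∈ U ∧ U ⊆ U₀ ∧ ContDiffOn ℝ (⊤ : ℕ∞) φ U ∧
      (∀ p ∈ U, fderiv ℝ φ p (0, 0, 1) + ψ p * fderiv ℝ φ p (0, 1, 0) = 0) ∧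
      (∀ p ∈ U, p.2.2 = 0 → φ p = p.2.1) ∧
      (∀ p ∈ U,
        fderiv ℝ (fun q : ℝ × ℝ × ℝ => ((q.1, φ q, q.2.1, q.2.2) : ℝ × ℝ × ℝ × ℝ)) p
            (1, 0, 0) = (1, fderiv ℝ φ p (1, 0, 0), 0, 0) ∧
        fderiv ℝ (fun q : ℝ × ℝ × ℝ => ((q.1, φ q, q.2.1, q.2.2) : ℝ × ℝ × ℝ × ℝ)) p
            (0, ψ p, 1) = (0, 0, ψ p, 1)) := by
  obtain ⟨R, hR, hRU⟩ := Metric.mem_nhds_iff.1 (hU₀.mem_nhds h0)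
  let χ : ContDiffBump (0 : ℝ × ℝ × ℝ) :=
    { rIn := R / 4
      rOut := R / 2
      rIn_pos := by positivity
      rIn_lt_rOut := by linarith }
  have hsupp : tsupport χ ⊆ U₀ := by
    rw [χ.tsupport_eq]
    exact (Metric.closedBall_subset_ball (half_lt_self hR)).trans hRU
  have hsm : ContDiff ℝ ∞ (fun p => χ p * ψ p) := by
    rw [contDiff_iff_contDiffAt]
    intro p
    by_cases hp : p ∈ U₀
    · exact χ.contDiffAt.mul (hψ.contDiffAt (hU₀.mem_nhds hp))
    · have h1 : (χ : ℝ × ℝ × ℝ → ℝ) =ᶠ[𝓝 p] 0 :=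
        notMem_tsupport_iff_eventuallyEq.1 fun h => hp (hsupp h)
      refine (contDiffAt_const (c := (0 : ℝ))).congr_of_eventuallyEq ?_
      filter_upwards [h1] with q hq
      simp [hq]
  obtain ⟨U, φ, hU, h0U, hφ, hpde, hic⟩ := core ⟨fun p => χ p * ψ p, hsm.continuous⟩ hsm
  have hpde' : ∀ p ∈ U ∩ Metric.ball 0 (R / 4),
      fderiv ℝ φ p (0, 0, 1) + ψ p * fderiv ℝ φ p (0, 1, 0) = 0 := by
    intro p hp
    have h1 := hpde p hp.1
    have h2 : χ p = 1 := χ.one_of_mem_closedBall (Metric.ball_subset_closedBall hp.2)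
    simpa [h2] using h1
  refine ⟨U ∩ Metric.ball 0 (R / 4), φ, hU.inter Metric.isOpen_ball,
    ⟨h0U, Metric.mem_ball_self (by positivity)⟩, ?_, hφ.mono inter_subset_left, hpde',
    fun p hp => hic p hp.1, ?_⟩
  · exact fun p hp => hRU (Metric.ball_subset_ball (by linarith) hp.2)
  · intro p hp
    have hd : HasFDerivAt φ (fderiv ℝ φ p) p :=
      ((hφ.contDiffAt (hU.mem_nhds hp.1)).differentiableAt (by simp)).hasFDerivAt
    have h1 : HasFDerivAt (fun q : ℝ × ℝ × ℝ => ((q.1, φ q, q.2.1, q.2.2) : ℝ × ℝ × ℝ × ℝ))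
        ((ContinuousLinearMap.fst ℝ ℝ (ℝ × ℝ)).prod ((fderiv ℝ φ p).prod
          (ContinuousLinearMap.snd ℝ ℝ (ℝ × ℝ)))) p :=
      hasFDerivAt_fst.prodMk (hd.prodMk hasFDerivAt_snd)
    rw [h1.fderiv]
    refine ⟨by simp, ?_⟩
    have h4 : ((0, ψ p, 1) : ℝ × ℝ × ℝ) = (0, 0, 1) + ψ p • (0, 1, 0) := by
      ext <;> simp
    have h5 : fderiv ℝ φ p (0, ψ p, 1) = 0 := by
      rw [h4, map_add, map_smul, smul_eq_mul]
      exact hpde' p hp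
    simp [h5]
end

section
/- Let φ be a smooth function on an open neighborhood U of the origin in ℝ³ (coordinates (x,a,b)) with 1 + ∂_aφ ≠ 0 on U, and let M ⊂ ℝ⁴ be the image of the embedding ι(x,a,b) = (x, a + φ(a,b,x), a, b). Let f = (u,v): U → ℝ² be a para-CR function for the induced structure, i.e. ∂_x v = 0 and Y(u) = 0 where Y = ∂_b − (∂_bφ/(1+∂_aφ))·∂_a. Then there exist an open neighborhood Ω of M in ℝ⁴ and a para-holomorphic function f̃ = (ũ, ṽ): Ω → ℝ² with f̃ ∘ ι = f; moreover f̃ is unique in the sense that any two para-holomorphic functions on neighborhoods of M that agree with f on M agree on some common neighborhood of M. -/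
/-- The embedding `ι(x,a,b) = (x, a + φ(x,a,b), a, b)` of a para-CR manifold into
`ℝ⁴ = ℝ²_{xy} × ℝ²_{ab}` (coordinates `(x,y,a,b)`). -/
def iotaEmb (φ : (ℝ × ℝ × ℝ) → ℝ) (p : ℝ × ℝ × ℝ) : ℝ × ℝ × ℝ × ℝ :=
  (p.1, p.2.1 + φ p, p.2.1, p.2.2)

/-- A pair `(u,v)` of functions on an open set `Ω ⊆ ℝ⁴` is para-holomorphic if it
is differentiable, `u` depends only on `(x,y)` (i.e. `∂_a u = ∂_b u = 0`) and `v`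
depends only on `(a,b)` (i.e. `∂_x v = ∂_y v = 0`). -/
def IsParaHolPair (Ω : Set (ℝ × ℝ × ℝ × ℝ)) (u v : (ℝ × ℝ × ℝ × ℝ) → ℝ) : Prop :=
  DifferentiableOn ℝ u Ω ∧ DifferentiableOn ℝ v Ω ∧
  (∀ q ∈ Ω, fderiv ℝ u q (0, 0, 1, 0) = 0 ∧ fderiv ℝ u q (0, 0, 0, 1) = 0) ∧
  (∀ q ∈ Ω, fderiv ℝ v q (1, 0, 0, 0) = 0 ∧ fderiv ℝ v q (0, 1, 0, 0) = 0)

open Set Filter Topology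

theorem inv_lemma {E : Type*} [NormedAddCommGroup E] [NormedSpace ℝ E] [CompleteSpace E]
    (G : E → E) (W : Set E) (hW : IsOpen W) (hinj : InjOn G W)
    (hG : ∀ q ∈ W, ContDiffAt ℝ (⊤ : ℕ∞) G q)
    (hL : ∀ q ∈ W, ∃ L : E ≃L[ℝ] E, HasFDerivAt G (L : E →L[ℝ] E) q) :
    ∃ H : E → E, IsOpen (G '' W) ∧ ContDiffOn ℝ (⊤ : ℕ∞) H (G '' W) ∧ ∀ q ∈ W, H (G q) = q := by
  have hn : ((⊤ : ℕ∞) : WithTop ℕ∞) ≠ 0 := by simp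
  refine ⟨fun y => (fun h : Nonempty E => @Function.invFunOn _ _ h G W y) ⟨0⟩, ?_, ?_, ?_⟩
  · rw [isOpen_iff_mem_nhds]
    rintro _ ⟨q, hq, rfl⟩
    obtain ⟨L, hL⟩ := hL q hq
    rw [← ((hG q hq).hasStrictFDerivAt' hL hn).map_nhds_eq_of_equiv]
    exact image_mem_map (hW.mem_nhds hq)
  · rintro _ ⟨q, hq, rfl⟩
    obtain ⟨L, hL⟩ := hL q hq
    apply ContDiffAt.contDiffWithinAt
    have h1 := (hG q hq).to_localInverse hL hn
    refine h1.congr_of_eventuallyEq ?_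
    have h2 := ((hG q hq).hasStrictFDerivAt' hL hn).eventually_right_inverse
    have h3 := h1.continuousAt.eventually_mem
      (by rw [(hG q hq).localInverse_apply_image hL hn]; exact hW.mem_nhds hq)
    filter_upwards [h2, h3] with y hy2 hy3
    have hy : y ∈ G '' W := ⟨_, hy3, hy2⟩
    apply hinj (Function.invFunOn_mem hy) hy3
    rw [Function.invFunOn_eq hy]
    exact hy2.symm
  · intro q hq
    exact hinj (Function.invFunOn_mem ⟨q, hq, rfl⟩) hq (Function.invFunOn_eq ⟨q, hq, rfl⟩)

theorem const_dir {E : Type*} [NormedAddCommGroup E] [NormedSpace ℝ E]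
    (w : E → ℝ) (B : Set E) (hc : Convex ℝ B) (ho : IsOpen B) (hw : DifferentiableOn ℝ w B)
    (d : E) (hd : ∀ q ∈ B, fderiv ℝ w q d = 0) (q : E) (hq : q ∈ B) (t : ℝ)
    (hqt : q + t • d ∈ B) : w (q + t • d) = w q := by
  have hmem : ∀ s ∈ Icc (0 : ℝ) 1, q + s • (t • d) ∈ B := fun s hs => by
    have := hc.add_smul_sub_mem hq hqt hs
    simpa using this
  have hder : ∀ s ∈ Icc (0 : ℝ) 1, HasDerivAt (fun s : ℝ => w (q + s • (t • d))) 0 s := by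
    intro s hs
    have h1 : HasFDerivAt w (fderiv ℝ w (q + s • (t • d))) (q + s • (t • d)) :=
      (hw.differentiableAt (ho.mem_nhds (hmem s hs))).hasFDerivAt
    have h2 : HasDerivAt (fun s : ℝ => q + s • (t • d)) (t • d) s := by
      simpa using ((hasDerivAt_id s).smul_const (t • d)).const_add q
    have := h1.comp_hasDerivAt s h2
    rw [map_smul, hd _ (hmem s hs), smul_zero] at this
    exact this
  have := constant_of_has_deriv_right_zero (f := fun s : ℝ => w (q + s • (t • d))) (a := 0) (b := 1)
    (fun s hs => (hder s hs).continuousAt.continuousWithinAt)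
    (fun s hs => (hder s (Ico_subset_Icc_self hs)).hasDerivWithinAt) 1 (by simp)
  simpa using this

/-- The map sending (x,c,a,b) to (x, c + φ(x,c,b), a, b). -/
def GG (φ : (ℝ × ℝ × ℝ) → ℝ) (q : ℝ × ℝ × ℝ × ℝ) : ℝ × ℝ × ℝ × ℝ :=
  (q.1, q.2.1 + φ (q.1, q.2.1, q.2.2.2), q.2.2.1, q.2.2.2)

def WW (U : Set (ℝ × ℝ × ℝ)) : Set (ℝ × ℝ × ℝ × ℝ) :=
  {q | edist q.2.1 q.2.2.1 < Metric.infEDist ((q.1, q.2.2.1, q.2.2.2) : ℝ × ℝ × ℝ) Uᶜ}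

theorem WW_open (U : Set (ℝ × ℝ × ℝ)) : IsOpen (WW U) := by
  apply isOpen_lt
  · fun_prop
  · exact Metric.continuous_infEDist.comp (by fun_prop)

theorem WW_diag (U : Set (ℝ × ℝ × ℝ)) (hU : IsOpen U) (p) (hp : p ∈ U) :
    (p.1, p.2.1, p.2.1, p.2.2) ∈ WW U := by
  simp only [WW, mem_ofPred_eq, edist_self]
  rw [Metric.infEDist_pos_iff_notMem_closure, hU.isClosed_compl.closure_eq]
  simpa using hp

theorem WW_mem (U : Set (ℝ × ℝ × ℝ)) (q) (hq : q ∈ WW U) (t : ℝ)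
    (ht : |t - q.2.2.1| ≤ |q.2.1 - q.2.2.1|) : (q.1, t, q.2.2.2) ∈ U := by
  by_contra h
  have h1 := Metric.infEDist_le_edist_of_mem (x := ((q.1, q.2.2.1, q.2.2.2) : ℝ × ℝ × ℝ))
    (s := Uᶜ) h
  have h2 : edist ((q.1, q.2.2.1, q.2.2.2) : ℝ × ℝ × ℝ) (q.1, t, q.2.2.2) = edist t q.2.2.1 := by
    simp [Prod.edist_eq, edist_comm]
  have h3 : edist t q.2.2.1 ≤ edist q.2.1 q.2.2.1 := by
    rw [edist_dist, edist_dist]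
    exact ENNReal.ofReal_le_ofReal ht
  exact absurd (lt_of_lt_of_le hq (h1.trans (h2.le.trans h3))) (lt_irrefl _)

theorem GG_fderiv (φ : (ℝ × ℝ × ℝ) → ℝ) (q : ℝ × ℝ × ℝ × ℝ)
    (hφ : ContDiffAt ℝ (⊤ : ℕ∞) φ (q.1, q.2.1, q.2.2.2))
    (hnd : 1 + fderiv ℝ φ (q.1, q.2.1, q.2.2.2) (0, 1, 0) ≠ 0) :
    ContDiffAt ℝ (⊤ : ℕ∞) (GG φ) q ∧ ∃ L : (ℝ × ℝ × ℝ × ℝ) ≃L[ℝ] (ℝ × ℝ × ℝ × ℝ),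
      HasFDerivAt (GG φ) (L : (ℝ × ℝ × ℝ × ℝ) →L[ℝ] (ℝ × ℝ × ℝ × ℝ)) q ∧
      ∀ h, L h = (h.1, h.2.1 + fderiv ℝ φ (q.1, q.2.1, q.2.2.2) (h.1, h.2.1, h.2.2.2),
        h.2.2.1, h.2.2.2) := by
  have hc : ContDiffAt ℝ (⊤ : ℕ∞)
      (fun q : ℝ × ℝ × ℝ × ℝ => φ (q.1, q.2.1, q.2.2.2)) q :=
    ContDiffAt.comp q (g := φ) (f := fun q : ℝ × ℝ × ℝ × ℝ => (q.1, q.2.1, q.2.2.2)) hφ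
      (by fun_prop)
  have hG : ContDiffAt ℝ (⊤ : ℕ∞) (GG φ) q := by
    unfold GG; fun_prop
  refine ⟨hG, ?_⟩
  set D := fderiv ℝ φ (q.1, q.2.1, q.2.2.2) with hD
  have hφd : HasFDerivAt φ D (q.1, q.2.1, q.2.2.2) :=
    (hφ.differentiableAt (by simp)).hasFDerivAt
  have e1 : HasFDerivAt (fun q : ℝ × ℝ × ℝ × ℝ => q.1) (.fst ℝ ℝ (ℝ × ℝ × ℝ)) q := hasFDerivAt_fst
  have e2' : HasFDerivAt (fun q : ℝ × ℝ × ℝ × ℝ => q.2) (.snd ℝ ℝ (ℝ × ℝ × ℝ)) q := hasFDerivAt_snd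
  have e2 := e2'.fst
  have e3 := e2'.snd.fst
  have e4 := e2'.snd.snd
  have ef := hφd.comp q (e1.prodMk (e2.prodMk e4))
  have eG := e1.prodMk ((e2.add ef).prodMk (e3.prodMk e4))
  have eG : HasFDerivAt (GG φ) _ q := eG
  set A := fderiv ℝ (GG φ) q with hA
  have hAh : ∀ h, A h = (h.1, h.2.1 + D (h.1, h.2.1, h.2.2.2), h.2.2.1, h.2.2.2) := by
    intro h
    rw [hA, eG.fderiv]
    simp
  have hAi : Function.Injective (A : (ℝ × ℝ × ℝ × ℝ) →ₗ[ℝ] (ℝ × ℝ × ℝ × ℝ)) := by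
    rw [← LinearMap.ker_eq_bot, LinearMap.ker_eq_bot']
    rintro ⟨h1, h2, h3, h4⟩ h
    have hh : A (h1, h2, h3, h4) = 0 := h
    clear h
    rw [hAh] at hh
    simp only [Prod.mk_eq_zero] at hh
    obtain ⟨rfl, h, rfl, rfl⟩ := hh
    have : ((0, h2, 0) : ℝ × ℝ × ℝ) = h2 • (0, 1, 0) := by simp
    rw [this, map_smul, smul_eq_mul] at h
    have : h2 * (1 + D (0, 1, 0)) = 0 := by linarith
    rcases mul_eq_zero.1 this with rfl | h'
    · simp
    · exact absurd h' hnd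
  refine ⟨(LinearEquiv.ofInjectiveEndo _ hAi).toContinuousLinearEquiv, ?_, ?_⟩
  · have : (((LinearEquiv.ofInjectiveEndo _ hAi).toContinuousLinearEquiv :
      (ℝ × ℝ × ℝ × ℝ) ≃L[ℝ] (ℝ × ℝ × ℝ × ℝ)) : (ℝ × ℝ × ℝ × ℝ) →L[ℝ] (ℝ × ℝ × ℝ × ℝ)) = A := by
      exact ContinuousLinearMap.ext fun h => rfl
    rw [this]
    exact eG.differentiableAt.hasFDerivAt
  · intro h
    exact hAh h

theorem rolle_inj (φ : (ℝ × ℝ × ℝ) → ℝ) (x b s t : ℝ) (hst : s < t)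
    (hd : ∀ r ∈ Icc s t, DifferentiableAt ℝ φ (x, r, b))
    (hnd : ∀ r ∈ Icc s t, 1 + fderiv ℝ φ (x, r, b) (0, 1, 0) ≠ 0) :
    s + φ (x, s, b) ≠ t + φ (x, t, b) := by
  intro h
  have hder : ∀ r ∈ Icc s t, HasDerivAt (fun r => r + φ (x, r, b))
      (1 + fderiv ℝ φ (x, r, b) (0, 1, 0)) r := by
    intro r hr
    have h1 : HasDerivAt (fun r : ℝ => ((x, r, b) : ℝ × ℝ × ℝ)) (0, 1, 0) r :=
      (hasDerivAt_const r x).prodMk ((hasDerivAt_id r).prodMk (hasDerivAt_const r b))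
    exact (hasDerivAt_id r).add ((hd r hr).hasFDerivAt.comp_hasDerivAt r h1)
  obtain ⟨c, hc, h0⟩ := exists_hasDerivAt_eq_zero hst
    (fun r hr => (hder r hr).continuousAt.continuousWithinAt) h
    (fun r hr => hder r (Ioo_subset_Icc_self hr))
  exact hnd c (Ioo_subset_Icc_self hc) h0

theorem GG_inj (U : Set (ℝ × ℝ × ℝ)) (φ : (ℝ × ℝ × ℝ) → ℝ)
    (hd : ∀ p ∈ U, DifferentiableAt ℝ φ p)
    (hnd : ∀ p ∈ U, 1 + fderiv ℝ φ p (0, 1, 0) ≠ 0) : InjOn (GG φ) (WW U) := by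
  rintro ⟨x, s, a, b⟩ hq ⟨x', t, a', b'⟩ hq' h
  simp only [GG, Prod.mk.injEq] at h
  obtain ⟨rfl, h, rfl, rfl⟩ := h
  have key : ∀ r, (min s t ≤ r ∧ r ≤ max s t) → (x, r, b) ∈ U := by
    intro r hr
    by_cases h1 : |r - a| ≤ |s - a|
    · exact WW_mem U _ hq r h1
    · refine WW_mem U _ hq' r ?_
      simp only
      rcases abs_cases (r - a) with h2 | h2 <;> rcases abs_cases (s - a) with h3 | h3 <;>
      rcases abs_cases (t - a) with h4 | h4 <;> rcases min_cases s t with h5 | h5 <;>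
      rcases max_cases s t with h6 | h6 <;> linarith
  rcases lt_trichotomy s t with hst | rfl | hst
  · refine absurd h (rolle_inj φ x b s t hst (fun r hr => hd _ (key r ?_)) fun r hr => hnd _ (key r ?_)) <;>
    · rw [min_eq_left hst.le, max_eq_right hst.le]; exact hr
  · rfl
  · refine absurd h.symm (rolle_inj φ x b t s hst (fun r hr => hd _ (key r ?_)) fun r hr => hnd _ (key r ?_)) <;>
    · rw [min_eq_right hst.le, max_eq_left hst.le]; exact hr

/-- A para-CR function `f = (u,v)` on an embedded para-CR manifold
`M = ι(U)` extends to a para-holomorphic function on a neighbourhood `Ω` of `M`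
in `ℝ⁴`, smooth and uniquely so: any two para-holomorphic functions on
neighbourhoods of `M` agreeing with `f` on `M` agree on a common neighbourhood. -/
theorem stmt_3
    (U : Set (ℝ × ℝ × ℝ)) (hU : IsOpen U) (h0 : (0 : ℝ × ℝ × ℝ) ∈ U)
    (φ : (ℝ × ℝ × ℝ) → ℝ) (hφ : ContDiffOn ℝ (⊤ : ℕ∞) φ U)
    (hnd : ∀ p ∈ U, 1 + fderiv ℝ φ p (0, 1, 0) ≠ 0)
    (u v : (ℝ × ℝ × ℝ) → ℝ) (hu : ContDiffOn ℝ (⊤ : ℕ∞) u U) (hv : ContDiffOn ℝ (⊤ : ℕ∞) v U)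
    (hCRv : ∀ p ∈ U, fderiv ℝ v p (1, 0, 0) = 0)
    (hCRu : ∀ p ∈ U, fderiv ℝ u p
        (0, -fderiv ℝ φ p (0, 0, 1) / (1 + fderiv ℝ φ p (0, 1, 0)), 1) = 0) :
    (∃ (Ω : Set (ℝ × ℝ × ℝ × ℝ)) (ut vt : (ℝ × ℝ × ℝ × ℝ) → ℝ),
      IsOpen Ω ∧ (∀ p ∈ U, iotaEmb φ p ∈ Ω) ∧
      ContDiffOn ℝ (⊤ : ℕ∞) ut Ω ∧ ContDiffOn ℝ (⊤ : ℕ∞) vt Ω ∧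
      IsParaHolPair Ω ut vt ∧
      (∀ p ∈ U, ut (iotaEmb φ p) = u p ∧ vt (iotaEmb φ p) = v p)) ∧
    (∀ (Ω₁ Ω₂ : Set (ℝ × ℝ × ℝ × ℝ)) (u₁ v₁ u₂ v₂ : (ℝ × ℝ × ℝ × ℝ) → ℝ),
      IsOpen Ω₁ → IsOpen Ω₂ →
      (∀ p ∈ U, iotaEmb φ p ∈ Ω₁) → (∀ p ∈ U, iotaEmb φ p ∈ Ω₂) →
      IsParaHolPair Ω₁ u₁ v₁ → IsParaHolPair Ω₂ u₂ v₂ →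
      (∀ p ∈ U, u₁ (iotaEmb φ p) = u p ∧ v₁ (iotaEmb φ p) = v p) →
      (∀ p ∈ U, u₂ (iotaEmb φ p) = u p ∧ v₂ (iotaEmb φ p) = v p) →
      ∃ Ω₃ : Set (ℝ × ℝ × ℝ × ℝ),
        IsOpen Ω₃ ∧ Ω₃ ⊆ Ω₁ ∩ Ω₂ ∧ (∀ p ∈ U, iotaEmb φ p ∈ Ω₃) ∧
        ∀ q ∈ Ω₃, u₁ q = u₂ q ∧ v₁ q = v₂ q) := by
  have hφa : ∀ p ∈ U, ContDiffAt ℝ (⊤ : ℕ∞) φ p := fun p hp => hφ.contDiffAt (hU.mem_nhds hp)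
  have hua : ∀ p ∈ U, ContDiffAt ℝ (⊤ : ℕ∞) u p := fun p hp => hu.contDiffAt (hU.mem_nhds hp)
  have hva : ∀ p ∈ U, ContDiffAt ℝ (⊤ : ℕ∞) v p := fun p hp => hv.contDiffAt (hU.mem_nhds hp)
  have hWU : ∀ q ∈ WW U, (q.1, q.2.1, q.2.2.2) ∈ U := fun q hq => WW_mem U q hq _ le_rfl
  have hWU' : ∀ q ∈ WW U, (q.1, q.2.2.1, q.2.2.2) ∈ U := fun q hq => WW_mem U q hq _ (by simp)
  have hGd := fun q (hq : q ∈ WW U) => GG_fderiv φ q (hφa _ (hWU q hq)) (hnd _ (hWU q hq))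
  have hιG : ∀ p, iotaEmb φ p = GG φ (p.1, p.2.1, p.2.1, p.2.2) := fun p => rfl
  constructor
  · obtain ⟨H, hO, hH, hHG⟩ := inv_lemma (GG φ) (WW U) (WW_open U)
      (GG_inj U φ (fun p hp => (hφa p hp).differentiableAt (by simp)) hnd)
      (fun q hq => (hGd q hq).1) (fun q hq => (hGd q hq).2.imp fun L h => h.1)
    have hut : ContDiffOn ℝ (⊤ : ℕ∞)
        (fun y => u ((H y).1, (H y).2.1, (H y).2.2.2)) (GG φ '' WW U) := by
      rintro _ ⟨q, hq, rfl⟩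
      apply ContDiffAt.contDiffWithinAt
      have h1 := hH.contDiffAt (hO.mem_nhds ⟨q, hq, rfl⟩)
      refine ContDiffAt.comp (GG φ q) (g := u)
        (f := fun y => ((H y).1, (H y).2.1, (H y).2.2.2)) ?_ (by fun_prop)
      rw [hHG q hq]; exact hua _ (hWU q hq)
    have hvt : ContDiffOn ℝ (⊤ : ℕ∞)
        (fun y : ℝ × ℝ × ℝ × ℝ => v (y.1, y.2.2.1, y.2.2.2)) (GG φ '' WW U) := by
      rintro _ ⟨q, hq, rfl⟩
      apply ContDiffAt.contDiffWithinAt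
      exact ContDiffAt.comp (GG φ q) (g := v)
        (f := fun y : ℝ × ℝ × ℝ × ℝ => (y.1, y.2.2.1, y.2.2.2)) (hva _ (hWU' q hq)) (by fun_prop)
    refine ⟨GG φ '' WW U, _, _, hO, ?_, hut, hvt,
      ⟨hut.differentiableOn (by simp), hvt.differentiableOn (by simp), ?_, ?_⟩, ?_⟩
    · intro p hp
      exact ⟨_, WW_diag U hU p hp, rfl⟩
    · rintro _ ⟨q, hq, rfl⟩
      obtain ⟨-, L, hL, hLh⟩ := hGd q hq
      have hud := (((hut.contDiffAt (hO.mem_nhds ⟨q, hq, rfl⟩)).differentiableAt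
        (by simp)).hasFDerivAt)
      have hc := hud.comp q hL
      have hπ : HasFDerivAt (fun q : ℝ × ℝ × ℝ × ℝ => (q.1, q.2.1, q.2.2.2))
          ((ContinuousLinearMap.fst ℝ ℝ (ℝ × ℝ × ℝ)).prod
            ((((ContinuousLinearMap.fst ℝ ℝ (ℝ × ℝ)).comp (ContinuousLinearMap.snd ℝ ℝ (ℝ × ℝ × ℝ)))).prod
              ((ContinuousLinearMap.snd ℝ ℝ ℝ).comp
                ((ContinuousLinearMap.snd ℝ ℝ (ℝ × ℝ)).comp (ContinuousLinearMap.snd ℝ ℝ (ℝ × ℝ × ℝ)))))) q := by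
        exact hasFDerivAt_fst.prodMk (hasFDerivAt_snd.fst.prodMk hasFDerivAt_snd.snd.snd)
      have hu' := (((hua _ (hWU q hq)).differentiableAt (by simp)).hasFDerivAt).comp q hπ
      have heq : ((fun y => u ((H y).1, (H y).2.1, (H y).2.2.2)) ∘ GG φ) =ᶠ[𝓝 q]
          (u ∘ fun q : ℝ × ℝ × ℝ × ℝ => (q.1, q.2.1, q.2.2.2)) := by
        filter_upwards [(WW_open U).mem_nhds hq] with r hr
        simp [hHG r hr]
      have huniq := (hu'.congr_of_eventuallyEq heq).unique hc
      have hap := fun h => congrArg (fun T : (ℝ × ℝ × ℝ × ℝ) →L[ℝ] ℝ => T h) huniq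
      simp only [ContinuousLinearMap.comp_apply, ContinuousLinearEquiv.coe_coe, hLh,
        ContinuousLinearMap.prod_apply, ContinuousLinearMap.coe_fst',
        ContinuousLinearMap.coe_snd'] at hap
      constructor
      · have := hap (0, 0, 1, 0)
        have hz : ((0, 0, 0) : ℝ × ℝ × ℝ) = 0 := rfl
        simp only [hz, map_zero, add_zero] at this
        exact this.symm
      · set p : ℝ × ℝ × ℝ := (q.1, q.2.1, q.2.2.2) with hp
        set c := -fderiv ℝ φ p (0, 0, 1) / (1 + fderiv ℝ φ p (0, 1, 0)) with hcdef
        have := hap (0, c, 0, 1)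
        simp only at this
        rw [hCRu p (hWU q hq)] at this
        have hs : ((0, c, 1) : ℝ × ℝ × ℝ) = c • (0, 1, 0) + (0, 0, 1) := by simp
        have hz : c + fderiv ℝ φ p (0, c, 1) = 0 := by
          rw [hs, map_add, map_smul, smul_eq_mul]
          have := hnd p (hWU q hq)
          rw [hcdef]; field_simp; ring
        rw [hz] at this
        exact this.symm
    · rintro _ ⟨q, hq, rfl⟩
      have hπ : HasFDerivAt (fun q : ℝ × ℝ × ℝ × ℝ => (q.1, q.2.2.1, q.2.2.2))
          ((ContinuousLinearMap.fst ℝ ℝ (ℝ × ℝ × ℝ)).prod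
            ((ContinuousLinearMap.snd ℝ ℝ (ℝ × ℝ)).comp (ContinuousLinearMap.snd ℝ ℝ (ℝ × ℝ × ℝ)))) (GG φ q) := by
        exact hasFDerivAt_fst.prodMk hasFDerivAt_snd.snd
      have hv' := HasFDerivAt.comp (GG φ q) (g := v)
        (((hva _ (hWU' q hq)).differentiableAt (by simp)).hasFDerivAt) hπ
      have hv'' := hv'.fderiv
      have hap := fun h => congrArg (fun T : (ℝ × ℝ × ℝ × ℝ) →L[ℝ] ℝ => T h) hv''
      constructor
      · refine (hap _).trans ?_
        exact hCRv _ (hWU' q hq)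
      · refine (hap _).trans ?_
        exact map_zero (fderiv ℝ v ((GG φ q).1, (GG φ q).2.2.1, (GG φ q).2.2.2))
    · intro p hp
      have := hHG _ (WW_diag U hU p hp)
      simp only [hιG, this]
      exact ⟨trivial, rfl⟩
  · intro Ω₁ Ω₂ u₁ v₁ u₂ v₂ ho₁ ho₂ hm₁ hm₂ hp₁ hp₂ hf₁ hf₂
    refine ⟨interior {q | q ∈ Ω₁ ∩ Ω₂ ∧ (u₁ q = u₂ q ∧ v₁ q = v₂ q)}, isOpen_interior,
      interior_subset.trans fun q hq => hq.1, ?_, fun q hq => (interior_subset hq).2⟩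
    intro p hp
    rw [mem_interior_iff_mem_nhds]
    obtain ⟨ε, hε, hB⟩ := Metric.mem_nhds_iff.1
      ((ho₁.inter ho₂).mem_nhds ⟨hm₁ p hp, hm₂ p hp⟩)
    set B := Metric.ball (iotaEmb φ p) ε with hBdef
    have hBo : IsOpen B := Metric.isOpen_ball
    have hBc : Convex ℝ B := convex_ball _ _
    have hpB : iotaEmb φ p ∈ B := Metric.mem_ball_self hε
    obtain ⟨du₁, dv₁, cu₁, cv₁⟩ := hp₁
    obtain ⟨du₂, dv₂, cu₂, cv₂⟩ := hp₂
    have s₁ : B ⊆ Ω₁ := fun q hq => (hB hq).1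
    have s₂ : B ⊆ Ω₂ := fun q hq => (hB hq).2
    have hU4 : ∀ᶠ q : ℝ × ℝ × ℝ × ℝ in 𝓝 (iotaEmb φ p), (q.1, q.2.2.1, q.2.2.2) ∈ U := by
      have hc : Continuous fun q : ℝ × ℝ × ℝ × ℝ => (q.1, q.2.2.1, q.2.2.2) := by fun_prop
      exact hc.continuousAt.eventually_mem (hU.mem_nhds hp)
    have hvev : ∀ᶠ q in 𝓝 (iotaEmb φ p), v₁ q = v₂ q := by
      have hcont : ContinuousAt (fun q : ℝ × ℝ × ℝ × ℝ =>
          iotaEmb φ (q.1, q.2.2.1, q.2.2.2)) (iotaEmb φ p) := by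
        have hc : ContinuousAt (fun q : ℝ × ℝ × ℝ × ℝ => φ (q.1, q.2.2.1, q.2.2.2))
            (iotaEmb φ p) :=
          ContinuousAt.comp (g := φ) (f := fun q : ℝ × ℝ × ℝ × ℝ => (q.1, q.2.2.1, q.2.2.2))
            (hφa p hp).continuousAt (by fun_prop)
        unfold iotaEmb at hc ⊢
        fun_prop
      filter_upwards [hU4, hcont.eventually_mem (hBo.mem_nhds hpB), hBo.mem_nhds hpB]
        with q h1 h2 h3
      have he : iotaEmb φ (q.1, q.2.2.1, q.2.2.2) =
          q + (q.2.2.1 + φ (q.1, q.2.2.1, q.2.2.2) - q.2.1) • ((0, 1, 0, 0) : ℝ × ℝ × ℝ × ℝ) := by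
        obtain ⟨x, y, a, b⟩ := q
        simp [iotaEmb]
      have e₁ := const_dir v₁ B hBc hBo (dv₁.mono s₁) _ (fun q hq => (cv₁ q (s₁ hq)).2) q h3 _
        (he ▸ h2)
      have e₂ := const_dir v₂ B hBc hBo (dv₂.mono s₂) _ (fun q hq => (cv₂ q (s₂ hq)).2) q h3 _
        (he ▸ h2)
      rw [← he] at e₁ e₂
      rw [← e₁, ← e₂, (hf₁ _ h1).2, (hf₂ _ h1).2]
    have huev : ∀ᶠ q in 𝓝 (iotaEmb φ p), u₁ q = u₂ q := by
      have hq₀ := WW_diag U hU p hp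
      obtain ⟨hGc, L, hL, -⟩ := hGd _ hq₀
      rw [hιG, ← (hGc.hasStrictFDerivAt' hL (by simp)).map_nhds_eq_of_equiv, eventually_map]
      have hcont : ContinuousAt (fun q : ℝ × ℝ × ℝ × ℝ =>
          GG φ (q.1, q.2.1, q.2.1, q.2.2.2)) (p.1, p.2.1, p.2.1, p.2.2) :=
        ContinuousAt.comp (g := GG φ)
          (f := fun q : ℝ × ℝ × ℝ × ℝ => (q.1, q.2.1, q.2.1, q.2.2.2))
          hGc.continuousAt (by fun_prop)
      filter_upwards [(WW_open U).mem_nhds hq₀, hcont.eventually_mem (hBo.mem_nhds hpB),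
        hGc.continuousAt.eventually_mem (hBo.mem_nhds hpB)] with q h1 h2 h3
      have he : GG φ (q.1, q.2.1, q.2.1, q.2.2.2) =
          GG φ q + (q.2.1 - q.2.2.1) • ((0, 0, 1, 0) : ℝ × ℝ × ℝ × ℝ) := by
        obtain ⟨x, y, a, b⟩ := q
        simp [GG]
      have e₁ := const_dir u₁ B hBc hBo (du₁.mono s₁) _ (fun q hq => (cu₁ q (s₁ hq)).1) _ h3 _
        (he ▸ h2)
      have e₂ := const_dir u₂ B hBc hBo (du₂.mono s₂) _ (fun q hq => (cu₂ q (s₂ hq)).1) _ h3 _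
        (he ▸ h2)
      rw [← he] at e₁ e₂
      have h4 := hWU q h1
      have g₁ := (hf₁ _ h4).1
      have g₂ := (hf₂ _ h4).1
      rw [hιG] at g₁ g₂
      rw [← e₁, ← e₂]
      exact g₁.trans g₂.symm
    filter_upwards [hvev, huev, hBo.mem_nhds hpB] with q h1 h2 h3
    exact ⟨hB h3, h2, h1⟩
end

section
/- Let M ⊂ ℝ⁴ be the embedded para-CR hypersurface given by ι(x,a,b) = (x, a+φ(a,b,x), a, b) over an open set U ⊂ ℝ³, where φ is smooth and 1+∂_aφ ≠ 0, with induced direction fields L₁ = TM ∩ Tℝ²_{xy} and L₂ = TM ∩ Tℝ²_{ab}. Then: (1) if V is a smooth vector field on an open subset of M whose local flow maps are local para-CR automorphisms of M (diffeomorphisms between open subsets of M whose differentials map L₁ into L₁ and L₂ into L₂), then near every point of its domain V extends to a para-holomorphic vector field defined on an open subset of ℝ⁴; (2) conversely, if Ṽ is a para-holomorphic vector field on an open subset Ω of ℝ⁴ that is tangent to M at every point of M ∩ Ω, then the restriction of Ṽ to M ∩ Ω is a local infinitesimal para-CR automorphism of M, i.e. its local flow maps are local para-CR automorphisms. -/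
/-- The `∂_a`-coefficient of the induced direction field
`Y = ∂_b − (∂_bφ/(1+∂_aφ)) ∂_a` in parameter coordinates `(x,a,b)`: in these
coordinates the induced para-CR structure of `M` is `L₁ = ℝ·(1,0,0)`
(corresponding to `TM ∩ Tℝ²_{xy}`) and `L₂ = ℝ·(0,ψ,1)` (corresponding to
`TM ∩ Tℝ²_{ab}`). -/
noncomputable def psiOf (φ : (ℝ × ℝ × ℝ) → ℝ) (p : ℝ × ℝ × ℝ) : ℝ :=
  -fderiv ℝ φ p (0, 0, 1) / (1 + fderiv ℝ φ p (0, 1, 0))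

/-- A map `G` (read in parameter coordinates) is a local para-CR automorphism on
`W₀` when its differential maps the direction field `L₁` into `L₁` and `L₂` into
`L₂` with nonzero factors. -/
def ParaCRMapOn (φ : (ℝ × ℝ × ℝ) → ℝ) (W₀ : Set (ℝ × ℝ × ℝ))
    (G : (ℝ × ℝ × ℝ) → (ℝ × ℝ × ℝ)) : Prop :=
  ∀ p ∈ W₀,
    (∃ c : ℝ, c ≠ 0 ∧ fderiv ℝ G p (1, 0, 0) = c • ((1 : ℝ), (0 : ℝ), (0 : ℝ))) ∧
    (∃ c : ℝ, c ≠ 0 ∧ fderiv ℝ G p (0, psiOf φ p, 1)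
        = c • ((0 : ℝ), psiOf φ (G p), (1 : ℝ)))

/-- `σ` is a local flow of the vector field `V` on `W₀ ⊆ W`, for times in
`(-ε, ε)`. -/
def IsLocalFlowOf (W : Set (ℝ × ℝ × ℝ)) (V : (ℝ × ℝ × ℝ) → (ℝ × ℝ × ℝ)) (ε : ℝ)
    (W₀ : Set (ℝ × ℝ × ℝ)) (σ : ℝ → (ℝ × ℝ × ℝ) → (ℝ × ℝ × ℝ)) : Prop :=
  0 < ε ∧ IsOpen W₀ ∧ W₀ ⊆ W ∧ (∀ p ∈ W₀, σ 0 p = p) ∧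
  ∀ p ∈ W₀, ∀ t ∈ Set.Ioo (-ε) ε,
    σ t p ∈ W ∧ HasDerivAt (fun s => σ s p) (V (σ t p)) t

/-- A para-holomorphic vector field on `Ω ⊆ ℝ⁴`, i.e. of the form
`ξ(x,y)∂_x + η(x,y)∂_y + α(a,b)∂_a + β(a,b)∂_b`, smooth on `Ω`. -/
def IsParaHolVF (Ω : Set (ℝ × ℝ × ℝ × ℝ)) (Vt : (ℝ × ℝ × ℝ × ℝ) → ℝ × ℝ × ℝ × ℝ) : Prop :=
  ContDiffOn ℝ (⊤ : ℕ∞) Vt Ω ∧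
  ∃ ξ η α β : ℝ × ℝ → ℝ, ∀ q ∈ Ω,
    Vt q = (ξ (q.1, q.2.1), η (q.1, q.2.1), α (q.2.2.1, q.2.2.2), β (q.2.2.1, q.2.2.2))

section

open Set Metric Filter Topology NNReal

theorem pl_flow {E : Type*} [NormedAddCommGroup E] [NormedSpace ℝ E] [CompleteSpace E]
    {f : ℝ → E → E} {tmin tmax : ℝ} {t₀ : Icc tmin tmax} {x₀ : E} {a r L K : ℝ≥0}
    (hf : IsPicardLindelof f t₀ x₀ a r L K) :
    ∃ α : E → ℝ → E, (∀ x ∈ closedBall x₀ r, α x t₀ = x ∧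
      ∀ t ∈ Icc tmin tmax, α x t ∈ closedBall x₀ a ∧
        HasDerivWithinAt (α x) (f t (α x t)) (Icc tmin tmax) t) ∧
      ∃ L' : ℝ≥0, ∀ t ∈ Icc tmin tmax, LipschitzOnWith L' (α · t) (closedBall x₀ r) := by
  classical
  have (x) (hx : x ∈ closedBall x₀ r) := ODE.FunSpace.exists_isFixedPt_next hf hx
  choose α hα using this
  set α' := fun (x : E) ↦ if hx : x ∈ closedBall x₀ r then
    α x hx |>.compProj else 0 with hα'
  refine ⟨α', fun x hx ↦ ⟨?_, fun t ht ↦ ⟨?_, ?_⟩⟩, ?_⟩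
  · rw [hα']
    beta_reduce
    rw [dif_pos hx, ODE.FunSpace.compProj_val, ← hα, ODE.FunSpace.next_apply₀]
  · rw [hα']
    beta_reduce
    rw [dif_pos hx]
    exact (α x hx).compProj_mem_closedBall hf.mul_max_le
  · rw [hα']
    beta_reduce
    rw [dif_pos hx, ODE.FunSpace.compProj_apply]
    apply ODE.hasDerivWithinAt_picard_Icc t₀.2 hf.continuousOn_uncurry
      (α x hx |>.continuous_compProj.continuousOn)
      (fun _ ht' ↦ α x hx |>.compProj_mem_closedBall hf.mul_max_le)
      x ht |>.congr_of_mem _ ht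
    intro t' ht'
    nth_rw 1 [← hα]
    rw [ODE.FunSpace.compProj_of_mem ht', ODE.FunSpace.next_apply]
  · obtain ⟨L', h⟩ := ODE.FunSpace.exists_forall_closedBall_funSpace_dist_le_mul hf
    refine ⟨L', fun t ht ↦ LipschitzOnWith.of_dist_le_mul fun x hx y hy ↦ ?_⟩
    simp_rw [hα']
    rw [dif_pos hx, dif_pos hy, ODE.FunSpace.compProj_apply, ODE.FunSpace.compProj_apply,
      ← ODE.FunSpace.toContinuousMap_apply_eq_apply, ← ODE.FunSpace.toContinuousMap_apply_eq_apply]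
    have : Nonempty (Icc tmin tmax) := ⟨t₀⟩
    apply ContinuousMap.dist_le_iff_of_nonempty.mp
    exact h x y hx hy (α x hx) (α y hy) (hα x hx) (hα y hy)

theorem gronwall_scale (K c x : ℝ) : gronwallBound 0 K c x = c * gronwallBound 0 K 1 x := by
  unfold gronwallBound
  split_ifs <;> ring

theorem sym_gronwall_pos {E : Type*} [NormedAddCommGroup E] [NormedSpace ℝ E]
    {e e' : ℝ → E} {δ K c : ℝ} (h0 : e 0 = 0)
    (hd : ∀ t ∈ Ioo (-δ) δ, HasDerivAt e (e' t) t)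
    (hb : ∀ t ∈ Ioo (-δ) δ, ‖e' t‖ ≤ K * ‖e t‖ + c) (t : ℝ) (ht : t ∈ Ioo (-δ) δ) (ht0 : 0 ≤ t) :
    ‖e t‖ ≤ gronwallBound 0 K c t := by
  have hsub : ∀ s ∈ Icc 0 t, s ∈ Ioo (-δ) δ := fun s hs =>
    ⟨by linarith [hs.1, ht.1, ht.2], by linarith [hs.2, ht.2]⟩
  have := norm_le_gronwallBound_of_norm_deriv_right_le (f := e) (f' := e') (δ := 0) (K := K)
    (ε := c) (a := 0) (b := t)
    (fun s hs => (hd s (hsub s hs)).continuousAt.continuousWithinAt)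
    (fun s hs => (hd s (hsub s ⟨hs.1, hs.2.le⟩)).hasDerivWithinAt) (by simp [h0])
    (fun s hs => hb s (hsub s ⟨hs.1, hs.2.le⟩)) t ⟨ht0, le_rfl⟩
  simpa using this

theorem sym_gronwall {E : Type*} [NormedAddCommGroup E] [NormedSpace ℝ E]
    {e e' : ℝ → E} {δ K c : ℝ} (h0 : e 0 = 0)
    (hd : ∀ t ∈ Ioo (-δ) δ, HasDerivAt e (e' t) t)
    (hb : ∀ t ∈ Ioo (-δ) δ, ‖e' t‖ ≤ K * ‖e t‖ + c) (t : ℝ) (ht : t ∈ Ioo (-δ) δ) :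
    ‖e t‖ ≤ c * gronwallBound 0 K 1 |t| := by
  rw [← gronwall_scale]
  rcases le_total 0 t with h | h
  · rw [abs_of_nonneg h]
    exact sym_gronwall_pos h0 hd hb t ht h
  · rw [abs_of_nonpos h]
    have hneg : ∀ s ∈ Ioo (-δ) δ, -s ∈ Ioo (-δ) δ := fun s hs =>
      ⟨by linarith [hs.2], by linarith [hs.1]⟩
    have := sym_gronwall_pos (e := fun s => e (-s)) (e' := fun s => - e' (-s)) (δ := δ) (K := K)
      (c := c) (by simp [h0])
      (fun s hs => by
        have h1 := (hd (-s) (hneg s hs)).scomp s (hasDerivAt_neg s)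
        simpa [Function.comp_def] using h1)
      (fun s hs => by simpa using hb (-s) (hneg s hs)) (-t) (hneg t ht) (by linarith)
    simpa using this

theorem ioo_ind {a b : ℝ} (P : ℝ → Prop) {t₀ : ℝ} (ht₀ : t₀ ∈ Ioo a b) (h0 : P t₀)
    (step : ∀ t ∈ Ioo a b, ∃ δ > 0, ∀ t₁ ∈ Ioo a b, ∀ t₂ ∈ Ioo a b,
      |t₁ - t| < δ → |t₂ - t| < δ → P t₁ → P t₂) : ∀ t ∈ Ioo a b, P t := by
  have key : Ioo a b ⊆ {t | t ∈ Ioo a b ∧ P t} := by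
    apply isPreconnected_Ioo.subset_of_closure_inter_subset
    · rw [Metric.isOpen_iff]
      rintro t ⟨ht, hP⟩
      obtain ⟨δ, hδ, hs⟩ := step t ht
      obtain ⟨ρ, hρ, hρs⟩ := Metric.isOpen_iff.1 isOpen_Ioo t ht
      refine ⟨min δ ρ, lt_min hδ hρ, fun s hsb => ?_⟩
      have hs1 : s ∈ Ioo a b := hρs (ball_subset_ball (min_le_right _ _) hsb)
      refine ⟨hs1, hs t ht s hs1 (by simpa using hδ) ?_ hP⟩
      have := ball_subset_ball (min_le_left _ _) hsb
      rwa [mem_ball, Real.dist_eq] at this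
    · exact ⟨t₀, ht₀, ht₀, h0⟩
    · rintro t ⟨hc, ht⟩
      obtain ⟨δ, hδ, hs⟩ := step t ht
      obtain ⟨s, hs1, hs2⟩ := Metric.mem_closure_iff.1 hc δ hδ
      rw [dist_comm, Real.dist_eq] at hs2
      exact ⟨ht, hs s hs1.1 t ht hs2 (by simpa using hδ) hs1.2⟩
  exact fun t ht => (key ht).2

theorem ode_unique {E : Type*} [NormedAddCommGroup E] [NormedSpace ℝ E]
    {f : E → E} {γ₁ γ₂ : ℝ → E} {a b t₀ : ℝ} (ht₀ : t₀ ∈ Ioo a b) (h0 : γ₁ t₀ = γ₂ t₀)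
    (hf : ∀ t ∈ Ioo a b, ContDiffAt ℝ 1 f (γ₁ t))
    (h1 : ∀ t ∈ Ioo a b, HasDerivAt γ₁ (f (γ₁ t)) t)
    (h2 : ∀ t ∈ Ioo a b, HasDerivAt γ₂ (f (γ₂ t)) t) : ∀ t ∈ Ioo a b, γ₁ t = γ₂ t := by
  apply ioo_ind (fun t => γ₁ t = γ₂ t) ht₀ h0
  intro t ht
  have c1 := (h1 t ht).continuousAt
  have c2 := (h2 t ht).continuousAt
  have hI : Ioo a b ∈ 𝓝 t := isOpen_Ioo.mem_nhds ht
  by_cases he : γ₁ t = γ₂ t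
  · obtain ⟨K, s, hs, hl⟩ := (hf t ht).exists_lipschitzOnWith
    have := ODE_solution_unique_of_eventually (v := fun _ => f) (s := fun _ => s) (K := K)
      (f := γ₁) (g := γ₂) (t₀ := t) (Eventually.of_forall fun _ => hl)
      (by filter_upwards [hI, c1 hs] with u hu hu' using ⟨h1 u hu, hu'⟩)
      (by
        rw [he] at hs
        filter_upwards [hI, c2 hs] with u hu hu' using ⟨h2 u hu, hu'⟩) he
    obtain ⟨δ, hδ, h⟩ := Metric.eventually_nhds_iff.1 this
    exact ⟨δ, hδ, fun t₁ _ t₂ _ _ h2 _ => h (by rwa [Real.dist_eq])⟩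
  · have := (c1.prodMk c2).eventually ((isOpen_ne_fun continuous_fst continuous_snd).mem_nhds
      (x := (γ₁ t, γ₂ t)) he)
    obtain ⟨δ, hδ, h⟩ := Metric.eventually_nhds_iff.1 this
    exact ⟨δ, hδ, fun t₁ _ t₂ _ h1 _ h3 => absurd h3 (h (by rwa [Real.dist_eq]))⟩

theorem local_flow {E : Type*} [NormedAddCommGroup E] [NormedSpace ℝ E] [CompleteSpace E]
    {f : E → E} {O : Set E} (hO : IsOpen O) (hf : ContDiffOn ℝ (⊤ : ℕ∞) f O) {x₀ : E}
    (hx₀ : x₀ ∈ O) :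
    ∃ δ > 0, ∃ N : Set E, IsOpen N ∧ x₀ ∈ N ∧ N ⊆ O ∧ ∃ F : ℝ → E → E,
      ∀ q ∈ N, F 0 q = q ∧ ∀ t ∈ Ioo (-δ) δ, F t q ∈ O ∧
        HasDerivAt (fun s => F s q) (f (F t q)) t ∧
        ∃ A : E →L[ℝ] E, Function.Injective A ∧ HasFDerivAt (F t) A q := by
  have hfx : ContDiffAt ℝ (⊤ : ℕ∞) f x₀ := hf.contDiffAt (hO.mem_nhds hx₀)
  have hdf : ContDiffAt ℝ 1 (fderiv ℝ f) x₀ := hfx.fderiv_right (m := 1) (by norm_cast)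
  let g : E × (E →L[ℝ] E) → E × (E →L[ℝ] E) := fun z => (f z.1, (fderiv ℝ f z.1).comp z.2)
  have hg : ContDiffAt ℝ 1 g (x₀, ContinuousLinearMap.id ℝ E) := by
    apply ContDiffAt.prodMk
    · exact ContDiffAt.comp _ (hfx.of_le (by norm_cast)) contDiffAt_fst
    · exact ContDiffAt.clm_comp (ContDiffAt.comp _ hdf contDiffAt_fst) contDiffAt_snd
  obtain ⟨M, s, hs, hM⟩ := hdf.exists_lipschitzOnWith
  have hbd : ∀ᶠ x in 𝓝 x₀, ‖fderiv ℝ f x‖ < ‖fderiv ℝ f x₀‖ + 1 :=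
    hdf.continuousAt.norm.eventually (gt_mem_nhds (by linarith))
  obtain ⟨ρ, hρ, hρs⟩ := Metric.eventually_nhds_iff_ball.1
    (hbd.and (Filter.Eventually.and hs (hO.mem_nhds hx₀)))
  obtain ⟨ε, hε, a, r, L, K, hr, hpl⟩ := IsPicardLindelof.of_contDiffAt_one hg
  have hpl0 := hpl 0
  have har : r ≤ a := by
    have := hpl0.mul_max_le
    have h2 : (0:ℝ) ≤ L * max (0 + ε - 0) (0 - (0 - ε)) := by
      have : 0 ≤ max (0 + ε - 0) (0 - (0 - ε)) := le_max_of_le_left (by linarith)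
      positivity
    have h3 : (r : ℝ) ≤ a := by
      change (L:ℝ) * max (0 + ε - 0) (0 - (0 - ε)) ≤ a - r at this
      linarith
    exact_mod_cast h3
  have ha : 0 < a := lt_of_lt_of_le hr har
  obtain ⟨a', ha'0, ha'a, ha'ρ, ha'1⟩ : ∃ a' : ℝ≥0, 0 < a' ∧ a' ≤ a ∧ (a' : ℝ) < ρ ∧ (a' : ℝ) < 1 := by
    refine ⟨min a (min (ρ.toNNReal / 2) (1/2)), ?_, min_le_left _ _, ?_, ?_⟩
    · have : 0 < ρ.toNNReal := by simpa using hρ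
      positivity
    · have h1 : min a (min (ρ.toNNReal / 2) (1/2)) ≤ ρ.toNNReal / 2 :=
        (min_le_right _ _).trans (min_le_left _ _)
      have h2 : ((min a (min (ρ.toNNReal / 2) (1/2)) : ℝ≥0) : ℝ) ≤ ((ρ.toNNReal / 2 : ℝ≥0) : ℝ) := by
        exact_mod_cast h1
      refine lt_of_le_of_lt h2 ?_
      rw [NNReal.coe_div, Real.coe_toNNReal _ hρ.le]
      simp; linarith
    · have h1 : min a (min (ρ.toNNReal / 2) (1/2)) ≤ 1 / 2 :=
        (min_le_right _ _).trans (min_le_right _ _)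
      have h2 : ((min a (min (ρ.toNNReal / 2) (1/2)) : ℝ≥0) : ℝ) ≤ ((1 / 2 : ℝ≥0) : ℝ) := by
        exact_mod_cast h1
      refine lt_of_le_of_lt h2 ?_
      norm_num
  obtain ⟨δ, hδ, hpl'⟩ := IsPicardLindelof.exists_shrink_radius hε hpl0 ha'a
    (r' := a' / 2) (by exact NNReal.half_lt_self ha'0.ne')
  obtain ⟨α, hα, L', hL'⟩ := pl_flow hpl'
  have hIcc : ∀ t ∈ Ioo (-δ) δ, t ∈ Icc (0 - δ) (0 + δ) := fun t ht =>
    ⟨by linarith [ht.1], by linarith [ht.2]⟩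
  have hin : ∀ q ∈ ball x₀ (a'/2 : ℝ), (q, ContinuousLinearMap.id ℝ E) ∈
      closedBall (x₀, ContinuousLinearMap.id ℝ E) ((a'/2 : ℝ≥0) : ℝ) := by
    intro q hq
    rw [← closedBall_prod_same]
    have h2 : ((a'/2 : ℝ≥0) : ℝ) = (a' : ℝ) / 2 := by simp
    rw [h2]
    exact ⟨(mem_ball.1 hq).le, mem_closedBall_self (by positivity)⟩
  have hmem : ∀ q ∈ ball x₀ (a'/2 : ℝ), ∀ t ∈ Ioo (-δ) δ,
      (α (q, ContinuousLinearMap.id ℝ E) t).1 ∈ ball x₀ ρ ∧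
      ‖(α (q, ContinuousLinearMap.id ℝ E) t).2 - ContinuousLinearMap.id ℝ E‖ < 1 := by
    intro q hq t ht
    have := ((hα _ (hin q hq)).2 t (hIcc t ht)).1
    rw [← closedBall_prod_same] at this
    refine ⟨lt_of_le_of_lt this.1 ha'ρ, lt_of_le_of_lt ?_ ha'1⟩
    rw [← dist_eq_norm]
    exact this.2
  have hder : ∀ q ∈ ball x₀ (a'/2 : ℝ), ∀ t ∈ Ioo (-δ) δ,
      HasDerivAt (α (q, ContinuousLinearMap.id ℝ E)) (g (α (q, ContinuousLinearMap.id ℝ E) t)) t := by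
    intro q hq t ht
    exact ((hα _ (hin q hq)).2 t (hIcc t ht)).2.hasDerivAt
      (Icc_mem_nhds (by linarith [ht.1]) (by linarith [ht.2]))
  have hder1 : ∀ q ∈ ball x₀ (a'/2 : ℝ), ∀ t ∈ Ioo (-δ) δ,
      HasDerivAt (fun s => (α (q, ContinuousLinearMap.id ℝ E) s).1)
        (f (α (q, ContinuousLinearMap.id ℝ E) t).1) t := by
    intro q hq t ht
    exact (hder q hq t ht).fst
  have hder2 : ∀ q ∈ ball x₀ (a'/2 : ℝ), ∀ t ∈ Ioo (-δ) δ,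
      HasDerivAt (fun s => (α (q, ContinuousLinearMap.id ℝ E) s).2)
        ((fderiv ℝ f (α (q, ContinuousLinearMap.id ℝ E) t).1).comp
          (α (q, ContinuousLinearMap.id ℝ E) t).2) t := by
    intro q hq t ht
    exact (hder q hq t ht).snd
  refine ⟨δ, hδ, ball x₀ (a'/2 : ℝ), isOpen_ball, mem_ball_self (by positivity), ?_,
    fun t q => (α (q, ContinuousLinearMap.id ℝ E) t).1, ?_⟩
  · intro q hq
    refine (hρs q (ball_subset_ball ?_ hq)).2.2
    have : (0:ℝ) < a' := by exact_mod_cast ha'0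
    linarith
  intro q hq
  refine ⟨?_, fun t ht => ⟨(hρs _ (hmem q hq t ht).1).2.2, hder1 q hq t ht,
    (α (q, ContinuousLinearMap.id ℝ E) t).2, ?_, ?_⟩⟩
  · have := (hα _ (hin q hq)).1
    simp only at this ⊢
    rw [this]
  · intro u v huv
    by_contra hne
    have hne' : 0 < ‖u - v‖ := norm_pos_iff.2 (sub_ne_zero.2 hne)
    have h1 := ((α (q, ContinuousLinearMap.id ℝ E) t).2 - ContinuousLinearMap.id ℝ E).le_opNorm (u - v)
    have h2 : ((α (q, ContinuousLinearMap.id ℝ E) t).2 - ContinuousLinearMap.id ℝ E) (u - v)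
        = -(u - v) := by
      simp [huv]
    rw [h2, norm_neg] at h1
    nlinarith [(hmem q hq t ht).2]
  · -- the derivative
    set C : ℝ := M * L' ^ 2 with hC
    have key : ∀ q' ∈ ball x₀ (a'/2 : ℝ),
        ‖(α (q', ContinuousLinearMap.id ℝ E) t).1 - (α (q, ContinuousLinearMap.id ℝ E) t).1
          - (α (q, ContinuousLinearMap.id ℝ E) t).2 (q' - q)‖ ≤
        (C * ‖q' - q‖ ^ 2) * gronwallBound 0 (‖fderiv ℝ f x₀‖ + 1) 1 |t| := by
      intro q' hq'
      refine sym_gronwall (e := fun s => (α (q', ContinuousLinearMap.id ℝ E) s).1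
          - (α (q, ContinuousLinearMap.id ℝ E) s).1
          - (α (q, ContinuousLinearMap.id ℝ E) s).2 (q' - q)) ?_
        (fun s hs => ((hder1 q' hq' s hs).sub (hder1 q hq s hs)).sub
          ((hder2 q hq s hs).clm_apply (hasDerivAt_const s (q' - q)))) ?_ t ht
      · have h1 := (hα _ (hin q hq)).1
        have h2 := (hα _ (hin q' hq')).1
        simp only at h1 h2
        simp only [h1, h2]
        simp
      · intro s hs
        set X' := (α (q', ContinuousLinearMap.id ℝ E) s).1 with hX'
        set X := (α (q, ContinuousLinearMap.id ℝ E) s).1 with hX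
        set Λ := (α (q, ContinuousLinearMap.id ℝ E) s).2 with hΛ
        have mX' := (hmem q' hq' s hs).1
        have mX := (hmem q hq s hs).1
        rw [← hX'] at mX'
        rw [← hX] at mX
        have hlip : ‖X' - X‖ ≤ L' * ‖q' - q‖ := by
          have := (hL' s (hIcc s hs)).dist_le_mul _ (hin q' hq') _ (hin q hq)
          have h3 : dist X' X ≤ dist (α (q', ContinuousLinearMap.id ℝ E) s)
            (α (q, ContinuousLinearMap.id ℝ E) s) := le_max_left _ _
          have h4 : dist (q', ContinuousLinearMap.id ℝ E) (q, ContinuousLinearMap.id ℝ E)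
              = dist q' q := by simp [Prod.dist_eq]
          rw [h4] at this
          rw [← dist_eq_norm, ← dist_eq_norm]
          exact h3.trans this
        have hrem : ‖f X' - f X - fderiv ℝ f X (X' - X)‖ ≤ (M * ‖X' - X‖) * ‖X' - X‖ := by
          have hseg : segment ℝ X X' ⊆ ball x₀ ρ := (convex_ball x₀ ρ).segment_subset mX mX'
          refine (convex_segment X X').norm_image_sub_le_of_norm_hasFDerivWithin_le'
            (f' := fderiv ℝ f) (fun z hz => ?_) (fun z hz => ?_) (left_mem_segment ℝ X X')
            (right_mem_segment ℝ X X')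
          · have hzO := (hρs z (hseg hz)).2.2
            have : ContDiffAt ℝ (⊤ : ℕ∞) f z := hf.contDiffAt (hO.mem_nhds hzO)
            exact (this.differentiableAt (by simp)).hasFDerivAt.hasFDerivWithinAt
          · have h1 := hM.dist_le_mul z (hρs z (hseg hz)).2.1 X (hρs X mX).2.1
            rw [dist_eq_norm, dist_eq_norm] at h1
            refine h1.trans ?_
            gcongr
            have := norm_sub_le_of_mem_segment hz
            exact this
        have hid : f X' - f X - ((fderiv ℝ f X).comp Λ (q' - q) + Λ 0)
            = (f X' - f X - fderiv ℝ f X (X' - X)) + fderiv ℝ f X (X' - X - Λ (q' - q)) := by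
          simp
        rw [hid]
        have hfin : ‖fderiv ℝ f X (X' - X - Λ (q' - q))‖ ≤
            (‖fderiv ℝ f x₀‖ + 1) * ‖X' - X - Λ (q' - q)‖ := by
          refine ((fderiv ℝ f X).le_opNorm _).trans ?_
          gcongr
          exact (hρs X mX).1.le
        have h5 : (M * ‖X' - X‖) * ‖X' - X‖ ≤ C * ‖q' - q‖ ^ 2 := by
          calc (M * ‖X' - X‖) * ‖X' - X‖ ≤ (M * (L' * ‖q' - q‖)) * (L' * ‖q' - q‖) := by gcongr
            _ = C * ‖q' - q‖ ^ 2 := by rw [hC]; ring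
        refine (norm_add_le _ _).trans ?_
        linarith
    rw [hasFDerivAt_iff_isLittleO]
    set B := gronwallBound 0 (‖fderiv ℝ f x₀‖ + 1) 1 |t|
    have hbig : (fun q' => (α (q', ContinuousLinearMap.id ℝ E) t).1
        - (α (q, ContinuousLinearMap.id ℝ E) t).1
          - (α (q, ContinuousLinearMap.id ℝ E) t).2 (q' - q)) =O[𝓝 q]
          fun q' => ‖q' - q‖ ^ 2 := by
      refine Asymptotics.IsBigO.of_bound (C * B) ?_
      filter_upwards [isOpen_ball.mem_nhds hq] with q' hq'
      refine (key q' hq').trans (le_of_eq ?_)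
      rw [Real.norm_of_nonneg (by positivity)]
      ring
    refine hbig.trans_isLittleO ?_
    have : (fun q' => ‖q' - q‖ ^ 2) =o[𝓝 q] fun q' => ‖q' - q‖ ^ 1 := by
      have h6 : Tendsto (fun q' : E => ‖q' - q‖) (𝓝 q) (𝓝 0) := by
        have : ContinuousAt (fun q' : E => ‖q' - q‖) q := by fun_prop
        simpa [ContinuousAt] using this
      exact (Asymptotics.isLittleO_pow_pow (𝕜 := ℝ) (m := 1) (n := 2) (by norm_num)).comp_tendsto h6
    simpa using this

theorem flow_diff {E : Type*} [NormedAddCommGroup E] [NormedSpace ℝ E] [CompleteSpace E]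
    {f : E → E} {O : Set E} (hO : IsOpen O) (hf : ContDiffOn ℝ (⊤ : ℕ∞) f O)
    {W : Set E} (hW : IsOpen W) {ε : ℝ} (hε : 0 < ε) {σ : ℝ → E → E}
    (h0 : ∀ p ∈ W, σ 0 p = p)
    (hσ : ∀ p ∈ W, ∀ t ∈ Ioo (-ε) ε, σ t p ∈ O ∧ HasDerivAt (fun s => σ s p) (f (σ t p)) t)
    {p : E} (hp : p ∈ W) :
    ∀ t ∈ Ioo (-ε) ε, ∃ A : E →L[ℝ] E, Function.Injective A ∧ HasFDerivAt (σ t) A p := by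
  have hfO : ∀ x ∈ O, ContDiffAt ℝ 1 f x := fun x hx =>
    (hf.contDiffAt (hO.mem_nhds hx)).of_le (by norm_cast)
  have hz : (0:ℝ) ∈ Ioo (-ε) ε := ⟨by linarith, hε⟩
  apply ioo_ind (fun t => ∃ A : E →L[ℝ] E, Function.Injective A ∧ HasFDerivAt (σ t) A p) hz
  · refine ⟨ContinuousLinearMap.id ℝ E, fun _ _ h => h, ?_⟩
    refine (hasFDerivAt_id p).congr_of_eventuallyEq ?_
    filter_upwards [hW.mem_nhds hp] with q hq using h0 q hq
  · intro t ht
    obtain ⟨δ, hδ, N, hN, hxN, hNO, F, hF⟩ := local_flow hO hf (hσ p hp t ht).1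
    have hc : ContinuousAt (fun s => σ s p) t := (hσ p hp t ht).2.continuousAt
    obtain ⟨δ', hδ', hb⟩ := Metric.eventually_nhds_iff.1 (hc.eventually (hN.mem_nhds hxN))
    refine ⟨min δ' (δ/2), lt_min hδ' (by linarith), ?_⟩
    rintro t₁ ht₁ t₂ ht₂ hd1 hd2 ⟨A, hA, hAd⟩
    have hp1 : σ t₁ p ∈ N := hb (by rw [Real.dist_eq]; exact lt_of_lt_of_le hd1 (min_le_left _ _))
    have e1 : |t₁ - t| < δ/2 := lt_of_lt_of_le hd1 (min_le_right _ _)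
    have e2 : |t₂ - t| < δ/2 := lt_of_lt_of_le hd2 (min_le_right _ _)
    rw [abs_lt] at e1 e2
    have hs : t₂ - t₁ ∈ Ioo (-δ) δ := ⟨by linarith, by linarith⟩
    obtain ⟨B, hB, hBd⟩ := ((hF _ hp1).2 _ hs).2.2
    refine ⟨B.comp A, hB.comp hA, ?_⟩
    refine (hBd.comp p hAd).congr_of_eventuallyEq ?_
    filter_upwards [hW.mem_nhds hp, hAd.continuousAt.eventually (hN.mem_nhds hp1)] with q hqW hqN
    have hu := ode_unique (f := f) (γ₁ := fun s => σ (s + t₁) q) (γ₂ := fun s => F s (σ t₁ q))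
      (a := max (-δ) (-ε - t₁)) (b := min δ (ε - t₁)) (t₀ := 0)
      ⟨max_lt (by linarith) (by linarith [ht₁.1]), lt_min hδ (by linarith [ht₁.2])⟩
      (by simp [(hF _ hqN).1])
      (fun s hs => hfO _ (hσ q hqW _ ⟨by linarith [(max_lt_iff.1 hs.1).2],
        by linarith [(lt_min_iff.1 hs.2).2]⟩).1)
      (fun s hs => (hσ q hqW (s + t₁) ⟨by linarith [(max_lt_iff.1 hs.1).2],
        by linarith [(lt_min_iff.1 hs.2).2]⟩).2.comp_add_const s t₁)
      (fun s hs => ((hF _ hqN).2 s ⟨(max_lt_iff.1 hs.1).1, (lt_min_iff.1 hs.2).1⟩).2.1)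
      (t₂ - t₁) ⟨max_lt hs.1 (by linarith [ht₂.1]), lt_min hs.2 (by linarith [ht₂.2])⟩
    simpa using hu


theorem derivSnd {f : ℝ → ℝ × ℝ × ℝ} {f' : ℝ × ℝ × ℝ} {t : ℝ} (h : HasDerivAt f f' t) :
    HasDerivAt (fun s => (f s).2) f'.2 t :=
  ((ContinuousLinearMap.snd ℝ ℝ (ℝ × ℝ)).hasFDerivAt (x := f t)).comp_hasDerivAt t h

/-- The `(x,y)`-part of the embedding. -/
def xyMap (φ : (ℝ × ℝ × ℝ) → ℝ) (p : ℝ × ℝ × ℝ) : ℝ × ℝ := (p.1, p.2.1 + φ p)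

/-- The derivative of `xyMap`. -/
noncomputable def xyDer (φ : (ℝ × ℝ × ℝ) → ℝ) (p : ℝ × ℝ × ℝ) : (ℝ × ℝ × ℝ) →L[ℝ] ℝ × ℝ :=
  (ContinuousLinearMap.fst ℝ ℝ (ℝ × ℝ)).prod
    ((ContinuousLinearMap.fst ℝ ℝ ℝ).comp (ContinuousLinearMap.snd ℝ ℝ (ℝ × ℝ)) + fderiv ℝ φ p)

theorem xyDer_apply (φ : (ℝ × ℝ × ℝ) → ℝ) (p w : ℝ × ℝ × ℝ) :
    xyDer φ p w = (w.1, w.2.1 + fderiv ℝ φ p w) := rfl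

theorem hasFDerivAt_xyMap {φ : (ℝ × ℝ × ℝ) → ℝ} {p : ℝ × ℝ × ℝ} (h : DifferentiableAt ℝ φ p) :
    HasFDerivAt (xyMap φ) (xyDer φ p) p := by
  have h1 : HasFDerivAt (fun p : ℝ × ℝ × ℝ => p.2.1)
    ((ContinuousLinearMap.fst ℝ ℝ ℝ).comp (ContinuousLinearMap.snd ℝ ℝ (ℝ × ℝ))) p :=
    ((ContinuousLinearMap.fst ℝ ℝ ℝ).comp (ContinuousLinearMap.snd ℝ ℝ (ℝ × ℝ))).hasFDerivAt
  exact hasFDerivAt_fst.prodMk (h1.add h.hasFDerivAt)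

theorem fderiv_iota {φ : (ℝ × ℝ × ℝ) → ℝ} {p : ℝ × ℝ × ℝ} (h : DifferentiableAt ℝ φ p)
    (w : ℝ × ℝ × ℝ) :
    fderiv ℝ (iotaEmb φ) p w = (w.1, w.2.1 + fderiv ℝ φ p w, w.2.1, w.2.2) := by
  have h1 : HasFDerivAt (fun p : ℝ × ℝ × ℝ => p.2.1)
    ((ContinuousLinearMap.fst ℝ ℝ ℝ).comp (ContinuousLinearMap.snd ℝ ℝ (ℝ × ℝ))) p :=
    ((ContinuousLinearMap.fst ℝ ℝ ℝ).comp (ContinuousLinearMap.snd ℝ ℝ (ℝ × ℝ))).hasFDerivAt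
  have h2 : HasFDerivAt (fun p : ℝ × ℝ × ℝ => p.2.2)
    ((ContinuousLinearMap.snd ℝ ℝ ℝ).comp (ContinuousLinearMap.snd ℝ ℝ (ℝ × ℝ))) p :=
    ((ContinuousLinearMap.snd ℝ ℝ ℝ).comp (ContinuousLinearMap.snd ℝ ℝ (ℝ × ℝ))).hasFDerivAt
  have : HasFDerivAt (iotaEmb φ) _ p :=
    hasFDerivAt_fst.prodMk ((h1.add h.hasFDerivAt).prodMk (h1.prodMk h2))
  rw [this.fderiv]
  rfl

theorem lin3 (l : (ℝ × ℝ × ℝ) →L[ℝ] ℝ) (w : ℝ × ℝ × ℝ) :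
    l w = w.1 * l (1, 0, 0) + w.2.1 * l (0, 1, 0) + w.2.2 * l (0, 0, 1) := by
  have : w = w.1 • ((1, 0, 0) : ℝ × ℝ × ℝ) + w.2.1 • ((0, 1, 0) : ℝ × ℝ × ℝ)
      + w.2.2 • ((0, 0, 1) : ℝ × ℝ × ℝ) := by
    ext <;> simp
  conv_lhs => rw [this]
  simp only [map_add, map_smul, smul_eq_mul]

theorem eq_psi {φ : (ℝ × ℝ × ℝ) → ℝ} {p : ℝ × ℝ × ℝ}
    (hnd : 1 + fderiv ℝ φ p (0, 1, 0) ≠ 0) {w : ℝ × ℝ × ℝ} (h : xyDer φ p w = 0) :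
    w = w.2.2 • ((0 : ℝ), psiOf φ p, (1 : ℝ)) := by
  rw [xyDer_apply, Prod.mk_eq_zero] at h
  obtain ⟨h1, h2⟩ := h
  rw [lin3, h1] at h2
  have h3 : w.2.1 = w.2.2 * psiOf φ p := by
    unfold psiOf
    field_simp
    linarith
  ext
  · simp [h1]
  · simp [h3]
  · simp

theorem xyDer_psi {φ : (ℝ × ℝ × ℝ) → ℝ} {p : ℝ × ℝ × ℝ}
    (hnd : 1 + fderiv ℝ φ p (0, 1, 0) ≠ 0) (c : ℝ) :
    xyDer φ p (c • ((0 : ℝ), psiOf φ p, (1 : ℝ))) = 0 := by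
  rw [map_smul, xyDer_apply, lin3]
  have : psiOf φ p + (0 * fderiv ℝ φ p (1, 0, 0) + psiOf φ p * fderiv ℝ φ p (0, 1, 0)
      + 1 * fderiv ℝ φ p (0, 0, 1)) = 0 := by
    unfold psiOf
    field_simp
    ring
  simp only [this]
  simp

theorem chart {U : Set (ℝ × ℝ × ℝ)} (hU : IsOpen U)
    {φ : (ℝ × ℝ × ℝ) → ℝ} (hφ : ContDiffOn ℝ (⊤ : ℕ∞) φ U)
    (hnd : ∀ p ∈ U, 1 + fderiv ℝ φ p (0, 1, 0) ≠ 0) {p : ℝ × ℝ × ℝ} (hp : p ∈ U)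
    {N : Set (ℝ × ℝ × ℝ)} (hN : IsOpen N) (hpN : p ∈ N) (hNU : N ⊆ U) :
    ∃ Ψ : OpenPartialHomeomorph (ℝ × ℝ × ℝ) (ℝ × ℝ × ℝ), p ∈ Ψ.source ∧ Ψ.source ⊆ N ∧
      (∀ q, Ψ q = (q.1, q.2.1 + φ q, q.2.2)) ∧ ContDiffOn ℝ (⊤ : ℕ∞) Ψ.symm Ψ.target ∧
      ∀ z ∈ Ψ.target, HasDerivAt (fun s => Ψ.symm (z.1, z.2.1, s))
        (0, psiOf φ (Ψ.symm z), 1) z.2.2 := by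
  let Φ : (ℝ × ℝ × ℝ) → (ℝ × ℝ × ℝ) := fun q => (q.1, q.2.1 + φ q, q.2.2)
  have hφd : ∀ q ∈ U, ContDiffAt ℝ (⊤ : ℕ∞) φ q := fun q hq => hφ.contDiffAt (hU.mem_nhds hq)
  have hΦ : ∀ q ∈ U, ContDiffAt ℝ (⊤ : ℕ∞) Φ q := fun q hq => by
    have := hφd q hq
    exact contDiffAt_fst.prodMk ((ContDiffAt.add (by fun_prop) this).prodMk (by fun_prop))
  have hder : ∀ q ∈ U, ∀ w, fderiv ℝ Φ q w = (w.1, w.2.1 + fderiv ℝ φ q w, w.2.2) := by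
    intro q hq w
    have hd : DifferentiableAt ℝ φ q := (hφd q hq).differentiableAt (by simp)
    have h1 : HasFDerivAt (fun p : ℝ × ℝ × ℝ => p.2.1)
      ((ContinuousLinearMap.fst ℝ ℝ ℝ).comp (ContinuousLinearMap.snd ℝ ℝ (ℝ × ℝ))) q :=
      ((ContinuousLinearMap.fst ℝ ℝ ℝ).comp (ContinuousLinearMap.snd ℝ ℝ (ℝ × ℝ))).hasFDerivAt
    have h2 : HasFDerivAt (fun p : ℝ × ℝ × ℝ => p.2.2)
      ((ContinuousLinearMap.snd ℝ ℝ ℝ).comp (ContinuousLinearMap.snd ℝ ℝ (ℝ × ℝ))) q :=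
      ((ContinuousLinearMap.snd ℝ ℝ ℝ).comp (ContinuousLinearMap.snd ℝ ℝ (ℝ × ℝ))).hasFDerivAt
    have : HasFDerivAt Φ _ q :=
      hasFDerivAt_fst.prodMk ((h1.add hd.hasFDerivAt).prodMk h2)
    rw [this.fderiv]
    rfl
  have hequiv : ∀ q ∈ U, ∃ e : (ℝ × ℝ × ℝ) ≃L[ℝ] (ℝ × ℝ × ℝ),
      HasFDerivAt Φ (e : (ℝ × ℝ × ℝ) →L[ℝ] (ℝ × ℝ × ℝ)) q := by
    intro q hq
    have hinj : Function.Injective (fderiv ℝ Φ q).toLinearMap := by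
      rw [← LinearMap.ker_eq_bot, LinearMap.ker_eq_bot']
      intro w hw
      change fderiv ℝ Φ q w = 0 at hw
      rw [hder q hq w, Prod.mk_eq_zero, Prod.mk_eq_zero] at hw
      obtain ⟨h1, h2, h3⟩ := hw
      have := eq_psi (hnd q hq) (w := w) (by rw [xyDer_apply, h1, h2]; rfl)
      rw [this, h3, zero_smul]
    refine ⟨(LinearEquiv.ofInjectiveEndo _ hinj).toContinuousLinearEquiv, ?_⟩
    have hd := ((hΦ q hq).differentiableAt (by simp)).hasFDerivAt
    have heq : (((LinearEquiv.ofInjectiveEndo _ hinj).toContinuousLinearEquiv :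
        (ℝ × ℝ × ℝ) ≃L[ℝ] (ℝ × ℝ × ℝ)) : (ℝ × ℝ × ℝ) →L[ℝ] (ℝ × ℝ × ℝ)) = fderiv ℝ Φ q :=
      ContinuousLinearMap.ext fun w => rfl
    rw [heq]
    exact hd
  obtain ⟨e, he⟩ := hequiv p hp
  let Ψ₀ := (hΦ p hp).toOpenPartialHomeomorph Φ he (by simp)
  let Ψ := Ψ₀.restrOpen N hN
  have hco : ∀ q, Ψ q = (q.1, q.2.1 + φ q, q.2.2) := fun q => rfl
  have hsrc : Ψ.source ⊆ N := fun q hq => hq.2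
  have hsymm : ∀ z ∈ Ψ.target, ContDiffAt ℝ (⊤ : ℕ∞) Ψ.symm z := by
    intro z hz
    have hzU : Ψ.symm z ∈ U := hNU (hsrc (Ψ.map_target hz))
    obtain ⟨e', he'⟩ := hequiv _ hzU
    exact Ψ.contDiffAt_symm hz (f₀' := e') he' (hΦ _ hzU)
  refine ⟨Ψ, ⟨(hΦ p hp).mem_toOpenPartialHomeomorph_source he (by simp), hpN⟩, hsrc, hco,
    fun z hz => (hsymm z hz).contDiffWithinAt, ?_⟩
  intro z hz
  have hzU : Ψ.symm z ∈ U := hNU (hsrc (Ψ.map_target hz))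
  have hline : HasDerivAt (fun s : ℝ => (z.1, z.2.1, s)) ((0 : ℝ), (0 : ℝ), (1 : ℝ)) z.2.2 :=
    (hasDerivAt_const _ _).prodMk ((hasDerivAt_const _ _).prodMk (hasDerivAt_id _))
  have hd : HasFDerivAt Ψ.symm (fderiv ℝ Ψ.symm z) ((fun s : ℝ => (z.1, z.2.1, s)) z.2.2) :=
    ((hsymm z hz).differentiableAt (by simp)).hasFDerivAt
  have h1 := hd.comp_hasDerivAt z.2.2 hline
  set w := fderiv ℝ Ψ.symm z (0, 0, 1) with hw
  have hΦd : HasFDerivAt Φ (fderiv ℝ Φ (Ψ.symm z)) (Ψ.symm (z.1, z.2.1, z.2.2)) :=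
    ((hΦ _ hzU).differentiableAt (by simp)).hasFDerivAt
  have h2 := hΦd.comp_hasDerivAt z.2.2 h1
  have h3 : (Φ ∘ (Ψ.symm ∘ fun s : ℝ => (z.1, z.2.1, s))) =ᶠ[𝓝 z.2.2]
      fun s : ℝ => (z.1, z.2.1, s) := by
    have := hline.continuousAt.eventually (Ψ.open_target.mem_nhds hz)
    filter_upwards [this] with s hs
    exact Ψ.right_inv hs
  have h4 := h2.unique (hline.congr_of_eventuallyEq h3)
  rw [hder _ hzU] at h4
  simp only [Prod.mk.injEq] at h4
  have h5 := eq_psi (hnd _ hzU) (w := w) (by rw [xyDer_apply, h4.1, h4.2.1]; rfl)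
  rw [h4.2.2, one_smul] at h5
  rw [← h5]
  exact h1

theorem part_two
    (U : Set (ℝ × ℝ × ℝ)) (hU : IsOpen U)
    (φ : (ℝ × ℝ × ℝ) → ℝ) (hφ : ContDiffOn ℝ (⊤ : ℕ∞) φ U)
    (hnd : ∀ p ∈ U, 1 + fderiv ℝ φ p (0, 1, 0) ≠ 0)
    (Ω : Set (ℝ × ℝ × ℝ × ℝ)) (Vt : (ℝ × ℝ × ℝ × ℝ) → ℝ × ℝ × ℝ × ℝ)
    (hΩ : IsOpen Ω) (hVt : IsParaHolVF Ω Vt)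
    (V : (ℝ × ℝ × ℝ) → (ℝ × ℝ × ℝ))
    (hV : ∀ p ∈ U, iotaEmb φ p ∈ Ω → fderiv ℝ (iotaEmb φ) p (V p) = Vt (iotaEmb φ p))
    (ε : ℝ) (W₀ : Set (ℝ × ℝ × ℝ)) (σ : ℝ → (ℝ × ℝ × ℝ) → (ℝ × ℝ × ℝ))
    (hσ : IsLocalFlowOf {p ∈ U | iotaEmb φ p ∈ Ω} V ε W₀ σ) :
    ∀ t ∈ Set.Ioo (-ε) ε, ParaCRMapOn φ W₀ (σ t) := by
  obtain ⟨hVs, ξ, η, α, β, hform⟩ := hVt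
  obtain ⟨hε, hW₀, hW₀W, hσ0, hσd⟩ := hσ
  set W := {p ∈ U | iotaEmb φ p ∈ Ω} with hWdef
  have hφd : ∀ q ∈ U, ContDiffAt ℝ (⊤ : ℕ∞) φ q := fun q hq => hφ.contDiffAt (hU.mem_nhds hq)
  have hφd' : ∀ q ∈ U, DifferentiableAt ℝ φ q := fun q hq => (hφd q hq).differentiableAt (by simp)
  have hι : ContDiffOn ℝ (⊤ : ℕ∞) (iotaEmb φ) U := by
    unfold iotaEmb
    exact contDiffOn_fst.prodMk ((ContDiffOn.add (by fun_prop) hφ).prodMk (by fun_prop))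
  have hW : IsOpen W := hι.continuousOn.isOpen_inter_preimage hU hΩ
  have hVeq : ∀ p ∈ W, Vt (iotaEmb φ p) =
      ((V p).1, (V p).2.1 + fderiv ℝ φ p (V p), (V p).2.1, (V p).2.2) := fun p hp => by
    rw [← hV p hp.1 hp.2, fderiv_iota (hφd' p hp.1)]
  have hVsm : ContDiffOn ℝ (⊤ : ℕ∞) V W := by
    have h1 : ContDiffOn ℝ (⊤ : ℕ∞) (fun p => Vt (iotaEmb φ p)) W :=
      hVs.comp (hι.mono fun p hp => hp.1) (fun p hp => hp.2)
    have h2 : ContDiffOn ℝ (⊤ : ℕ∞) (fun p => ((Vt (iotaEmb φ p)).1, (Vt (iotaEmb φ p)).2.2)) W :=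
      h1.fst.prodMk h1.snd.snd
    refine h2.congr fun p hp => ?_
    rw [hVeq p hp]
  have hVab : ∀ p ∈ W, (V p).2 = (α p.2, β p.2) := fun p hp => by
    have := hVeq p hp
    rw [hform _ hp.2] at this
    simp only [Prod.mk.injEq] at this
    exact Prod.ext this.2.2.1.symm this.2.2.2.symm
  have hVxy : ∀ p ∈ W, xyDer φ p (V p) = (ξ (xyMap φ p), η (xyMap φ p)) := fun p hp => by
    have := hVeq p hp
    rw [hform _ hp.2] at this
    simp only [Prod.mk.injEq] at this
    rw [xyDer_apply]
    exact Prod.ext this.1.symm this.2.1.symm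
  have hVtd : ∀ q ∈ Ω, ContDiffAt ℝ 1 Vt q := fun q hq =>
    (hVs.contDiffAt (hΩ.mem_nhds hq)).of_le (by norm_cast)
  have hab : ∀ p ∈ W, ContDiffAt ℝ 1 (fun z : ℝ × ℝ => (α z, β z)) p.2 := by
    intro p hp
    have hc : ContDiff ℝ 1 (fun z : ℝ × ℝ => ((iotaEmb φ p).1, (iotaEmb φ p).2.1, z.1, z.2)) := by
      fun_prop
    have h1 : ContDiffAt ℝ 1
        (fun z : ℝ × ℝ => Vt ((iotaEmb φ p).1, (iotaEmb φ p).2.1, z.1, z.2)) p.2 :=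
      ContDiffAt.comp p.2 (hVtd (iotaEmb φ p) hp.2) hc.contDiffAt
    refine h1.snd.snd.congr_of_eventuallyEq ?_
    have := (hc.continuous.continuousAt (x := p.2)).eventually (hΩ.mem_nhds hp.2)
    filter_upwards [this] with z hz
    rw [hform _ hz]
  have hxy : ∀ p ∈ W, ContDiffAt ℝ 1 (fun z : ℝ × ℝ => (ξ z, η z)) (xyMap φ p) := by
    intro p hp
    have hc : ContDiff ℝ 1
        (fun z : ℝ × ℝ => (z.1, z.2, (iotaEmb φ p).2.2.1, (iotaEmb φ p).2.2.2)) := by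
      fun_prop
    have h1 : ContDiffAt ℝ 1
        (fun z : ℝ × ℝ => Vt (z.1, z.2, (iotaEmb φ p).2.2.1, (iotaEmb φ p).2.2.2)) (xyMap φ p) :=
      ContDiffAt.comp (xyMap φ p) (hVtd (iotaEmb φ p) hp.2) hc.contDiffAt
    refine (h1.fst.prodMk h1.snd.fst).congr_of_eventuallyEq ?_
    have := (hc.continuous.continuousAt (x := xyMap φ p)).eventually (hΩ.mem_nhds hp.2)
    filter_upwards [this] with z hz
    rw [hform _ hz]
  have hz : (0:ℝ) ∈ Ioo (-ε) ε := ⟨by linarith, hε⟩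
  have uab : ∀ p ∈ W₀, ∀ q ∈ W₀, q.2 = p.2 → ∀ t ∈ Ioo (-ε) ε, (σ t q).2 = (σ t p).2 := by
    intro p hp q hq hqp
    refine ode_unique (f := fun z : ℝ × ℝ => (α z, β z)) (γ₁ := fun s => (σ s q).2)
      (γ₂ := fun s => (σ s p).2) hz (by simp only [hσ0 p hp, hσ0 q hq, hqp])
      (fun t ht => hab _ (hσd q hq t ht).1) (fun t ht => ?_) (fun t ht => ?_)
    · have := derivSnd (hσd q hq t ht).2
      rwa [hVab _ (hσd q hq t ht).1] at this
    · have := derivSnd (hσd p hp t ht).2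
      rwa [hVab _ (hσd p hp t ht).1] at this
  have hxyd : ∀ p ∈ W₀, ∀ t ∈ Ioo (-ε) ε, HasDerivAt (fun s => xyMap φ (σ s p))
      (ξ (xyMap φ (σ t p)), η (xyMap φ (σ t p))) t := by
    intro p hp t ht
    rw [← hVxy _ (hσd p hp t ht).1]
    exact (hasFDerivAt_xyMap (hφd' _ (hσd p hp t ht).1.1)).comp_hasDerivAt t (hσd p hp t ht).2
  have uxy : ∀ p ∈ W₀, ∀ q ∈ W₀, xyMap φ q = xyMap φ p → ∀ t ∈ Ioo (-ε) ε,
      xyMap φ (σ t q) = xyMap φ (σ t p) := by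
    intro p hp q hq hqp
    exact ode_unique (f := fun z : ℝ × ℝ => (ξ z, η z)) (γ₁ := fun s => xyMap φ (σ s q))
      (γ₂ := fun s => xyMap φ (σ s p)) hz (by simp only [hσ0 p hp, hσ0 q hq, hqp])
      (fun t ht => hxy _ (hσd q hq t ht).1) (hxyd q hq) (hxyd p hp)
  intro t ht p hp
  obtain ⟨A, hA, hAd⟩ := flow_diff hW hVsm hW₀ hε hσ0 hσd hp t ht
  have hpU : p ∈ U := (hW₀W hp).1
  rw [hAd.fderiv]
  constructor
  · have hline : HasDerivAt (fun s : ℝ => (s, p.2)) ((1 : ℝ), (0 : ℝ × ℝ)) p.1 :=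
      (hasDerivAt_id _).prodMk (hasDerivAt_const _ _)
    have h1 : HasDerivAt (fun s : ℝ => (σ t (s, p.2)).2) (A (1, 0)).2 p.1 :=
      derivSnd (HasFDerivAt.comp_hasDerivAt (l := σ t) p.1 hAd hline)
    have h2 : (fun s : ℝ => (σ t (s, p.2)).2) =ᶠ[𝓝 p.1] fun _ => (σ t p).2 := by
      filter_upwards [hline.continuousAt.eventually (hW₀.mem_nhds hp)] with s hs
      exact uab p hp _ hs rfl t ht
    have h3 := h1.unique ((hasDerivAt_const p.1 (σ t p).2).congr_of_eventuallyEq h2)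
    have h4 : A (1, 0, 0) = (A (1, 0, 0)).1 • ((1 : ℝ), (0 : ℝ), (0 : ℝ)) := by
      change (A (1, 0, 0)).2 = 0 at h3
      rw [Prod.ext_iff, h3]
      refine ⟨by simp, by ext <;> simp⟩
    refine ⟨_, fun h0 => ?_, h4⟩
    rw [h0, zero_smul, ← map_zero A] at h4
    simpa using hA h4
  · obtain ⟨Ψ, hpΨ, hΨN, hΨ, hΨs, hΨd⟩ := chart hU hφ hnd hpU hW₀ hp
      (fun q hq => (hW₀W hq).1)
    have hz := Ψ.map_source hpΨ
    have hline := hΨd _ hz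
    rw [Ψ.left_inv hpΨ] at hline
    have hpt : Ψ.symm ((Ψ p).1, (Ψ p).2.1, (Ψ p).2.2) = p := Ψ.left_inv hpΨ
    have h1 : HasDerivAt (fun s : ℝ => σ t (Ψ.symm ((Ψ p).1, (Ψ p).2.1, s)))
        (A (0, psiOf φ p, 1)) (Ψ p).2.2 :=
      HasFDerivAt.comp_hasDerivAt (l := σ t) (Ψ p).2.2 (by rw [hpt]; exact hAd) hline
    have hqU := (hσd p hp t ht).1.1
    have h2 : HasDerivAt (fun s : ℝ => xyMap φ (σ t (Ψ.symm ((Ψ p).1, (Ψ p).2.1, s))))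
        (xyDer φ (σ t p) (A (0, psiOf φ p, 1))) (Ψ p).2.2 :=
      HasFDerivAt.comp_hasDerivAt (l := xyMap φ) (Ψ p).2.2
        (by rw [hpt]; exact hasFDerivAt_xyMap (hφd' _ hqU)) h1
    have h3 : (fun s : ℝ => xyMap φ (σ t (Ψ.symm ((Ψ p).1, (Ψ p).2.1, s)))) =ᶠ[𝓝 (Ψ p).2.2]
        fun _ => xyMap φ (σ t p) := by
      have hc : ContinuousAt (fun s : ℝ => ((Ψ p).1, (Ψ p).2.1, s)) (Ψ p).2.2 := by fun_prop
      filter_upwards [hc.eventually (Ψ.open_target.mem_nhds hz)] with s hs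
      refine uxy p hp _ (hΨN (Ψ.map_target hs)) ?_ t ht
      have h5 := Ψ.right_inv hs
      rw [hΨ, hΨ] at h5
      simp only [Prod.mk.injEq] at h5
      rw [hΨ]
      exact Prod.ext h5.1 h5.2.1
    have h4 := h2.unique ((hasDerivAt_const _ _).congr_of_eventuallyEq h3)
    have h5 := eq_psi (hnd _ hqU) h4
    refine ⟨_, fun h0 => ?_, h5⟩
    rw [h0, zero_smul, ← map_zero A] at h5
    simpa using hA h5

theorem part_one
    (U : Set (ℝ × ℝ × ℝ)) (hU : IsOpen U)
    (φ : (ℝ × ℝ × ℝ) → ℝ) (hφ : ContDiffOn ℝ (⊤ : ℕ∞) φ U)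
    (hnd : ∀ p ∈ U, 1 + fderiv ℝ φ p (0, 1, 0) ≠ 0)
    (W : Set (ℝ × ℝ × ℝ)) (V : (ℝ × ℝ × ℝ) → (ℝ × ℝ × ℝ))
    (hW : IsOpen W) (hWU : W ⊆ U) (hV : ContDiffOn ℝ (⊤ : ℕ∞) V W)
    (hflow : ∀ (ε : ℝ) (W₀ : Set (ℝ × ℝ × ℝ)) (σ : ℝ → (ℝ × ℝ × ℝ) → (ℝ × ℝ × ℝ)),
        IsLocalFlowOf W V ε W₀ σ → ∀ t ∈ Set.Ioo (-ε) ε, ParaCRMapOn φ W₀ (σ t))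
    (p₀ : ℝ × ℝ × ℝ) (hp₀ : p₀ ∈ W) :
        ∃ (Ω : Set (ℝ × ℝ × ℝ × ℝ)) (Vt : (ℝ × ℝ × ℝ × ℝ) → ℝ × ℝ × ℝ × ℝ),
          IsOpen Ω ∧ iotaEmb φ p₀ ∈ Ω ∧ IsParaHolVF Ω Vt ∧
          ∀ p ∈ W, iotaEmb φ p ∈ Ω →
            Vt (iotaEmb φ p) = fderiv ℝ (iotaEmb φ) p (V p) := by
  have hφd : ∀ q ∈ U, ContDiffAt ℝ (⊤ : ℕ∞) φ q := fun q hq => hφ.contDiffAt (hU.mem_nhds hq)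
  have hφd' : ∀ q ∈ U, DifferentiableAt ℝ φ q := fun q hq => (hφd q hq).differentiableAt (by simp)
  obtain ⟨δ, hδ, N, hN, hpN, hNW, F, hF⟩ := local_flow hW hV hp₀
  have hlf : IsLocalFlowOf W V δ N F :=
    ⟨hδ, hN, hNW, fun p hp => (hF p hp).1, fun p hp t ht =>
      ⟨((hF p hp).2 t ht).1, ((hF p hp).2 t ht).2.1⟩⟩
  have hcr := hflow δ N F hlf
  have hz : (0:ℝ) ∈ Ioo (-δ) δ := ⟨by linarith, hδ⟩
  have hI : Ioo (-δ) δ ∈ 𝓝 (0:ℝ) := isOpen_Ioo.mem_nhds hz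
  have hFd : ∀ p ∈ N, ∀ t ∈ Ioo (-δ) δ, HasFDerivAt (F t) (fderiv ℝ (F t) p) p := by
    intro p hp t ht
    obtain ⟨A, -, hA⟩ := ((hF p hp).2 t ht).2.2
    exact hA.differentiableAt.hasFDerivAt
  have hF0 : ∀ p ∈ N, HasDerivAt (fun s => F s p) (V p) 0 := by
    intro p hp
    have := ((hF p hp).2 0 hz).2.1
    rwa [(hF p hp).1] at this
  obtain ⟨r, hr, hrN⟩ := Metric.isOpen_iff.1 hN p₀ hpN
  -- independence of `x`
  have indx : ∀ p ∈ ball p₀ r, (V p).2 = (V (p₀.1, p.2)).2 := by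
    intro p hp
    rw [← ball_prod_same] at hp
    have hmem : ∀ x ∈ ball p₀.1 r, (x, p.2) ∈ N := fun x hx => hrN (by
      rw [← ball_prod_same]; exact ⟨hx, hp.2⟩)
    have hconst : ∀ t ∈ Ioo (-δ) δ, (F t p).2 = (F t (p₀.1, p.2)).2 := by
      intro t ht
      have hd : ∀ x ∈ ball p₀.1 r, HasDerivAt (fun s => (F t (s, p.2)).2) 0 x := by
        intro x hx
        have hline : HasDerivAt (fun s : ℝ => (s, p.2)) ((1 : ℝ), (0 : ℝ × ℝ)) x :=
          (hasDerivAt_id _).prodMk (hasDerivAt_const _ _)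
        have h1 := derivSnd (HasFDerivAt.comp_hasDerivAt (l := F t) x (hFd _ (hmem x hx) t ht) hline)
        obtain ⟨c, -, hc⟩ := (hcr t ht _ (hmem x hx)).1
        have h2 : fderiv ℝ (F t) (x, p.2) ((1 : ℝ), (0 : ℝ × ℝ)) = c • ((1 : ℝ), (0 : ℝ), (0 : ℝ)) := hc
        rw [h2] at h1
        have h3 : (c • ((1 : ℝ), (0 : ℝ), (0 : ℝ))).2 = 0 := by
          ext <;> simp
        rw [h3] at h1
        exact h1
      exact (convex_ball p₀.1 r).is_const_of_fderivWithin_eq_zero (𝕜 := ℝ)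
        (f := fun s => (F t (s, p.2)).2)
        (fun x hx => (hd x hx).differentiableAt.differentiableWithinAt)
        (fun x hx => by
          rw [fderivWithin_of_isOpen isOpen_ball hx]
          ext
          · simp [(hd x hx).deriv]
          · simp [(hd x hx).deriv]) hp.1 (mem_ball_self hr)
    have h1 := derivSnd (hF0 p (hmem p.1 hp.1))
    have h2 := derivSnd (hF0 _ (hmem p₀.1 (mem_ball_self hr)))
    refine h1.unique (h2.congr_of_eventuallyEq ?_)
    filter_upwards [hI] with t ht using hconst t ht
  obtain ⟨Ψ, hpΨ, hΨN, hΨ, hΨs, hΨd⟩ := chart hU hφ hnd (hWU hp₀) hN hpN (hNW.trans hWU)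
  have hzt := Ψ.map_source hpΨ
  obtain ⟨ρ, hρ, hρt⟩ := Metric.isOpen_iff.1 Ψ.open_target _ hzt
  -- independence of `b`
  have indb : ∀ z ∈ ball (Ψ p₀) ρ, xyDer φ (Ψ.symm z) (V (Ψ.symm z))
      = xyDer φ (Ψ.symm (z.1, z.2.1, p₀.2.2)) (V (Ψ.symm (z.1, z.2.1, p₀.2.2))) := by
    intro z hz'
    rw [← ball_prod_same, ← ball_prod_same] at hz'
    have hΨ2 : (Ψ p₀).2.2 = p₀.2.2 := by rw [hΨ]
    have hmem : ∀ s ∈ ball (Ψ p₀).2.2 ρ, (z.1, z.2.1, s) ∈ Ψ.target := fun s hs => hρt (by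
      rw [← ball_prod_same, ← ball_prod_same]; exact ⟨hz'.1, hz'.2.1, hs⟩)
    have hmemN : ∀ s ∈ ball (Ψ p₀).2.2 ρ, Ψ.symm (z.1, z.2.1, s) ∈ N := fun s hs =>
      hΨN (Ψ.map_target (hmem s hs))
    have hcen : p₀.2.2 ∈ ball (Ψ p₀).2.2 ρ := by rw [hΨ2]; exact mem_ball_self hρ
    have hconst : ∀ t ∈ Ioo (-δ) δ, xyMap φ (F t (Ψ.symm z))
        = xyMap φ (F t (Ψ.symm (z.1, z.2.1, p₀.2.2))) := by
      intro t ht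
      have hd : ∀ s ∈ ball (Ψ p₀).2.2 ρ,
          HasDerivAt (fun s => xyMap φ (F t (Ψ.symm (z.1, z.2.1, s)))) 0 s := by
        intro s hs
        have hqU := hWU ((hF _ (hmemN s hs)).2 t ht).1
        have h1 := HasFDerivAt.comp_hasDerivAt (l := F t) s (hFd _ (hmemN s hs) t ht)
          (hΨd _ (hmem s hs))
        obtain ⟨c, -, hc⟩ := (hcr t ht _ (hmemN s hs)).2
        rw [hc] at h1
        have h2 := HasFDerivAt.comp_hasDerivAt (l := xyMap φ) s
          (hasFDerivAt_xyMap (hφd' _ hqU)) h1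
        have h3 := xyDer_psi (hnd _ hqU) c
        rw [← h3]
        exact h2
      exact (convex_ball (Ψ p₀).2.2 ρ).is_const_of_fderivWithin_eq_zero (𝕜 := ℝ)
        (f := fun s => xyMap φ (F t (Ψ.symm (z.1, z.2.1, s))))
        (fun x hx => (hd x hx).differentiableAt.differentiableWithinAt)
        (fun x hx => by
          rw [fderivWithin_of_isOpen isOpen_ball hx]
          ext
          · simp [(hd x hx).deriv]
          · simp [(hd x hx).deriv]) hz'.2.2 hcen
    have hxyd : ∀ p ∈ N, HasDerivAt (fun s => xyMap φ (F s p)) (xyDer φ p (V p)) 0 := by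
      intro p hp
      refine HasFDerivAt.comp_hasDerivAt (l := xyMap φ) 0 ?_ (hF0 p hp)
      rw [(hF p hp).1]
      exact hasFDerivAt_xyMap (hφd' _ (hWU (hNW hp)))
    refine (hxyd _ (hmemN z.2.2 hz'.2.2)).unique
      ((hxyd _ (hmemN p₀.2.2 hcen)).congr_of_eventuallyEq ?_)
    filter_upwards [hI] with t ht using hconst t ht
  -- the ambient field
  let S : Set (ℝ × ℝ × ℝ) := ball p₀ r ∩ Ψ.source
  have hS : IsOpen S := isOpen_ball.inter Ψ.open_source
  let Ω : Set (ℝ × ℝ × ℝ × ℝ) :=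
    {q | (q.1, q.2.1, q.2.2.2) ∈ ball (Ψ p₀) ρ} ∩ {q | (q.1, q.2.2.1, q.2.2.2) ∈ S}
  let X : ℝ × ℝ → ℝ × ℝ := fun z =>
    xyDer φ (Ψ.symm (z.1, z.2, p₀.2.2)) (V (Ψ.symm (z.1, z.2, p₀.2.2)))
  let Y : ℝ × ℝ → ℝ × ℝ := fun z => (V (p₀.1, z)).2
  have hXW : ContDiffOn ℝ (⊤ : ℕ∞) (fun p => xyDer φ p (V p)) W := by
    have h1 : ContDiffOn ℝ (⊤ : ℕ∞) (fderiv ℝ φ) W := by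
      have := hφ.fderiv_of_isOpen (m := (⊤ : ℕ∞)) hU (by norm_cast)
      exact this.mono hWU
    exact hV.fst.prodMk (hV.snd.fst.add (h1.clm_apply hV))
  refine ⟨Ω, fun q => ((X (q.1, q.2.1)).1, (X (q.1, q.2.1)).2, (Y (q.2.2.1, q.2.2.2)).1,
    (Y (q.2.2.1, q.2.2.2)).2), ?_, ?_, ⟨?_, fun z => (X z).1, fun z => (X z).2, fun z => (Y z).1,
    fun z => (Y z).2, fun q _ => rfl⟩, ?_⟩
  · exact (isOpen_ball.preimage (by fun_prop)).inter (hS.preimage (by fun_prop))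
  · refine ⟨?_, ⟨mem_ball_self hr, hpΨ⟩⟩
    change ((iotaEmb φ p₀).1, (iotaEmb φ p₀).2.1, (iotaEmb φ p₀).2.2.2) ∈ ball (Ψ p₀) ρ
    rw [hΨ]
    exact mem_ball_self hρ
  · have hX : ContDiffOn ℝ (⊤ : ℕ∞) (fun q : ℝ × ℝ × ℝ × ℝ => X (q.1, q.2.1)) Ω := by
      have hmt : ∀ q ∈ Ω, (q.1, q.2.1, p₀.2.2) ∈ Ψ.target := by
        intro q hq
        refine hρt ?_
        have h1 : (q.1, q.2.1, q.2.2.2) ∈ ball (Ψ p₀) ρ := hq.1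
        rw [← ball_prod_same, ← ball_prod_same] at h1 ⊢
        refine ⟨h1.1, h1.2.1, ?_⟩
        rw [hΨ]
        exact mem_ball_self hρ
      have h1 : ContDiffOn ℝ (⊤ : ℕ∞)
          (fun q : ℝ × ℝ × ℝ × ℝ => Ψ.symm (q.1, q.2.1, p₀.2.2)) Ω :=
        hΨs.comp (g := Ψ.symm) (f := fun q : ℝ × ℝ × ℝ × ℝ => (q.1, q.2.1, p₀.2.2))
          (by fun_prop) hmt
      exact hXW.comp h1 (fun q hq => hNW (hΨN (Ψ.map_target (hmt q hq))))
    have hY : ContDiffOn ℝ (⊤ : ℕ∞) (fun q : ℝ × ℝ × ℝ × ℝ => Y (q.2.2.1, q.2.2.2)) Ω := by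
      refine (hV.comp (g := V) (f := fun q : ℝ × ℝ × ℝ × ℝ => (p₀.1, q.2.2.1, q.2.2.2))
          (by fun_prop) ?_).snd
      intro q hq
      have h1 : (q.1, q.2.2.1, q.2.2.2) ∈ ball p₀ r := hq.2.1
      rw [← ball_prod_same] at h1
      refine hNW (hrN ?_)
      rw [← ball_prod_same]
      exact ⟨mem_ball_self hr, h1.2⟩
    exact hX.fst.prodMk (hX.snd.prodMk (hY.fst.prodMk hY.snd))
  · intro p hp hpΩ
    have h1 : p ∈ S := hpΩ.2
    have h2 : Ψ p ∈ ball (Ψ p₀) ρ := by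
      have := hpΩ.1
      rw [hΨ p]
      exact this
    have h3 := indx p h1.1
    have h4 := indb _ h2
    rw [Ψ.left_inv h1.2, hΨ p, xyDer_apply] at h4
    rw [fderiv_iota (hφd' p (hWU hp))]
    have h5 : X ((iotaEmb φ p).1, (iotaEmb φ p).2.1) = ((V p).1, (V p).2.1 + fderiv ℝ φ p (V p)) :=
      h4.symm
    have h6 : Y ((iotaEmb φ p).2.2.1, (iotaEmb φ p).2.2.2) = (V p).2 := h3.symm
    simp only [h5, h6]


end

/-- (1) a smooth vector field on (an open piece of) the embedded
para-CR manifold `M = ι(U)` whose local flow maps are local para-CR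
automorphisms extends, near every point, to a para-holomorphic vector field on an
open subset of `ℝ⁴`; (2) conversely, the restriction to `M` of a para-holomorphic
vector field tangent to `M` is a local infinitesimal para-CR automorphism, i.e.
its local flow maps are local para-CR automorphisms.  Vector fields on `M` are
read in the parameter coordinates `(x,a,b)`; the corresponding field on `M ⊆ ℝ⁴`
is `dι ∘ V`. -/
theorem stmt_5
    (U : Set (ℝ × ℝ × ℝ)) (hU : IsOpen U)
    (φ : (ℝ × ℝ × ℝ) → ℝ) (hφ : ContDiffOn ℝ (⊤ : ℕ∞) φ U)
    (hnd : ∀ p ∈ U, 1 + fderiv ℝ φ p (0, 1, 0) ≠ 0) :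
    -- (1)
    (∀ (W : Set (ℝ × ℝ × ℝ)) (V : (ℝ × ℝ × ℝ) → (ℝ × ℝ × ℝ)),
      IsOpen W → W ⊆ U → ContDiffOn ℝ (⊤ : ℕ∞) V W →
      (∀ (ε : ℝ) (W₀ : Set (ℝ × ℝ × ℝ)) (σ : ℝ → (ℝ × ℝ × ℝ) → (ℝ × ℝ × ℝ)),
        IsLocalFlowOf W V ε W₀ σ → ∀ t ∈ Set.Ioo (-ε) ε, ParaCRMapOn φ W₀ (σ t)) →
      ∀ p₀ ∈ W,
        ∃ (Ω : Set (ℝ × ℝ × ℝ × ℝ)) (Vt : (ℝ × ℝ × ℝ × ℝ) → ℝ × ℝ × ℝ × ℝ),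
          IsOpen Ω ∧ iotaEmb φ p₀ ∈ Ω ∧ IsParaHolVF Ω Vt ∧
          ∀ p ∈ W, iotaEmb φ p ∈ Ω →
            Vt (iotaEmb φ p) = fderiv ℝ (iotaEmb φ) p (V p)) ∧
    -- (2)
    (∀ (Ω : Set (ℝ × ℝ × ℝ × ℝ)) (Vt : (ℝ × ℝ × ℝ × ℝ) → ℝ × ℝ × ℝ × ℝ),
      IsOpen Ω → IsParaHolVF Ω Vt →
      (∀ p ∈ U, iotaEmb φ p ∈ Ω →
        ∃ w : ℝ × ℝ × ℝ, Vt (iotaEmb φ p) = fderiv ℝ (iotaEmb φ) p w) →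
      ∀ V : (ℝ × ℝ × ℝ) → (ℝ × ℝ × ℝ),
        (∀ p ∈ U, iotaEmb φ p ∈ Ω →
          fderiv ℝ (iotaEmb φ) p (V p) = Vt (iotaEmb φ p)) →
        ∀ (ε : ℝ) (W₀ : Set (ℝ × ℝ × ℝ)) (σ : ℝ → (ℝ × ℝ × ℝ) → (ℝ × ℝ × ℝ)),
          IsLocalFlowOf {p ∈ U | iotaEmb φ p ∈ Ω} V ε W₀ σ →
          ∀ t ∈ Set.Ioo (-ε) ε, ParaCRMapOn φ W₀ (σ t)) := by
  refine ⟨fun W V hW hWU hV hflow p₀ hp₀ =>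
    part_one U hU φ hφ hnd W V hW hWU hV hflow p₀ hp₀, ?_⟩
  intro Ω Vt hΩ hVt _ V hV ε W₀ σ hσ
  exact part_two U hU φ hφ hnd Ω Vt hΩ hVt V hV ε W₀ σ hσ
end

section
/- Let k ≥ 2 be an integer and γ₁,…,γ_{k−1} real numbers, not all zero. Let ρ(x,y,a,b) = y − a − ∑_{i=1}^{k−1} γᵢ bⁱ x^{k−i} − a·g(x,a,b) − h(x,b), where g and h are real-analytic near the origin, g(0,0,0) = 0, and h vanishes to order at least k+1 at the origin, and let M = {ρ = 0}. Then: (1) for every real-analytic para-holomorphic curve F(s,t) = (x(t), y(t), a(s), b(s)) with F(0,0) = 0 that is regular at (0,0), i.e. (x′(0), y′(0)) ≠ (0,0) and (a′(0), b′(0)) ≠ (0,0), the function ρ∘F vanishes at (0,0) to order at most k (in particular it is not identically zero); (2) the regular para-holomorphic curve F(s,t) = (t, 0, 0, s) has ρ∘F vanishing at (0,0) to order exactly k. Hence M is of finite type exactly k at the origin. -/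
open Asymptotics Filter Topology

lemma aux_norm_left (s : ℝ) : ‖((s, 0) : ℝ × ℝ)‖ = ‖s‖ := by
  simp [Prod.norm_def]

lemma aux_norm_right (s : ℝ) : ‖((0, s) : ℝ × ℝ)‖ = ‖s‖ := by
  simp [Prod.norm_def]

lemma aux_bigO_of_deriv (f : ℝ → ℝ) (hf : DifferentiableAt ℝ f 0) (h0 : f 0 = 0) :
    f =O[𝓝 0] fun t : ℝ => ‖t‖ := by
  have := hf.hasFDerivAt.isBigO_sub
  simp only [h0, sub_zero] at this
  exact this.norm_right

lemma aux_deriv_zero (f : ℝ → ℝ) (n : ℕ) (hn : 1 < n)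
    (hf : f =O[𝓝 0] fun t : ℝ => ‖t‖ ^ n) : deriv f 0 = 0 := by
  have h1 : HasFDerivAt f (0 : ℝ →L[ℝ] ℝ) 0 :=
    IsBigO.hasFDerivAt (n := n) (by simpa using hf) hn
  simpa using h1.hasDerivAt.deriv

lemma aux_tendsto_slope (f : ℝ → ℝ) (hf : DifferentiableAt ℝ f 0) (h0 : f 0 = 0) (u : ℝ) :
    Tendsto (fun l : ℝ => f (u * l) / l) (𝓝[≠] 0) (𝓝 (u * deriv f 0)) := by
  have h1 : HasDerivAt (fun l : ℝ => f (u * l)) (deriv f 0 * u) 0 := by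
    have h2 : HasDerivAt (fun l : ℝ => u * l) u 0 := by
      simpa using (hasDerivAt_id (0 : ℝ)).const_mul u
    have h3 : HasDerivAt f (deriv f 0) (u * 0) := by simpa using hf.hasDerivAt
    exact h3.comp (0 : ℝ) h2
  have h4 := hasDerivAt_iff_tendsto_slope_zero.mp h1
  simp only [zero_add, mul_zero, h0, sub_zero, smul_eq_mul] at h4
  rw [mul_comm u]
  refine h4.congr fun l => ?_
  rw [div_eq_inv_mul]

lemma aux_poly (k : ℕ) (γ : ℕ → ℝ) (β ξ : ℝ) (hβ : β ≠ 0) (hξ : ξ ≠ 0)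
    (H : ∀ u : ℝ, ∑ i ∈ Finset.Icc 1 (k - 1), γ i * (u * β) ^ i * ξ ^ (k - i) = 0) :
    ∀ i ∈ Finset.Icc 1 (k - 1), γ i = 0 := by
  intro i hi
  have hp : (∑ j ∈ Finset.Icc 1 (k - 1),
      Polynomial.C (γ j * β ^ j * ξ ^ (k - j)) * Polynomial.X ^ j : Polynomial ℝ) = 0 := by
    apply Polynomial.funext
    intro u
    rw [Polynomial.eval_finsetSum, Polynomial.eval_zero, ← H u]
    refine Finset.sum_congr rfl fun j _ => ?_
    simp only [Polynomial.eval_mul, Polynomial.eval_C, Polynomial.eval_pow, Polynomial.eval_X]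
    ring
  have hc := congrArg (fun p => Polynomial.coeff p i) hp
  simp only [Polynomial.finsetSum_coeff, Polynomial.coeff_C_mul, Polynomial.coeff_X_pow,
    Polynomial.coeff_zero, mul_ite, mul_one, mul_zero, Finset.sum_ite_eq, hi, if_true] at hc
  simpa [hβ, hξ] using hc

lemma aux_final (k : ℕ) (γ : ℕ → ℝ) (x b : ℝ → ℝ)
    (hx : DifferentiableAt ℝ x 0) (hb : DifferentiableAt ℝ b 0) (x0 : x 0 = 0) (b0 : b 0 = 0)
    (hx' : deriv x 0 ≠ 0) (hb' : deriv b 0 ≠ 0)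
    (H : (fun v : ℝ × ℝ => ∑ i ∈ Finset.Icc 1 (k - 1), γ i * b v.1 ^ i * x v.2 ^ (k - i))
      =O[𝓝 0] fun v : ℝ × ℝ => ‖v‖ ^ (k + 1)) :
    ∀ i ∈ Finset.Icc 1 (k - 1), γ i = 0 := by
  apply aux_poly k γ _ _ hb' hx'
  intro u
  have ht : Tendsto (fun l : ℝ => ((u * l, 1 * l) : ℝ × ℝ)) (𝓝 0) (𝓝 0) := by
    have : Continuous (fun l : ℝ => ((u * l, 1 * l) : ℝ × ℝ)) := by fun_prop
    simpa [← Prod.mk_zero_zero] using this.tendsto 0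
  have h1 := H.comp_tendsto ht
  have h2 : ((fun v : ℝ × ℝ => ‖v‖ ^ (k + 1)) ∘ fun l : ℝ => ((u * l, 1 * l) : ℝ × ℝ))
      =O[𝓝 0] fun l : ℝ => l ^ (k + 1) := by
    have : (fun l : ℝ => ((u * l, 1 * l) : ℝ × ℝ)) =O[𝓝 0] fun l : ℝ => l :=
      (isBigO_const_mul_self u _ _).prod_left (isBigO_const_mul_self 1 _ _)
    exact this.norm_left.pow (k + 1)
  have h3 := (h1.trans h2).trans_isLittleO
    (isLittleO_pow_pow (𝕜 := ℝ) (Nat.lt_succ_self k))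
  have h4 := (h3.mono (nhdsWithin_le_nhds (s := {0}ᶜ))).tendsto_div_nhds_zero
  have h5 : Tendsto (fun l : ℝ => ∑ i ∈ Finset.Icc 1 (k - 1),
      γ i * (b (u * l) / l) ^ i * (x (1 * l) / l) ^ (k - i)) (𝓝[≠] 0)
      (𝓝 (∑ i ∈ Finset.Icc 1 (k - 1),
        γ i * (u * deriv b 0) ^ i * (1 * deriv x 0) ^ (k - i))) := by
    refine tendsto_finsetSum _ fun i _ => ?_
    exact (((aux_tendsto_slope b hb b0 u).pow i).const_mul (γ i)).mul
      ((aux_tendsto_slope x hx x0 1).pow (k - i))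
  rw [one_mul] at h5
  refine tendsto_nhds_unique h5 (h4.congr' ?_)
  filter_upwards [self_mem_nhdsWithin] with l hl
  have hl' : l ≠ 0 := hl
  simp only [Function.comp, Finset.sum_div]
  refine Finset.sum_congr rfl fun i hi => ?_
  have hik : k = i + (k - i) := by
    have := Finset.mem_Icc.mp hi
    omega
  have : l ^ k = l ^ i * l ^ (k - i) := by rw [← pow_add, ← hik]
  rw [this, div_pow, div_pow]
  field_simp

/-- Finite type of the hypersurface
`M = {y = a + ∑_{i=1}^{k-1} γᵢ bⁱ x^{k-i} + a·g(x,a,b) + h(x,b)}` in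
`ℝ⁴ = ℝ²_{xy} × ℝ²_{ab}` (coordinates `(x,y,a,b)`), where `g, h` are
real-analytic near `0`, `g(0) = 0` and `h` vanishes to order `≥ k+1` at `0`:
(1) for every regular real-analytic para-holomorphic curve
`F(s,t) = (x(t), y(t), a(s), b(s))` through `0`, `ρ ∘ F` vanishes at `(0,0)` to
order at most `k` (it is not `O(‖(s,t)‖^{k+1})`, in particular not identically
zero near `(0,0)`);
(2) the regular para-holomorphic curve `F(s,t) = (t, 0, 0, s)` realises the
order of contact exactly `k`.  Hence `M` is of finite type exactly `k` at `0`. -/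
theorem stmt_6
    (k : ℕ) (hk : 2 ≤ k) (γ : ℕ → ℝ)
    (hγ : ∃ i ∈ Finset.Icc 1 (k - 1), γ i ≠ 0)
    (g : (ℝ × ℝ × ℝ) → ℝ) (h : (ℝ × ℝ) → ℝ)
    (hg : AnalyticAt ℝ g 0) (hg0 : g 0 = 0)
    (hh : AnalyticAt ℝ h 0)
    (hhord : h =O[nhds (0 : ℝ × ℝ)] fun p : ℝ × ℝ => ‖p‖ ^ (k + 1))
    (ρ : (ℝ × ℝ × ℝ × ℝ) → ℝ)
    (hρ : ρ = fun q : ℝ × ℝ × ℝ × ℝ =>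
      q.2.1 - q.2.2.1 - (∑ i ∈ Finset.Icc 1 (k - 1), γ i * q.2.2.2 ^ i * q.1 ^ (k - i))
        - q.2.2.1 * g (q.1, q.2.2.1, q.2.2.2) - h (q.1, q.2.2.2)) :
    -- (1)
    (∀ x y a b : ℝ → ℝ,
      AnalyticAt ℝ x 0 → AnalyticAt ℝ y 0 → AnalyticAt ℝ a 0 → AnalyticAt ℝ b 0 →
      x 0 = 0 → y 0 = 0 → a 0 = 0 → b 0 = 0 →
      ((deriv x 0, deriv y 0) : ℝ × ℝ) ≠ 0 →
      ((deriv a 0, deriv b 0) : ℝ × ℝ) ≠ 0 →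
      ¬ ((fun v : ℝ × ℝ => ρ (x v.2, y v.2, a v.1, b v.1))
          =O[nhds (0 : ℝ × ℝ)] fun v : ℝ × ℝ => ‖v‖ ^ (k + 1))) ∧
    -- (2)
    (((fun v : ℝ × ℝ => ρ (v.2, 0, 0, v.1))
        =O[nhds (0 : ℝ × ℝ)] fun v : ℝ × ℝ => ‖v‖ ^ k) ∧
      ¬ ((fun v : ℝ × ℝ => ρ (v.2, 0, 0, v.1))
          =O[nhds (0 : ℝ × ℝ)] fun v : ℝ × ℝ => ‖v‖ ^ (k + 1))) := by
  have hpart : ∀ x y a b : ℝ → ℝ,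
      AnalyticAt ℝ x 0 → AnalyticAt ℝ y 0 → AnalyticAt ℝ a 0 → AnalyticAt ℝ b 0 →
      x 0 = 0 → y 0 = 0 → a 0 = 0 → b 0 = 0 →
      ((deriv x 0, deriv y 0) : ℝ × ℝ) ≠ 0 →
      ((deriv a 0, deriv b 0) : ℝ × ℝ) ≠ 0 →
      ¬ ((fun v : ℝ × ℝ => ρ (x v.2, y v.2, a v.1, b v.1))
          =O[nhds (0 : ℝ × ℝ)] fun v : ℝ × ℝ => ‖v‖ ^ (k + 1)) := by
    intro x y a b hx hy ha hb x0 y0 a0 b0 hxy hab H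
    have hfst : Tendsto (fun v : ℝ × ℝ => v.1) (𝓝 0) (𝓝 (0 : ℝ)) := continuous_fst.tendsto _
    have hsnd : Tendsto (fun v : ℝ × ℝ => v.2) (𝓝 0) (𝓝 (0 : ℝ)) := continuous_snd.tendsto _
    have hl : Tendsto (fun s : ℝ => ((s, 0) : ℝ × ℝ)) (𝓝 0) (𝓝 0) :=
      (by fun_prop : Continuous (fun s : ℝ => ((s, 0) : ℝ × ℝ))).tendsto 0
    have hr : Tendsto (fun s : ℝ => ((0, s) : ℝ × ℝ)) (𝓝 0) (𝓝 0) :=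
      (by fun_prop : Continuous (fun s : ℝ => ((0, s) : ℝ × ℝ))).tendsto 0
    have cx : Tendsto x (𝓝 0) (𝓝 0) := by simpa [x0] using hx.continuousAt.tendsto
    have ca : Tendsto a (𝓝 0) (𝓝 0) := by simpa [a0] using ha.continuousAt.tendsto
    have cb : Tendsto b (𝓝 0) (𝓝 0) := by simpa [b0] using hb.continuousAt.tendsto
    have bfst : (fun v : ℝ × ℝ => v.1) =O[𝓝 0] fun v : ℝ × ℝ => ‖v‖ :=
      isBigO_fst_prod'.norm_right
    have bsnd : (fun v : ℝ × ℝ => v.2) =O[𝓝 0] fun v : ℝ × ℝ => ‖v‖ :=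
      isBigO_snd_prod'.norm_right
    -- the term `h`
    have Hh : (fun v : ℝ × ℝ => h (x v.2, b v.1)) =O[𝓝 0] fun v : ℝ × ℝ => ‖v‖ ^ (k + 1) := by
      have t1 : Tendsto (fun v : ℝ × ℝ => ((x v.2, b v.1) : ℝ × ℝ)) (𝓝 0) (𝓝 0) :=
        (cx.comp hsnd).prodMk_nhds (cb.comp hfst)
      refine (hhord.comp_tendsto t1).trans ?_
      have t2 : (fun v : ℝ × ℝ => ((x v.2, b v.1) : ℝ × ℝ)) =O[𝓝 0] fun v : ℝ × ℝ => ‖v‖ :=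
        (((aux_bigO_of_deriv x hx.differentiableAt x0).comp_tendsto hsnd).trans
          bsnd.norm_left).prod_left
        (((aux_bigO_of_deriv b hb.differentiableAt b0).comp_tendsto hfst).trans bfst.norm_left)
      exact t2.norm_left.pow (k + 1)
    have hsum0 : ∀ z : ℝ, ∑ i ∈ Finset.Icc 1 (k - 1), γ i * (0 : ℝ) ^ i * z ^ (k - i) = 0 := by
      intro z
      refine Finset.sum_eq_zero fun i hi => ?_
      have := Finset.mem_Icc.mp hi
      rw [zero_pow (by omega)]; ring
    have hsum1 : ∀ z : ℝ, ∑ i ∈ Finset.Icc 1 (k - 1), γ i * z ^ i * (0 : ℝ) ^ (k - i) = 0 := by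
      intro z
      refine Finset.sum_eq_zero fun i hi => ?_
      have := Finset.mem_Icc.mp hi
      rw [zero_pow (by omega)]; ring
    have H2 := H.add Hh
    simp only [hρ, sub_add_cancel] at H2
    -- `y` vanishes to order `k + 1`
    have Hy : y =O[𝓝 0] fun t : ℝ => ‖t‖ ^ (k + 1) := by
      have := H2.comp_tendsto hr
      simpa only [Function.comp_def, a0, b0, hsum0, aux_norm_right, sub_zero, zero_mul] using this
    -- `a` vanishes to order `k + 1`
    have Ha : a =O[𝓝 0] fun t : ℝ => ‖t‖ ^ (k + 1) := by
      have h1 := H2.comp_tendsto hl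
      simp only [Function.comp_def, x0, y0, hsum1, aux_norm_left, sub_zero, zero_sub] at h1
      have t1 : Tendsto (fun s : ℝ => ((0, a s, b s) : ℝ × ℝ × ℝ)) (𝓝 0) (𝓝 0) :=
        tendsto_const_nhds.prodMk_nhds (ca.prodMk_nhds cb)
      have t2 : Tendsto (fun s : ℝ => 1 + g (0, a s, b s)) (𝓝 0) (𝓝 1) := by
        have t3 : Tendsto (fun s : ℝ => g (0, a s, b s)) (𝓝 0) (𝓝 (g 0)) :=
          hg.continuousAt.tendsto.comp t1
        simpa [hg0] using t3.const_add 1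
      have t4 := ((t2.inv₀ one_ne_zero).isBigO_one ℝ).mul h1.neg_left
      simp only [one_mul] at t4
      refine t4.congr' ?_ EventuallyEq.rfl
      filter_upwards [t2.eventually_ne one_ne_zero] with s hs
      field_simp
      ring
    have dy := aux_deriv_zero y (k + 1) (by omega) Hy
    have da := aux_deriv_zero a (k + 1) (by omega) Ha
    have dx : deriv x 0 ≠ 0 := fun h0 => hxy (by rw [h0, dy]; rfl)
    have db : deriv b 0 ≠ 0 := fun h0 => hab (by rw [h0, da]; rfl)
    obtain ⟨i, hi, hne⟩ := hγ
    refine hne (aux_final k γ x b hx.differentiableAt hb.differentiableAt x0 b0 dx db ?_ i hi)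
    have Hy2 : (fun v : ℝ × ℝ => y v.2) =O[𝓝 0] fun v : ℝ × ℝ => ‖v‖ ^ (k + 1) :=
      (Hy.comp_tendsto hsnd).trans (bsnd.norm_left.pow (k + 1))
    have Ha2 : (fun v : ℝ × ℝ => a v.1) =O[𝓝 0] fun v : ℝ × ℝ => ‖v‖ ^ (k + 1) :=
      (Ha.comp_tendsto hfst).trans (bfst.norm_left.pow (k + 1))
    have Hg : (fun v : ℝ × ℝ => g (x v.2, a v.1, b v.1)) =O[𝓝 0] fun _ : ℝ × ℝ => (1 : ℝ) := by
      have t1 : Tendsto (fun v : ℝ × ℝ => ((x v.2, a v.1, b v.1) : ℝ × ℝ × ℝ)) (𝓝 0) (𝓝 0) :=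
        (cx.comp hsnd).prodMk_nhds ((ca.comp hfst).prodMk_nhds (cb.comp hfst))
      exact (hg.continuousAt.tendsto.comp t1).isBigO_one ℝ
    have Hag := Ha2.mul Hg
    simp only [mul_one] at Hag
    refine (((Hy2.sub Ha2).sub Hag).sub H2).congr_left fun v => ?_
    ring
  refine ⟨hpart, ?_, ?_⟩
  · have e : (fun v : ℝ × ℝ => ρ (v.2, 0, 0, v.1)) = fun v : ℝ × ℝ =>
        -(∑ i ∈ Finset.Icc 1 (k - 1), γ i * v.1 ^ i * v.2 ^ (k - i)) - h (v.2, v.1) := by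
      funext v
      simp [hρ]
    rw [e]
    have bfst : (fun v : ℝ × ℝ => v.1) =O[𝓝 0] fun v : ℝ × ℝ => ‖v‖ :=
      isBigO_fst_prod'.norm_right
    have bsnd : (fun v : ℝ × ℝ => v.2) =O[𝓝 0] fun v : ℝ × ℝ => ‖v‖ :=
      isBigO_snd_prod'.norm_right
    refine IsBigO.sub (IsBigO.neg_left (IsBigO.fun_sum fun i hi => ?_)) ?_
    · have := ((bfst.pow i).const_mul_left (γ i)).mul (bsnd.pow (k - i))
      refine this.congr_right fun v => ?_
      have := Finset.mem_Icc.mp hi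
      rw [← pow_add]
      congr 1
      omega
    · have t1 : Tendsto (fun v : ℝ × ℝ => ((v.2, v.1) : ℝ × ℝ)) (𝓝 0) (𝓝 0) :=
        (by fun_prop : Continuous (fun v : ℝ × ℝ => ((v.2, v.1) : ℝ × ℝ))).tendsto 0
      refine (hhord.comp_tendsto t1).trans ?_
      have t2 := (bsnd.prod_left bfst).norm_left.pow (k + 1)
      refine t2.trans ?_
      have t3 : (fun v : ℝ × ℝ => ‖v‖) =O[𝓝 0] fun _ : ℝ × ℝ => (1 : ℝ) :=
        (continuous_norm.tendsto (0 : ℝ × ℝ)).isBigO_one ℝ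
      have t4 := (isBigO_refl (fun v : ℝ × ℝ => ‖v‖ ^ k) (𝓝 0)).mul t3
      simpa only [mul_one, ← pow_succ] using t4
  · refine hpart (fun t => t) (fun _ => 0) (fun _ => 0) (fun s => s) analyticAt_id
      analyticAt_const analyticAt_const analyticAt_id rfl rfl rfl rfl ?_ ?_ <;> simp
end

section
/- Fix an integer k > 2 and real numbers γ₁,…,γ_{k−1}, not all zero; let P(x,b) = ∑_{i=1}^{k−1} γᵢ bⁱ x^{k−i} and S = {y = a + P(x,b)} ⊂ ℝ⁴. Consider polynomial para-holomorphic vector fields that are weighted-homogeneous of weight k, i.e. of the form V = (α₂a² + α₁ab^k + α₀b^{2k})∂_a + (β₁ab + β₀b^{k+1})∂_b + (ξ₁xy + ξ₀x^{k+1})∂_x + (η₂y² + η₁x^k y + η₀x^{2k})∂_y. Then: (1) if at least two of the γᵢ are nonzero, the only such vector field tangent to S is V = 0; (2) if P(x,b) = γ·bᶦx^{k−ᶦ} with γ ≠ 0 and 1 ≤ ι ≤ k−1, then the space of such vector fields tangent to S is the one-dimensional span of V_k = a²∂_a + (1/ι)ab∂_b + (1/(k−ι))xy∂_x + y²∂_y.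 -/
/-- The polynomial `P(x,b) = ∑_{i=1}^{k-1} γᵢ bⁱ x^{k-i}`. -/
def Ppoly (k : ℕ) (γ : ℕ → ℝ) (x b : ℝ) : ℝ :=
  ∑ i ∈ Finset.Icc 1 (k - 1), γ i * b ^ i * x ^ (k - i)

/-- Tangency to `S = {y = a + P(x,b)}` of the para-holomorphic vector field
`ξ(x,y)∂_x + η(x,y)∂_y + α(a,b)∂_a + β(a,b)∂_b`:
`α + β·∂_bP + ξ·∂_xP − η = 0` whenever `y = a + P(x,b)`. -/
def TangentVF (k : ℕ) (γ : ℕ → ℝ) (ξ η α β : ℝ → ℝ → ℝ) : Prop :=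
  ∀ x a b : ℝ,
    α a b + β a b * deriv (fun t => Ppoly k γ x t) b
      + ξ x (a + Ppoly k γ x b) * deriv (fun t => Ppoly k γ t b) x
      - η x (a + Ppoly k γ x b) = 0

open Polynomial in
/-- The polynomial with coefficients `f i` for `1 ≤ i ≤ k-1`. -/
noncomputable def Gp (k : ℕ) (f : ℕ → ℝ) : Polynomial ℝ :=
  ∑ i ∈ Finset.Icc 1 (k - 1), Polynomial.C (f i) * Polynomial.X ^ i

theorem Gp_coeff (k : ℕ) (f : ℕ → ℝ) (n : ℕ) :
    (Gp k f).coeff n = if n ∈ Finset.Icc 1 (k - 1) then f n else 0 := by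
  unfold Gp
  rw [Polynomial.finsetSum_coeff]
  simp only [Polynomial.coeff_C_mul_X_pow]
  rw [Finset.sum_ite_eq]

theorem Gp_eval (k : ℕ) (f : ℕ → ℝ) (b : ℝ) :
    (Gp k f).eval b = ∑ i ∈ Finset.Icc 1 (k - 1), f i * b ^ i := by
  simp [Gp, Polynomial.eval_finsetSum]

theorem deriv_b (k : ℕ) (γ : ℕ → ℝ) (x b : ℝ) :
    b * deriv (fun t => Ppoly k γ x t) b
      = ∑ i ∈ Finset.Icc 1 (k - 1), (i : ℝ) * (γ i * b ^ i * x ^ (k - i)) := by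
  have h : HasDerivAt (fun t => Ppoly k γ x t)
      (∑ i ∈ Finset.Icc 1 (k - 1), γ i * ((i : ℝ) * b ^ (i - 1)) * x ^ (k - i)) b := by
    unfold Ppoly
    apply HasDerivAt.fun_sum
    intro i _
    exact ((hasDerivAt_pow i b).const_mul _).mul_const _
  rw [h.deriv, Finset.mul_sum]
  apply Finset.sum_congr rfl
  intro i hi
  rw [Finset.mem_Icc] at hi
  obtain ⟨n, rfl⟩ : ∃ n, i = n + 1 := ⟨i - 1, by omega⟩
  simp only [Nat.add_sub_cancel]
  ring

theorem deriv_x (k : ℕ) (γ : ℕ → ℝ) (x b : ℝ) :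
    x * deriv (fun t => Ppoly k γ t b) x
      = ∑ i ∈ Finset.Icc 1 (k - 1), ((k : ℝ) - i) * (γ i * b ^ i * x ^ (k - i)) := by
  have h : HasDerivAt (fun t => Ppoly k γ t b)
      (∑ i ∈ Finset.Icc 1 (k - 1), γ i * b ^ i * (((k - i : ℕ) : ℝ) * x ^ (k - i - 1))) x := by
    unfold Ppoly
    apply HasDerivAt.fun_sum
    intro i _
    exact (hasDerivAt_pow (k - i) x).const_mul _
  rw [h.deriv, Finset.mul_sum]
  apply Finset.sum_congr rfl
  intro i hi
  rw [Finset.mem_Icc] at hi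
  obtain ⟨n, rfl⟩ : ∃ n, k = n + 1 + i := ⟨k - i - 1, by omega⟩
  have e : n + 1 + i - i = n + 1 := by omega
  rw [e]
  simp only [Nat.add_sub_cancel]
  push_cast
  ring

theorem key (k : ℕ) (γ : ℕ → ℝ)
    (hγ : ∃ i ∈ Finset.Icc 1 (k - 1), γ i ≠ 0)
    (α₂ α₁ α₀ β₁ β₀ ξ₁ ξ₀ η₂ η₁ η₀ : ℝ)
    (h : TangentVF k γ
          (fun x y => ξ₁ * x * y + ξ₀ * x ^ (k + 1))
          (fun x y => η₂ * y ^ 2 + η₁ * x ^ k * y + η₀ * x ^ (2 * k))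
          (fun a b => α₂ * a ^ 2 + α₁ * a * b ^ k + α₀ * b ^ (2 * k))
          (fun a b => β₁ * a * b + β₀ * b ^ (k + 1))) :
    α₂ = η₂ ∧ α₁ = 0 ∧ α₀ = 0 ∧ β₀ = 0 ∧ ξ₀ = 0 ∧ η₁ = 0 ∧ η₀ = 0 ∧
      ∀ i ∈ Finset.Icc 1 (k - 1), γ i ≠ 0 →
        ξ₁ * ((k : ℝ) - i) = η₂ ∧ β₁ * i = η₂ := by
  obtain ⟨i₀, hi₀, hγi₀⟩ := hγ
  set p := Gp k γ with hp
  set E := Gp k (fun i => (i : ℝ) * γ i) with hE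
  set F := Gp k (fun i => ((k : ℝ) - i) * γ i) with hF
  have H : ∀ a b : ℝ, α₂ * a ^ 2 + α₁ * a * b ^ k + α₀ * b ^ (2 * k)
      + (β₁ * a + β₀ * b ^ k) * E.eval b + (ξ₁ * (a + p.eval b) + ξ₀) * F.eval b
      - (η₂ * (a + p.eval b) ^ 2 + η₁ * (a + p.eval b) + η₀) = 0 := by
    intro a b
    have h1 := h 1 a b
    have hb := deriv_b k γ 1 b
    have hx := deriv_x k γ 1 b
    have e1 : Ppoly k γ 1 b = p.eval b := by
      rw [hp, Gp_eval]; simp [Ppoly]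
    have e2 : b * deriv (fun t => Ppoly k γ 1 t) b = E.eval b := by
      rw [hb, hE, Gp_eval]; apply Finset.sum_congr rfl; intros; simp; ring
    have e3 : deriv (fun t => Ppoly k γ t b) 1 = F.eval b := by
      rw [one_mul] at hx
      rw [hx, hF, Gp_eval]; apply Finset.sum_congr rfl; intros; simp; ring
    simp only [e1, e3, one_pow, mul_one] at h1
    rw [← e2]
    linear_combination h1
  have hA : α₂ = η₂ := by
    have h0 := H 0 0
    have h1 := H 1 0
    have h2 := H (-1) 0
    linarith
  have hB : ∀ b : ℝ, α₁ * b ^ k + β₁ * E.eval b + ξ₁ * F.eval b - 2 * η₂ * p.eval b - η₁ = 0 := by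
    intro b
    have h1 := H 1 b
    have h2 := H (-1) b
    linarith
  have hC : ∀ b : ℝ, α₀ * b ^ (2 * k) + β₀ * b ^ k * E.eval b + (ξ₁ * p.eval b + ξ₀) * F.eval b
      - (η₂ * p.eval b ^ 2 + η₁ * p.eval b + η₀) = 0 := by
    intro b
    linear_combination H 0 b
  have PB : Polynomial.C α₁ * Polynomial.X ^ k + Polynomial.C β₁ * E + Polynomial.C ξ₁ * F
      - Polynomial.C (2 * η₂) * p - Polynomial.C η₁ = 0 := by
    apply Polynomial.funext
    intro b
    simpa using hB b
  have PC : Polynomial.C α₀ * Polynomial.X ^ (2 * k)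
      + Polynomial.C β₀ * (E * Polynomial.X ^ k)
      + Polynomial.C ξ₀ * F + p * (Polynomial.C ξ₁ * F - Polynomial.C η₂ * p)
      - Polynomial.C η₁ * p - Polynomial.C η₀ = 0 := by
    apply Polynomial.funext
    intro b
    simp only [Polynomial.eval_add, Polynomial.eval_sub, Polynomial.eval_mul, Polynomial.eval_C,
      Polynomial.eval_pow, Polynomial.eval_X, Polynomial.eval_zero]
    linear_combination hC b
  set R := Polynomial.C ξ₁ * F - Polynomial.C η₂ * p with hR
  have hk : 1 ≤ i₀ ∧ i₀ < k := by rw [Finset.mem_Icc] at hi₀; omega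
  have p0 : p.coeff 0 = 0 := by simp [hp, Gp_coeff]
  have E0 : E.coeff 0 = 0 := by simp [hE, Gp_coeff]
  have F0 : F.coeff 0 = 0 := by simp [hF, Gp_coeff]
  have hout : ∀ n, k ≤ n → n ∉ Finset.Icc 1 (k - 1) := by
    intro n hn; rw [Finset.mem_Icc]; omega
  have pk : ∀ n, k ≤ n → p.coeff n = 0 := fun n hn => by
    rw [hp, Gp_coeff, if_neg (hout n hn)]
  have Ek : ∀ n, k ≤ n → E.coeff n = 0 := fun n hn => by
    rw [hE, Gp_coeff, if_neg (hout n hn)]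
  have Fk : ∀ n, k ≤ n → F.coeff n = 0 := fun n hn => by
    rw [hF, Gp_coeff, if_neg (hout n hn)]
  have R0 : R.coeff 0 = 0 := by simp [hR, F0, p0]
  have Rk : ∀ n, k ≤ n → R.coeff n = 0 := fun n hn => by simp [hR, Fk n hn, pk n hn]
  have cB := fun n => congrArg (fun q => Polynomial.coeff q n) PB
  have cC := fun n => congrArg (fun q => Polynomial.coeff q n) PC
  simp only [Polynomial.coeff_add, Polynomial.coeff_sub, Polynomial.coeff_C_mul,
    Polynomial.coeff_zero, Polynomial.coeff_C,
    Polynomial.coeff_mul_X_pow'] at cB cC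
  have hη₁ : η₁ = 0 := by
    have := cB 0
    rw [if_neg (by omega), E0, F0, p0] at this
    simpa using this
  have hα₁ : α₁ = 0 := by
    have := cB k
    rw [Ek k le_rfl, Fk k le_rfl, pk k le_rfl, hη₁] at this
    simpa using this
  have hη₀ : η₀ = 0 := by
    have := cC 0
    rw [if_neg (by omega), if_neg (by omega), F0, p0, Polynomial.mul_coeff_zero, p0] at this
    simpa using this
  have pR_high : ∀ M n, (∀ i, M < i → p.coeff i = 0) → k + M ≤ n → (p * R).coeff n = 0 := by
    intro M n hM hn
    rw [Polynomial.coeff_mul]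
    apply Finset.sum_eq_zero
    rintro ⟨i, j⟩ hij
    rw [Finset.HasAntidiagonal.mem_antidiagonal] at hij
    simp only at hij ⊢
    by_cases hi : M < i
    · rw [hM i hi, zero_mul]
    · rw [Rk j (by omega), mul_zero]
  have hα₀ : α₀ = 0 := by
    have := cC (2 * k)
    rw [if_pos le_rfl, if_pos (Nat.sub_self _), if_pos (by omega), Ek _ (by omega), Fk _ (by omega), pk _ (by omega),
      pR_high k _ (fun i hi => pk i hi.le) (by omega), if_neg (by omega)] at this
    simpa using this
  have pi₀ : p.coeff i₀ ≠ 0 := by rw [hp, Gp_coeff, if_pos hi₀]; exact hγi₀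
  have pne : p ≠ 0 := fun e => pi₀ (by rw [e]; simp)
  have mem_of : ∀ n, p.coeff n ≠ 0 → n ∈ Finset.Icc 1 (k - 1) ∧ γ n ≠ 0 := by
    intro n hn
    rw [hp, Gp_coeff] at hn
    split_ifs at hn with hc
    · exact ⟨hc, hn⟩
    · exact absurd rfl hn
  have hξ₀ : ξ₀ = 0 := by
    set m := p.natTrailingDegree
    have hm : p.coeff m ≠ 0 := by
      have := Polynomial.trailingCoeff_nonzero_iff_nonzero.mpr pne
      exact this
    obtain ⟨hm1, hm2⟩ := mem_of m hm
    have hm3 := Finset.mem_Icc.mp hm1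
    have hpR : (p * R).coeff m = 0 := by
      rw [Polynomial.coeff_mul]
      apply Finset.sum_eq_zero
      rintro ⟨i, j⟩ hij
      rw [Finset.HasAntidiagonal.mem_antidiagonal] at hij
      simp only at hij ⊢
      by_cases hi : i < m
      · rw [Polynomial.coeff_eq_zero_of_lt_natTrailingDegree hi, zero_mul]
      · have : j = 0 := by omega
        rw [this, R0, mul_zero]
    have := cC m
    rw [if_neg (by omega), if_neg (by omega), hpR, if_neg (by omega), hη₁] at this
    have hFm : F.coeff m = ((k : ℝ) - m) * γ m := by rw [hF, Gp_coeff, if_pos hm1]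
    have hlt : (m : ℝ) < k := by exact_mod_cast (by omega : m < k)
    have hFm0 : F.coeff m ≠ 0 := by
      rw [hFm]; exact mul_ne_zero (by linarith) hm2
    simpa [hFm0] using this
  have hβ₀ : β₀ = 0 := by
    set M := p.natDegree
    have hM : p.coeff M ≠ 0 := by
      have := Polynomial.leadingCoeff_ne_zero.mpr pne
      exact this
    obtain ⟨hm1, hm2⟩ := mem_of M hM
    have hm3 := Finset.mem_Icc.mp hm1
    have := cC (k + M)
    rw [if_neg (by omega), if_pos (by omega),
      pR_high M _ (fun i hi => Polynomial.coeff_eq_zero_of_natDegree_lt hi) le_rfl,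
      Fk _ (by omega), pk _ (by omega), if_neg (by omega), Nat.add_sub_cancel_left] at this
    have hEm : E.coeff M = (M : ℝ) * γ M := by rw [hE, Gp_coeff, if_pos hm1]
    have hpos : (0 : ℝ) < M := by exact_mod_cast (by omega : 0 < M)
    have hEm0 : E.coeff M ≠ 0 := by
      rw [hEm]; exact mul_ne_zero hpos.ne' hm2
    simpa [hEm0] using this
  have hRz : R = 0 := by
    have : p * R = 0 := by
      rw [hα₀, hβ₀, hξ₀, hη₁, hη₀] at PC
      simpa using PC
    exact (mul_eq_zero.mp this).resolve_left pne
  refine ⟨hA, hα₁, hα₀, hβ₀, hξ₀, hη₁, hη₀, ?_⟩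
  intro i hi hγi
  have h1 : R.coeff i = 0 := by rw [hRz]; simp
  have h2 := cB i
  have him := Finset.mem_Icc.mp hi
  rw [hR, Polynomial.coeff_sub, Polynomial.coeff_C_mul, Polynomial.coeff_C_mul, hF, hp,
    Gp_coeff, Gp_coeff, if_pos hi, if_pos hi] at h1
  rw [if_neg (by omega), if_neg (by omega), hF, hp, hE, Gp_coeff, Gp_coeff, Gp_coeff,
    if_pos hi, if_pos hi, if_pos hi] at h2
  have g1 : ξ₁ * ((k : ℝ) - i) = η₂ := by
    apply mul_right_cancel₀ hγi
    linear_combination h1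
  refine ⟨g1, ?_⟩
  apply mul_right_cancel₀ hγi
  linear_combination h2 - h1

/-- weighted-homogeneous para-holomorphic vector fields of weight `k`
(weights: `x, b ↦ 1`, `y, a ↦ k`) tangent to `S = {y = a + P(x,b)}`, `k > 2`:
(1) if at least two `γᵢ` are nonzero, only the zero field is tangent;
(2) if `P(x,b) = γ bᶥ x^{k-ι}` with `γ ≠ 0`, the tangent ones are exactly the
multiples of `V_k = a²∂_a + (1/ι)ab∂_b + (1/(k-ι))xy∂_x + y²∂_y`. -/
theorem stmt_7
    (k : ℕ) (hk : 2 < k) (γ : ℕ → ℝ)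
    (hγ : ∃ i ∈ Finset.Icc 1 (k - 1), γ i ≠ 0) :
    -- (1)
    ((∃ i ∈ Finset.Icc 1 (k - 1), ∃ j ∈ Finset.Icc 1 (k - 1),
        i ≠ j ∧ γ i ≠ 0 ∧ γ j ≠ 0) →
      ∀ α₂ α₁ α₀ β₁ β₀ ξ₁ ξ₀ η₂ η₁ η₀ : ℝ,
        TangentVF k γ
          (fun x y => ξ₁ * x * y + ξ₀ * x ^ (k + 1))
          (fun x y => η₂ * y ^ 2 + η₁ * x ^ k * y + η₀ * x ^ (2 * k))
          (fun a b => α₂ * a ^ 2 + α₁ * a * b ^ k + α₀ * b ^ (2 * k))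
          (fun a b => β₁ * a * b + β₀ * b ^ (k + 1)) →
        α₂ = 0 ∧ α₁ = 0 ∧ α₀ = 0 ∧ β₁ = 0 ∧ β₀ = 0 ∧
          ξ₁ = 0 ∧ ξ₀ = 0 ∧ η₂ = 0 ∧ η₁ = 0 ∧ η₀ = 0) ∧
    -- (2)
    (∀ ι : ℕ, 1 ≤ ι → ι ≤ k - 1 → ∀ c : ℝ, c ≠ 0 →
      (∀ i ∈ Finset.Icc 1 (k - 1), γ i = if i = ι then c else 0) →
      ∀ α₂ α₁ α₀ β₁ β₀ ξ₁ ξ₀ η₂ η₁ η₀ : ℝ,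
        (TangentVF k γ
          (fun x y => ξ₁ * x * y + ξ₀ * x ^ (k + 1))
          (fun x y => η₂ * y ^ 2 + η₁ * x ^ k * y + η₀ * x ^ (2 * k))
          (fun a b => α₂ * a ^ 2 + α₁ * a * b ^ k + α₀ * b ^ (2 * k))
          (fun a b => β₁ * a * b + β₀ * b ^ (k + 1)) ↔
        ∃ d : ℝ, ∀ x y a b : ℝ,
          ξ₁ * x * y + ξ₀ * x ^ (k + 1) = d * (1 / ((k : ℝ) - (ι : ℝ)) * (x * y)) ∧
          η₂ * y ^ 2 + η₁ * x ^ k * y + η₀ * x ^ (2 * k) = d * y ^ 2 ∧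
          α₂ * a ^ 2 + α₁ * a * b ^ k + α₀ * b ^ (2 * k) = d * a ^ 2 ∧
          β₁ * a * b + β₀ * b ^ (k + 1) = d * (1 / (ι : ℝ) * (a * b)))) := by
  constructor
  · rintro ⟨i, hi, j, hj, hij, hgi, hgj⟩ α₂ α₁ α₀ β₁ β₀ ξ₁ ξ₀ η₂ η₁ η₀ h
    obtain ⟨h1, h2, h3, h4, h5, h6, h7, h8⟩ := key k γ hγ _ _ _ _ _ _ _ _ _ _ h
    obtain ⟨a1, a2⟩ := h8 i hi hgi
    obtain ⟨b1, b2⟩ := h8 j hj hgj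
    have hne : (i : ℝ) - j ≠ 0 := sub_ne_zero.mpr (by exact_mod_cast hij)
    have hξ : ξ₁ = 0 := by
      apply mul_right_cancel₀ hne
      linear_combination b1 - a1
    have hβ : β₁ = 0 := by
      apply mul_right_cancel₀ hne
      linear_combination a2 - b2
    have hη : η₂ = 0 := by rw [← a1, hξ, zero_mul]
    exact ⟨h1.trans hη, h2, h3, hβ, h4, hξ, h5, hη, h6, h7⟩
  · intro ι hι1 hι2 c hc hγc α₂ α₁ α₀ β₁ β₀ ξ₁ ξ₀ η₂ η₁ η₀
    have hmem : ι ∈ Finset.Icc 1 (k - 1) := Finset.mem_Icc.mpr ⟨hι1, hι2⟩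
    have hιpos : (ι : ℝ) ≠ 0 := by exact_mod_cast (by omega : ι ≠ 0)
    have hlt : (ι : ℝ) < k := by exact_mod_cast (by omega : ι < k)
    have hkι : (k : ℝ) - ι ≠ 0 := by linarith
    constructor
    · intro h
      obtain ⟨h1, h2, h3, h4, h5, h6, h7, h8⟩ := key k γ hγ _ _ _ _ _ _ _ _ _ _ h
      obtain ⟨a1, a2⟩ := h8 ι hmem (by rw [hγc ι hmem, if_pos rfl]; exact hc)
      refine ⟨η₂, fun x y a b => ⟨?_, ?_, ?_, ?_⟩⟩
      · rw [h5, ← a1]; field_simp; ring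
      · rw [h6, h7]; ring
      · rw [h1, h2, h3]; ring
      · rw [h4, ← a2]; field_simp; ring
    · rintro ⟨d, hd⟩ x a b
      obtain ⟨e1, e2, e3, e4⟩ := hd x (a + Ppoly k γ x b) a b
      have hs : ∀ g : ℕ → ℝ, ∑ i ∈ Finset.Icc 1 (k - 1), g i * (γ i * b ^ i * x ^ (k - i))
          = g ι * (γ ι * b ^ ι * x ^ (k - ι)) := by
        intro g
        apply Finset.sum_eq_single_of_mem ι hmem
        intro j hj hne
        rw [hγc j hj, if_neg hne]; ring
      have hP : Ppoly k γ x b = γ ι * b ^ ι * x ^ (k - ι) := by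
        have := hs (fun _ => 1)
        simpa [Ppoly] using this
      have hb := deriv_b k γ x b
      have hx := deriv_x k γ x b
      rw [hs (fun i => (i : ℝ)), ← hP] at hb
      rw [hs (fun i => (k : ℝ) - i), ← hP] at hx
      simp only
      rw [e1, e2, e3, e4]
      have f1 : d * (1 / (ι : ℝ) * (a * b)) * deriv (fun t => Ppoly k γ x t) b
          = d * a * Ppoly k γ x b := by
        calc _ = d * a * (1 / (ι : ℝ)) * (b * deriv (fun t => Ppoly k γ x t) b) := by ring
          _ = _ := by rw [hb]; field_simp
      have f2 : d * (1 / ((k : ℝ) - ι) * (x * (a + Ppoly k γ x b)))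
            * deriv (fun t => Ppoly k γ t b) x
          = d * (a + Ppoly k γ x b) * Ppoly k γ x b := by
        calc _ = d * (a + Ppoly k γ x b) * (1 / ((k : ℝ) - ι))
              * (x * deriv (fun t => Ppoly k γ t b) x) := by ring
          _ = _ := by rw [hx]; field_simp
      rw [f1, f2]
      ring
end
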